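/- For every nonzero integer k, all integers x and y satisfying y² = x³ + k satisfy max{|x|, |y|} ≤ exp((10¹⁰·|k|)^10000). -/

import Mathlib

theorem differentiable_dslope {f : ℂ → ℂ} (hf : Differentiable ℂ f) (a : ℂ) :
    Differentiable ℂ (dslope f a) := by
  rw [← differentiableOn_univ] at hf ⊢
  exact (Complex.differentiableOn_dslope Filter.univ_mem).2 hf

theorem iteratedDeriv_sub_mul {g : ℂ → ℂ} (hg : Differentiable ℂ g) (a : ℂ) (t : ℕ) (z : ℂ) :
    iteratedDeriv (t + 1) (fun z => (z - a) * g z) z =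
      (z - a) * iteratedDeriv (t + 1) g z + (t + 1) * iteratedDeriv t g z := by
  have hd : ∀ n, Differentiable ℂ (iteratedDeriv n g) := fun n =>
    (hg.contDiff (n := n + 1)).differentiable_iteratedDeriv n (by exact_mod_cast Nat.lt_succ_self n)
  induction t generalizing z with
  | zero =>
    rw [iteratedDeriv_succ, iteratedDeriv_zero]
    have := ((hasDerivAt_id z).sub_const a).mul (hg z).hasDerivAt
    simp only [id] at this
    rw [show (fun z => (z - a) * g z) = (fun y => y - a) * g from rfl, this.deriv]
    simp [iteratedDeriv_one]
    ring
  | succ t ih =>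
    rw [iteratedDeriv_succ, funext ih]
    have h1 := ((hasDerivAt_id z).sub_const a).mul (hd (t + 1) z).hasDerivAt
    have h2 := ((hd t z).hasDerivAt).const_mul ((t : ℂ) + 1)
    have h3 := h1.add h2
    simp only [id] at h3
    have h4 : deriv (fun z => (z - a) * iteratedDeriv (t + 1) g z +
      ((t : ℂ) + 1) * iteratedDeriv t g z) z = _ := h3.deriv
    rw [h4, ← iteratedDeriv_succ, ← iteratedDeriv_succ]
    push_cast
    ring

theorem iteratedDeriv_succ_eq_dslope {f : ℂ → ℂ} (hf : Differentiable ℂ f) (a : ℂ) (t : ℕ)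
    (z : ℂ) :
    iteratedDeriv (t + 1) f z = (z - a) * iteratedDeriv (t + 1) (dslope f a) z +
      (t + 1) * iteratedDeriv t (dslope f a) z := by
  rw [← iteratedDeriv_sub_mul (differentiable_dslope hf a) a t z]
  have h : (fun z => (z - a) * dslope f a z) = fun z => f z - f a := by
    ext z; exact sub_smul_dslope f a z
  rw [h, iteratedDeriv_succ', iteratedDeriv_succ']
  congr 1
  ext z
  exact (deriv_sub_const (f a)).symm

/-- Jets of the divided difference at another node. -/
theorem norm_iteratedDeriv_dslope_le {f : ℂ → ℂ} (hf : Differentiable ℂ f) {a b : ℂ}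
    (hab : 1 ≤ ‖b - a‖) {ε : ℝ} (hε : 0 ≤ ε) {T n : ℕ} (hn : n ≤ T) (ha : ‖f a‖ ≤ ε)
    (h : ∀ t < n, ‖iteratedDeriv t f b‖ ≤ ε) :
    ∀ t < n, ‖iteratedDeriv t (dslope f a) b‖ ≤ (T + 2 : ℝ) ^ (t + 1) * ε := by
  have hdiv : ∀ w : ℂ, ‖w‖ ≤ ‖(b - a) * w‖ := fun w => by
    rw [norm_mul]; exact le_mul_of_one_le_left (norm_nonneg _) hab
  intro t ht
  induction t with
  | zero =>
    have h0 := h 0 ht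
    simp only [iteratedDeriv_zero] at h0 ⊢
    refine (hdiv _).trans ?_
    have : (b - a) * dslope f a b = f b - f a := sub_smul_dslope f a b
    rw [this]
    refine (norm_sub_le _ _).trans ?_
    have : (0 : ℝ) ≤ T * ε := by positivity
    rw [zero_add, pow_one]
    nlinarith
  | succ t ih =>
    have h0 := h _ ht
    rw [iteratedDeriv_succ_eq_dslope hf a] at h0
    have ih' := ih (by omega)
    refine (hdiv _).trans ?_
    have h1 : ‖(b - a) * iteratedDeriv (t + 1) (dslope f a) b‖ ≤
        ε + ‖((t : ℂ) + 1) * iteratedDeriv t (dslope f a) b‖ := by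
      refine le_trans ?_ (add_le_add_left h0 _)
      have := norm_sub_le ((b - a) * iteratedDeriv (t + 1) (dslope f a) b +
        (t + 1) * iteratedDeriv t (dslope f a) b) (((t : ℂ) + 1) * iteratedDeriv t (dslope f a) b)
      simpa using this
    refine h1.trans ?_
    have h2 : ‖((t : ℂ) + 1)‖ = t + 1 := by
      have : ((t : ℂ) + 1) = ((t + 1 : ℕ) : ℂ) := by push_cast; rfl
      rw [this, Complex.norm_natCast]; push_cast; rfl
    rw [norm_mul, h2]
    have h3 : (t : ℝ) + 1 ≤ T := by
      have : t + 1 ≤ T := by omega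
      exact_mod_cast this
    have h4 : (t + 1 : ℝ) * ‖iteratedDeriv t (dslope f a) b‖ ≤ T * ((T + 2 : ℝ) ^ (t + 1) * ε) :=
      mul_le_mul h3 ih' (norm_nonneg _) (by positivity)
    have h5 : (1 : ℝ) ≤ (T + 2 : ℝ) ^ (t + 1) := one_le_pow₀
        (by linarith [(Nat.cast_nonneg T : (0:ℝ) ≤ T)])
    have h6 : ε ≤ (T + 2 : ℝ) ^ (t + 1) * ε := le_mul_of_one_le_left hε h5
    calc _ ≤ (T + 2 : ℝ) ^ (t + 1) * ε + T * ((T + 2 : ℝ) ^ (t + 1) * ε) := add_le_add h6 h4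
      _ ≤ (T + 2 : ℝ) ^ (t + 1 + 1) * ε := by
        rw [pow_succ (T + 2 : ℝ) (t + 1)]
        nlinarith

/-- Jets of the divided difference at the node itself. -/
theorem norm_iteratedDeriv_dslope_self_le {f : ℂ → ℂ} (hf : Differentiable ℂ f) (a : ℂ) (t : ℕ) :
    ‖iteratedDeriv t (dslope f a) a‖ ≤ ‖iteratedDeriv (t + 1) f a‖ := by
  rw [iteratedDeriv_succ_eq_dslope hf a, sub_self, zero_mul, zero_add, norm_mul]
  refine le_mul_of_one_le_left (norm_nonneg _) ?_
  have : ((t : ℂ) + 1) = ((t + 1 : ℕ) : ℂ) := by push_cast; rfl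
  rw [this, Complex.norm_natCast]
  exact_mod_cast Nat.succ_le_succ (Nat.zero_le t)

theorem norm_dslope_le_of_mem_closedBall {f : ℂ → ℂ} (hf : Differentiable ℂ f) {a : ℂ} {r R M : ℝ}
    (ha : ‖a‖ ≤ r) (hrR : r < R) (hM : ∀ z, ‖z‖ ≤ R → ‖f z‖ ≤ M) :
    ∀ z, ‖z‖ ≤ R → ‖dslope f a z‖ ≤ 2 * M / (R - r) := by
  have hR : 0 < R := (norm_nonneg a).trans_lt (ha.trans_lt hrR)
  intro z hz
  have hz' : z ∈ closure (Metric.ball (0 : ℂ) R) := by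
    rw [closure_ball _ hR.ne']; simpa using hz
  refine Complex.norm_le_of_forall_mem_frontier_norm_le Metric.isBounded_ball
    (differentiable_dslope hf a).diffContOnCl (fun w hw => ?_) hz'
  rw [frontier_ball _ hR.ne'] at hw
  have hw : ‖w‖ = R := by simpa using hw
  have h1 : R - r ≤ ‖w - a‖ := by
    have := norm_sub_norm_le w a
    linarith
  have h2 : (w - a) * dslope f a w = f w - f a := sub_smul_dslope f a w
  rw [le_div_iff₀ (by linarith)]
  calc ‖dslope f a w‖ * (R - r) ≤ ‖dslope f a w‖ * ‖w - a‖ := by gcongr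
    _ = ‖f w - f a‖ := by rw [← h2, norm_mul, mul_comm]
    _ ≤ ‖f w‖ + ‖f a‖ := norm_sub_le _ _
    _ ≤ M + M := add_le_add (hM _ hw.le) (hM _ (by linarith))
    _ = 2 * M := by ring

/-- A Schwarz lemma for entire functions with approximate zeros at the integers `0, …, S - 1`. -/
theorem norm_le_of_approx_zeros {r R : ℝ} (hr : 0 ≤ r) (hR : 13 * r < R) {S T : ℕ}
    (hS : (S : ℝ) ≤ r) (N : ℕ) :
    ∀ (f : ℂ → ℂ) (μ : ℕ → ℕ) (ε M : ℝ), Differentiable ℂ f → 0 ≤ ε → (∀ l, μ l ≤ T) →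
      ∑ l ∈ Finset.range S, μ l = N → (∀ z, ‖z‖ ≤ R → ‖f z‖ ≤ M) →
      (∀ l < S, ∀ t < μ l, ‖iteratedDeriv t f l‖ ≤ ε) →
      ∀ z, ‖z‖ ≤ r → ‖f z‖ ≤ ε * (1 + 2 * r * (T + 2 : ℝ) ^ (T + 1)) ^ N + M * (1 / 3) ^ N := by
  induction N with
  | zero =>
    intro f μ ε M _ hε _ _ hM _ z hz
    have := hM z (by linarith)
    simp only [pow_zero, mul_one]
    linarith
  | succ N ih =>
    intro f μ ε M hf hε hT hN hM hjet z hz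
    obtain ⟨a, ha, hμa⟩ : ∃ a ∈ Finset.range S, μ a ≠ 0 := by
      by_contra! hcon
      rw [Finset.sum_eq_zero hcon] at hN
      omega
    have haS : a < S := Finset.mem_range.1 ha
    have hfa : ‖f a‖ ≤ ε := by simpa using hjet a haS 0 (by omega)
    have har : ‖(a : ℂ)‖ ≤ r := by
      rw [Complex.norm_natCast]
      have : (a : ℝ) ≤ S := by exact_mod_cast haS.le
      linarith
    have hM0 : 0 ≤ M := (norm_nonneg _).trans (hM 0 (by simp; linarith))
    have hr0 : 0 < r := by
      have : (1 : ℝ) ≤ S := by exact_mod_cast (by omega : 1 ≤ S)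
      linarith
    set τ : ℝ := (T + 2 : ℝ) ^ (T + 1) with hτ
    have hT2 : (1 : ℝ) ≤ (T + 2 : ℝ) := by linarith [(Nat.cast_nonneg T : (0:ℝ) ≤ T)]
    have hτ1 : 1 ≤ τ := one_le_pow₀ hT2
    have key := ih (dslope f a) (fun l => if l = a then μ a - 1 else μ l) (τ * ε)
      (2 * M / (R - r)) (differentiable_dslope hf _) (by positivity)
      (fun l => by
        have h1 := hT l
        have h2 := hT a
        split_ifs <;> omega)
      (by
        rw [← Finset.add_sum_erase _ _ ha] at hN ⊢
        have : ∑ l ∈ (Finset.range S).erase a, (if l = a then μ a - 1 else μ l) =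
            ∑ l ∈ (Finset.range S).erase a, μ l :=
          Finset.sum_congr rfl fun l hl => if_neg (Finset.ne_of_mem_erase hl)
        rw [this, if_pos rfl]
        omega)
      (norm_dslope_le_of_mem_closedBall hf har (by linarith) hM)
      (by
        intro l hl t ht
        by_cases hla : l = a
        · subst hla
          simp only [if_true] at ht
          refine (norm_iteratedDeriv_dslope_self_le hf _ t).trans ?_
          exact (hjet l hl (t + 1) (by omega)).trans (le_mul_of_one_le_left hε hτ1)
        · simp only [if_neg hla] at ht
          have h1 : (1 : ℝ) ≤ ‖(l : ℂ) - a‖ := by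
            have : ((l : ℂ) - a) = (((l : ℤ) - a : ℤ) : ℂ) := by push_cast; rfl
            rw [this, Complex.norm_intCast]
            have h0 : (l : ℤ) - a ≠ 0 := by omega
            exact_mod_cast Int.one_le_abs h0
          refine (norm_iteratedDeriv_dslope_le hf h1 hε (hT l) hfa (hjet l hl) t ht).trans ?_
          gcongr
          exact pow_le_pow_right₀ hT2 (by have := hT l; omega))
      z hz
    have hfz : f z = f a + (z - a) * dslope f a z := by
      have : (z - a) * dslope f a z = f z - f a := sub_smul_dslope f (a : ℂ) z
      rw [this]; ring
    have hza : ‖z - a‖ ≤ 2 * r := (norm_sub_le _ _).trans (by linarith)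
    have hA : (1 : ℝ) ≤ 1 + 2 * r * τ := by nlinarith
    have h1 : ‖f z‖ ≤ ε + 2 * r * ‖dslope f a z‖ := by
      rw [hfz]
      refine (norm_add_le _ _).trans (add_le_add hfa ?_)
      rw [norm_mul]
      gcongr
    have h2 : 2 * r * (2 * M / (R - r)) ≤ M * (1 / 3) := by
      rw [mul_div_assoc', div_le_iff₀ (by linarith)]
      nlinarith
    have h3 : (1 : ℝ) ≤ (1 + 2 * r * τ) ^ N := one_le_pow₀ hA
    calc ‖f z‖ ≤ ε + 2 * r * (τ * ε * (1 + 2 * r * τ) ^ N + 2 * M / (R - r) * (1 / 3) ^ N) := by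
          refine h1.trans ?_
          gcongr
      _ = ε + 2 * r * τ * ε * (1 + 2 * r * τ) ^ N + 2 * r * (2 * M / (R - r)) * (1 / 3) ^ N := by
          ring
      _ ≤ ε * (1 + 2 * r * τ) ^ N + 2 * r * τ * ε * (1 + 2 * r * τ) ^ N +
          M * (1 / 3) * (1 / 3) ^ N := by
          gcongr
          exact le_mul_of_one_le_right hε h3
      _ = _ := by ring

section LinearForms

open Finset

/-- Triples of exponents below `L`. -/
def expBox (L : ℕ) : Finset (ℕ × ℕ × ℕ) := range L ×ˢ range L ×ˢ range L

theorem mem_expBox {L : ℕ} {v : ℕ × ℕ × ℕ} :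
    v ∈ expBox L ↔ v.1 < L ∧ v.2.1 < L ∧ v.2.2 < L := by
  simp [expBox]

/-- First coordinate of the projection of `v` along `(1, -b₁, -b₂)`. -/
def projFst (b₁ : ℤ) (v : ℕ × ℕ × ℕ) : ℤ := v.2.1 + v.1 * b₁

/-- Second coordinate of the projection of `v` along `(1, -b₁, -b₂)`. -/
def projSnd (b₂ : ℤ) (v : ℕ × ℕ × ℕ) : ℤ := v.2.2 + v.1 * b₂

/-- The monomial of bidegree `(m, n)` in the projection of `v`. -/
def projMonomial (b₁ b₂ : ℤ) (m n : ℕ) (v : ℕ × ℕ × ℕ) : ℤ :=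
  projFst b₁ v ^ m * projSnd b₂ v ^ n

/-- The linear form `v₀ ℓ₀ + v₁ ℓ₁ + v₂ ℓ₂`. -/
noncomputable def logForm (ℓ₀ ℓ₁ ℓ₂ : ℂ) (v : ℕ × ℕ × ℕ) : ℂ :=
  v.1 * ℓ₀ + v.2.1 * ℓ₁ + v.2.2 * ℓ₂

/-- The auxiliary exponential sum, whose values at integers are algebraic. -/
noncomputable def algSum (ℓ₀ ℓ₁ ℓ₂ : ℂ) (b₁ b₂ : ℤ) (L : ℕ) (p : ℕ × ℕ × ℕ → ℤ) (m n : ℕ) (z : ℂ) :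
    ℂ :=
  ∑ v ∈ expBox L, ((p v * projMonomial b₁ b₂ m n v : ℤ) : ℂ) *
    Complex.exp (logForm ℓ₀ ℓ₁ ℓ₂ v * z)

/-- The exponential sum with `ℓ₀` replaced by `b₁ ℓ₁ + b₂ ℓ₂`, a family stable by derivation. -/
noncomputable def auxSum (ℓ₁ ℓ₂ : ℂ) (b₁ b₂ : ℤ) (L : ℕ) (p : ℕ × ℕ × ℕ → ℤ) (m n : ℕ) (z : ℂ) :
    ℂ :=
  ∑ v ∈ expBox L, ((p v * projMonomial b₁ b₂ m n v : ℤ) : ℂ) *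
    Complex.exp ((projFst b₁ v * ℓ₁ + projSnd b₂ v * ℓ₂) * z)

/-- A Liouville type lower bound for integral polynomials in `a₀, a₁, a₂`. -/
def LiouvilleBound (a₀ a₁ a₂ : ℂ) (X : ℕ) : Prop :=
  ∀ (s : Finset (ℕ × ℕ × ℕ)) (c : ℕ × ℕ × ℕ → ℤ) (e : ℕ × ℕ × ℕ → ℕ × ℕ × ℕ) (N : ℕ) (w : ℝ),
    (∀ v ∈ s, (e v).1 ≤ N ∧ (e v).2.1 ≤ N ∧ (e v).2.2 ≤ N) → ∑ v ∈ s, |(c v : ℝ)| ≤ Real.exp w →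
    ∑ v ∈ s, (c v : ℂ) * (a₀ ^ (e v).1 * a₁ ^ (e v).2.1 * a₂ ^ (e v).2.2) = 0 ∨
    Real.exp (-(X * (w + X * N))) ≤
      ‖∑ v ∈ s, (c v : ℂ) * (a₀ ^ (e v).1 * a₁ ^ (e v).2.1 * a₂ ^ (e v).2.2)‖

section AuxSum

variable {ℓ₀ ℓ₁ ℓ₂ : ℂ} {b₁ b₂ : ℤ} {L : ℕ} {p : ℕ × ℕ × ℕ → ℤ}

theorem projForm_eq (v : ℕ × ℕ × ℕ) :
    projFst b₁ v * ℓ₁ + projSnd b₂ v * ℓ₂ =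
      logForm ℓ₀ ℓ₁ ℓ₂ v - v.1 * (ℓ₀ - b₁ * ℓ₁ - b₂ * ℓ₂) := by
  simp only [projFst, projSnd, logForm]
  push_cast
  ring

theorem hasDerivAt_auxSum (m n : ℕ) (z : ℂ) :
    HasDerivAt (auxSum ℓ₁ ℓ₂ b₁ b₂ L p m n)
      (ℓ₁ * auxSum ℓ₁ ℓ₂ b₁ b₂ L p (m + 1) n z + ℓ₂ * auxSum ℓ₁ ℓ₂ b₁ b₂ L p m (n + 1) z) z := by
  have : ∀ v ∈ expBox L, HasDerivAt (fun z => ((p v * projMonomial b₁ b₂ m n v : ℤ) : ℂ) *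
      Complex.exp ((projFst b₁ v * ℓ₁ + projSnd b₂ v * ℓ₂) * z))
      (((p v * projMonomial b₁ b₂ m n v : ℤ) : ℂ) *
        (Complex.exp ((projFst b₁ v * ℓ₁ + projSnd b₂ v * ℓ₂) * z) *
          ((projFst b₁ v * ℓ₁ + projSnd b₂ v * ℓ₂) * 1))) z := fun v _ =>
    (((hasDerivAt_id z).const_mul (projFst b₁ v * ℓ₁ + projSnd b₂ v * ℓ₂)).cexp).const_mul _
  refine (HasDerivAt.fun_sum this).congr_deriv ?_
  simp only [auxSum, mul_sum]
  rw [← sum_add_distrib]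
  refine sum_congr rfl fun v _ => ?_
  simp only [projMonomial]
  push_cast
  ring

theorem differentiable_auxSum (m n : ℕ) : Differentiable ℂ (auxSum ℓ₁ ℓ₂ b₁ b₂ L p m n) :=
  fun z => (hasDerivAt_auxSum m n z).differentiableAt

theorem norm_iteratedDeriv_auxSum_le {X : ℝ} (h₁ : ‖ℓ₁‖ ≤ X) (h₂ : ‖ℓ₂‖ ≤ X) {δ : ℝ} {z : ℂ}
    (t : ℕ) :
    ∀ m n : ℕ, (∀ m' n' : ℕ, m' + n' ≤ m + n + t → ‖auxSum ℓ₁ ℓ₂ b₁ b₂ L p m' n' z‖ ≤ δ) →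
      ‖iteratedDeriv t (auxSum ℓ₁ ℓ₂ b₁ b₂ L p m n) z‖ ≤ (2 * X) ^ t * δ := by
  induction t with
  | zero => intro m n h; simpa using h m n (by omega)
  | succ t ih =>
    intro m n h
    have hd : deriv (auxSum ℓ₁ ℓ₂ b₁ b₂ L p m n) = fun z =>
        ℓ₁ * auxSum ℓ₁ ℓ₂ b₁ b₂ L p (m + 1) n z + ℓ₂ * auxSum ℓ₁ ℓ₂ b₁ b₂ L p m (n + 1) z :=
      funext fun z => (hasDerivAt_auxSum m n z).deriv
    have hc : ∀ (ℓ : ℂ) (m n : ℕ),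
        ContDiffAt ℂ t (fun z => ℓ * auxSum ℓ₁ ℓ₂ b₁ b₂ L p m n z) z := fun ℓ m n =>
      ((differentiable_auxSum m n).const_mul ℓ).contDiff.contDiffAt
    rw [iteratedDeriv_succ', hd, iteratedDeriv_fun_add (hc _ _ _) (hc _ _ _),
      iteratedDeriv_const_mul_field, iteratedDeriv_const_mul_field]
    have e₁ := ih (m + 1) n fun m' n' h' => h m' n' (by omega)
    have e₂ := ih m (n + 1) fun m' n' h' => h m' n' (by omega)
    have hX : 0 ≤ X := (norm_nonneg _).trans h₁
    calc _ ≤ ‖ℓ₁‖ * ‖iteratedDeriv t (auxSum ℓ₁ ℓ₂ b₁ b₂ L p (m + 1) n) z‖ +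
          ‖ℓ₂‖ * ‖iteratedDeriv t (auxSum ℓ₁ ℓ₂ b₁ b₂ L p m (n + 1)) z‖ := by
            refine (norm_add_le _ _).trans ?_
            rw [norm_mul, norm_mul]
      _ ≤ X * ((2 * X) ^ t * δ) + X * ((2 * X) ^ t * δ) := by gcongr
      _ = _ := by ring

theorem norm_logForm_le {X : ℝ} (h₀ : ‖ℓ₀‖ ≤ X) (h₁ : ‖ℓ₁‖ ≤ X) (h₂ : ‖ℓ₂‖ ≤ X) {v : ℕ × ℕ × ℕ}
    (hv : v ∈ expBox L) : ‖logForm ℓ₀ ℓ₁ ℓ₂ v‖ ≤ 3 * L * X := by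
  obtain ⟨e₀, e₁, e₂⟩ := mem_expBox.1 hv
  have key : ∀ (i : ℕ) (ℓ : ℂ), i < L → ‖ℓ‖ ≤ X → ‖(i : ℂ) * ℓ‖ ≤ L * X := fun i ℓ hi hℓ => by
    rw [norm_mul, Complex.norm_natCast]
    gcongr
  calc _ ≤ ‖(v.1 : ℂ) * ℓ₀‖ + ‖(v.2.1 : ℂ) * ℓ₁‖ + ‖(v.2.2 : ℂ) * ℓ₂‖ := norm_add₃_le
    _ ≤ L * X + L * X + L * X := add_le_add_three (key _ _ e₀ h₀) (key _ _ e₁ h₁) (key _ _ e₂ h₂)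
    _ = _ := by ring

theorem norm_auxSum_le {X W : ℝ} (h₀ : ‖ℓ₀‖ ≤ X) (h₁ : ‖ℓ₁‖ ≤ X) (h₂ : ‖ℓ₂‖ ≤ X) (hX : 1 ≤ X)
    (hΛ : ‖ℓ₀ - b₁ * ℓ₁ - b₂ * ℓ₂‖ ≤ 1) {m n : ℕ}
    (hW : ∑ v ∈ expBox L, |((p v * projMonomial b₁ b₂ m n v : ℤ) : ℝ)| ≤ W) {r : ℝ} {z : ℂ}
    (hz : ‖z‖ ≤ r) :
    ‖auxSum ℓ₁ ℓ₂ b₁ b₂ L p m n z‖ ≤ W * Real.exp (4 * L * X * r) := by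
  have hr : 0 ≤ r := (norm_nonneg z).trans hz
  refine (norm_sum_le _ _).trans ?_
  refine le_trans (sum_le_sum (g := fun v => |((p v * projMonomial b₁ b₂ m n v : ℤ) : ℝ)| *
    Real.exp (4 * L * X * r)) fun v hv => ?_) (by rw [← sum_mul]; gcongr)
  rw [norm_mul, Complex.norm_intCast]
  gcongr
  refine (Complex.norm_exp_le_exp_norm _).trans (Real.exp_le_exp.2 ?_)
  rw [norm_mul, projForm_eq (ℓ₀ := ℓ₀)]
  have e := norm_logForm_le h₀ h₁ h₂ hv
  have e' : ‖(v.1 : ℂ) * (ℓ₀ - b₁ * ℓ₁ - b₂ * ℓ₂)‖ ≤ L * X := by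
    rw [norm_mul, Complex.norm_natCast]
    have : v.1 ≤ L := (mem_expBox.1 hv).1.le
    have : ‖ℓ₀ - b₁ * ℓ₁ - b₂ * ℓ₂‖ ≤ X := hΛ.trans hX
    gcongr
  gcongr
  exact (norm_sub_le _ _).trans (by linarith)

theorem norm_auxSum_sub_algSum_le {X W : ℝ} (h₀ : ‖ℓ₀‖ ≤ X) (h₁ : ‖ℓ₁‖ ≤ X) (h₂ : ‖ℓ₂‖ ≤ X)
    {m n : ℕ}
    (hW : ∑ v ∈ expBox L, |((p v * projMonomial b₁ b₂ m n v : ℤ) : ℝ)| ≤ W) {S l : ℕ} (hl : l ≤ S)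
    (hΛ : L * S * ‖ℓ₀ - b₁ * ℓ₁ - b₂ * ℓ₂‖ ≤ 1) :
    ‖auxSum ℓ₁ ℓ₂ b₁ b₂ L p m n l - algSum ℓ₀ ℓ₁ ℓ₂ b₁ b₂ L p m n l‖ ≤
      W * (Real.exp (3 * L * X * S) * (2 * (L * S * ‖ℓ₀ - b₁ * ℓ₁ - b₂ * ℓ₂‖))) := by
  set Λ := ℓ₀ - b₁ * ℓ₁ - b₂ * ℓ₂ with hΛdef
  have hX : 0 ≤ X := (norm_nonneg _).trans h₀
  rw [auxSum, algSum, ← sum_sub_distrib]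
  refine (norm_sum_le _ _).trans ?_
  refine le_trans (sum_le_sum (g := fun v => |((p v * projMonomial b₁ b₂ m n v : ℤ) : ℝ)| *
    (Real.exp (3 * L * X * S) * (2 * (L * S * ‖Λ‖)))) fun v hv => ?_)
    (by rw [← sum_mul]; gcongr)
  rw [← mul_sub, norm_mul, Complex.norm_intCast]
  gcongr
  have hu : ‖-((v.1 : ℂ) * Λ * l)‖ ≤ L * S * ‖Λ‖ := by
    rw [norm_neg, norm_mul, norm_mul, Complex.norm_natCast, Complex.norm_natCast]
    have h3 : v.1 ≤ L := (mem_expBox.1 hv).1.le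
    calc (v.1 : ℝ) * ‖Λ‖ * l ≤ L * ‖Λ‖ * S := by gcongr
      _ = _ := by ring
  have hsplit : Complex.exp ((projFst b₁ v * ℓ₁ + projSnd b₂ v * ℓ₂) * l) -
      Complex.exp (logForm ℓ₀ ℓ₁ ℓ₂ v * l) =
      Complex.exp (logForm ℓ₀ ℓ₁ ℓ₂ v * l) * (Complex.exp (-((v.1 : ℂ) * Λ * l)) - 1) := by
    rw [mul_sub, ← Complex.exp_add, mul_one, projForm_eq (ℓ₀ := ℓ₀), hΛdef]
    ring_nf
  rw [hsplit, norm_mul]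
  refine mul_le_mul ?_ ?_ (norm_nonneg _) (Real.exp_pos _).le
  · refine (Complex.norm_exp_le_exp_norm _).trans (Real.exp_le_exp.2 ?_)
    rw [norm_mul, Complex.norm_natCast]
    have e := norm_logForm_le h₀ h₁ h₂ hv
    gcongr
  · refine (Complex.norm_exp_sub_one_le (hu.trans hΛ)).trans ?_
    gcongr

theorem algSum_eq_zero_or_le {X : ℕ}
    (hα : LiouvilleBound (Complex.exp ℓ₀) (Complex.exp ℓ₁) (Complex.exp ℓ₂) X)
    {w : ℝ} {m n : ℕ}
    (hW : ∑ v ∈ expBox L, |((p v * projMonomial b₁ b₂ m n v : ℤ) : ℝ)| ≤ Real.exp w) {S l : ℕ}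
    (hl : l ≤ S) :
    algSum ℓ₀ ℓ₁ ℓ₂ b₁ b₂ L p m n l = 0 ∨
      Real.exp (-(X * (w + X * (L * S)))) ≤ ‖algSum ℓ₀ ℓ₁ ℓ₂ b₁ b₂ L p m n l‖ := by
  have h := hα (expBox L) (fun v => p v * projMonomial b₁ b₂ m n v)
    (fun v => (v.1 * l, v.2.1 * l, v.2.2 * l)) (L * S) w
    (fun v hv => by
      obtain ⟨e₀, e₁, e₂⟩ := mem_expBox.1 hv
      exact ⟨Nat.mul_le_mul e₀.le hl, Nat.mul_le_mul e₁.le hl, Nat.mul_le_mul e₂.le hl⟩) hW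
  have e : algSum ℓ₀ ℓ₁ ℓ₂ b₁ b₂ L p m n l = ∑ v ∈ expBox L,
      ((p v * projMonomial b₁ b₂ m n v : ℤ) : ℂ) * (Complex.exp ℓ₀ ^ (v.1 * l) *
        Complex.exp ℓ₁ ^ (v.2.1 * l) * Complex.exp ℓ₂ ^ (v.2.2 * l)) := by
    refine sum_congr rfl fun v _ => ?_
    rw [← Complex.exp_nat_mul, ← Complex.exp_nat_mul, ← Complex.exp_nat_mul, ← Complex.exp_add,
      ← Complex.exp_add, logForm]
    push_cast
    ring_nf
  rw [e]
  push_cast at h ⊢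
  exact h

end AuxSum

section Extrapolation

variable {ℓ₀ ℓ₁ ℓ₂ : ℂ} {b₁ b₂ : ℤ} {L : ℕ} {p : ℕ × ℕ × ℕ → ℤ}

theorem one_add_mul_pow_le_exp (s T : ℕ) :
    1 + 2 * (s : ℝ) * (T + 2 : ℝ) ^ (T + 1) ≤ Real.exp (2 * s + (T + 1) ^ 2) := by
  have h1 : (T + 2 : ℝ) ^ (T + 1) ≤ Real.exp ((T + 1) ^ 2) := by
    calc (T + 2 : ℝ) ^ (T + 1) ≤ Real.exp (T + 1) ^ (T + 1) := by
          gcongr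
          have := Real.add_one_le_exp ((T : ℝ) + 1)
          linarith
      _ = Real.exp ((T + 1) ^ 2) := by
          rw [← Real.exp_nat_mul]; push_cast; ring_nf
  have h2 : (1 : ℝ) ≤ Real.exp ((T + 1) ^ 2) := Real.one_le_exp (by positivity)
  have h3 := Real.add_one_le_exp (2 * (s : ℝ))
  rw [Real.exp_add]
  have h4 : 2 * (s : ℝ) * (T + 2 : ℝ) ^ (T + 1) ≤ 2 * (s : ℝ) * Real.exp ((T + 1) ^ 2) := by gcongr
  nlinarith

theorem algSum_eq_zero_of_extrapolation {X : ℕ} (hX : 1 ≤ X) (h₀ : ‖ℓ₀‖ ≤ X) (h₁ : ‖ℓ₁‖ ≤ X)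
    (h₂ : ‖ℓ₂‖ ≤ X)
    (hα : LiouvilleBound (Complex.exp ℓ₀) (Complex.exp ℓ₁) (Complex.exp ℓ₂) X) {S S' T : ℕ}
    (hS : S ≤ S') (hS' : 1 ≤ S') {w V : ℝ} (hw : 0 ≤ w)
    (hW : ∀ m n, m + n < 2 * T →
      ∑ v ∈ expBox L, |((p v * projMonomial b₁ b₂ m n v : ℤ) : ℝ)| ≤ Real.exp w)
    (hzero : ∀ m n, m + n < 2 * T → ∀ l < S, algSum ℓ₀ ℓ₁ ℓ₂ b₁ b₂ L p m n l = 0)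
    (hV : ‖ℓ₀ - b₁ * ℓ₁ - b₂ * ℓ₂‖ ≤ Real.exp (-V))
    (hST : X * (w + X * (L * S')) + 2 + w + 56 * (L * X * S') ≤ (S : ℝ) * T)
    (hV' : w + 3 * (L * X * S') + 2 * (L * S') + 2 * (X * T) +
      S * T * (2 * S' + (T + 1) ^ 2) + X * (w + X * (L * S')) + 2 ≤ V) :
    ∀ m n, m + n < T → ∀ l < S', algSum ℓ₀ ℓ₁ ℓ₂ b₁ b₂ L p m n l = 0 := by
  intro m n hmn l hl
  by_contra hne
  set D : ℝ := X * (w + X * (L * S')) with hD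
  set Λ := ℓ₀ - b₁ * ℓ₁ - b₂ * ℓ₂ with hΛ
  have hlow : Real.exp (-D) ≤ ‖algSum ℓ₀ ℓ₁ ℓ₂ b₁ b₂ L p m n l‖ :=
    (algSum_eq_zero_or_le hα (hW m n (by omega)) hl.le).resolve_left hne
  have hX' : (1 : ℝ) ≤ X := by exact_mod_cast hX
  have hSr : (S : ℝ) ≤ S' := by exact_mod_cast hS
  have hD0 : 0 ≤ D := by positivity
  have hST0 : (0 : ℝ) ≤ S * T * (2 * S' + (T + 1) ^ 2) := by positivity
  have hXT0 : (0 : ℝ) ≤ X * T := by positivity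
  have hLXS0 : (0 : ℝ) ≤ L * X * S' := by positivity
  have hLS0 : (0 : ℝ) ≤ L * S' := by positivity
  have h2LS : 2 * (L * S' : ℝ) ≤ Real.exp (2 * (L * S')) := by
    linarith [Real.add_one_le_exp (2 * (L * S' : ℝ))]
  have hδ : 2 * (L * S' * ‖Λ‖) ≤ Real.exp (2 * (L * S') - V) := by
    rw [sub_eq_add_neg, Real.exp_add, ← mul_assoc]
    gcongr
  have hLΛ' : L * S' * ‖Λ‖ ≤ 1 := by
    have : Real.exp (2 * (L * S') - V) ≤ 1 := Real.exp_le_one_iff.2 (by linarith)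
    have : (0 : ℝ) ≤ L * S' * ‖Λ‖ := by positivity
    linarith
  have hLΛ : L * S * ‖Λ‖ ≤ 1 := le_trans (by gcongr) hLΛ'
  have hΛ1 : ‖Λ‖ ≤ 1 := hV.trans (Real.exp_le_one_iff.2 (by linarith))
  have hdiff : ∀ (S₁ : ℕ), S₁ ≤ S' → ∀ m n, m + n < 2 * T → ∀ l ≤ S₁,
      ‖auxSum ℓ₁ ℓ₂ b₁ b₂ L p m n l - algSum ℓ₀ ℓ₁ ℓ₂ b₁ b₂ L p m n l‖ ≤
        Real.exp (w + 3 * (L * X * S') + 2 * (L * S') - V) := by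
    intro S₁ hS₁ m n hmn l hl
    refine (norm_auxSum_sub_algSum_le h₀ h₁ h₂ (hW m n hmn) (hl.trans hS₁) hLΛ').trans ?_
    have e : Real.exp (w + 3 * (L * X * S') + 2 * (L * S') - V) =
        Real.exp w * (Real.exp (3 * L * X * S') * Real.exp (2 * (L * S') - V)) := by
      rw [← Real.exp_add, ← Real.exp_add]
      ring_nf
    rw [e]
    gcongr
  have hjet : ∀ l < S, ∀ t < T, ‖iteratedDeriv t (auxSum ℓ₁ ℓ₂ b₁ b₂ L p m n) l‖ ≤
      Real.exp (2 * (X * T) + (w + 3 * (L * X * S') + 2 * (L * S') - V)) := by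
    intro l hl t ht
    refine (norm_iteratedDeriv_auxSum_le h₁ h₂ t m n fun m' n' h' => ?_).trans
      (b := (2 * X : ℝ) ^ t * Real.exp (w + 3 * (L * X * S') + 2 * (L * S') - V)) ?_
    · have := hdiff S hS m' n' (by omega) l hl.le
      rwa [hzero m' n' (by omega) l hl, sub_zero] at this
    · rw [Real.exp_add]
      gcongr
      calc (2 * X : ℝ) ^ t ≤ (2 * X : ℝ) ^ T := by gcongr; linarith
        _ ≤ Real.exp (2 * X) ^ T := by
          gcongr
          linarith [Real.add_one_le_exp (2 * X : ℝ)]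
        _ = _ := by rw [← Real.exp_nat_mul]; ring_nf
  have hmain := norm_le_of_approx_zeros (r := S') (R := 14 * S') (by positivity)
    (by have : (1 : ℝ) ≤ S' := by exact_mod_cast hS'
        linarith) hSr (T := T) (S * T) (auxSum ℓ₁ ℓ₂ b₁ b₂ L p m n) (fun _ => T)
    (Real.exp (2 * (X * T) + (w + 3 * (L * X * S') + 2 * (L * S') - V)))
    (Real.exp w * Real.exp (4 * L * X * (14 * S')))
    (differentiable_auxSum m n) (Real.exp_pos _).le (fun _ => le_rfl) (by simp)
    (fun z hz => norm_auxSum_le h₀ h₁ h₂ hX' hΛ1 (hW m n (by omega)) hz) hjet l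
    (by rw [Complex.norm_natCast]; exact_mod_cast hl.le)
  have e1 : Real.exp (2 * (X * T) + (w + 3 * (L * X * S') + 2 * (L * S') - V)) *
      (1 + 2 * S' * (T + 2 : ℝ) ^ (T + 1)) ^ (S * T) ≤ Real.exp (-D - 2) := by
    calc _ ≤ Real.exp (2 * (X * T) + (w + 3 * (L * X * S') + 2 * (L * S') - V)) *
        Real.exp (2 * S' + (T + 1) ^ 2) ^ (S * T) := by
          gcongr
          exact one_add_mul_pow_le_exp S' T
      _ = Real.exp (2 * (X * T) + (w + 3 * (L * X * S') + 2 * (L * S') - V) +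
          S * T * (2 * S' + (T + 1) ^ 2)) := by
          rw [← Real.exp_nat_mul, ← Real.exp_add]
          push_cast
          rfl
      _ ≤ _ := Real.exp_le_exp.2 (by linarith)
  have e2 : Real.exp w * Real.exp (4 * L * X * (14 * S')) * (1 / 3) ^ (S * T) ≤
      Real.exp (-D - 2) := by
    calc _ ≤ Real.exp w * Real.exp (4 * L * X * (14 * S')) * Real.exp (-1) ^ (S * T) := by
          gcongr
          rw [Real.exp_neg, ← one_div]
          have := Real.exp_one_lt_d9
          gcongr
          linarith
      _ = Real.exp (w + 4 * L * X * (14 * S') + S * T * (-1)) := by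
          rw [← Real.exp_nat_mul, ← Real.exp_add, ← Real.exp_add]
          push_cast
          rfl
      _ ≤ _ := Real.exp_le_exp.2 (by nlinarith)
  have e3 : Real.exp (w + 3 * (L * X * S') + 2 * (L * S') - V) ≤ Real.exp (-D - 2) :=
    Real.exp_le_exp.2 (by linarith)
  have e4 := hdiff S' le_rfl m n (by omega) l hl.le
  have e5 : ‖algSum ℓ₀ ℓ₁ ℓ₂ b₁ b₂ L p m n l‖ ≤ ‖auxSum ℓ₁ ℓ₂ b₁ b₂ L p m n l‖ +
      ‖auxSum ℓ₁ ℓ₂ b₁ b₂ L p m n l - algSum ℓ₀ ℓ₁ ℓ₂ b₁ b₂ L p m n l‖ :=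
    norm_le_insert _ _
  have e6 : 3 * Real.exp (-D - 2) < Real.exp (-D) := by
    rw [sub_eq_add_neg, Real.exp_add, mul_comm, mul_assoc]
    refine mul_lt_of_lt_one_right (Real.exp_pos _) ?_
    rw [Real.exp_neg, inv_mul_lt_iff₀ (Real.exp_pos _), mul_one]
    have := Real.add_one_lt_exp (x := 2) (by norm_num)
    linarith
  linarith

end Extrapolation

section Siegel

variable {α β : Type*} [Fintype α] [Fintype β]

attribute [local instance] Matrix.seminormedAddCommGroup in
theorem exists_int_solution_le_exp (A : α → β → ℤ) (hm : 0 < Fintype.card α)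
    (hn : Fintype.card α < Fintype.card β) {q Z P : ℝ} (hZ : 0 ≤ Z)
    (hq : (Fintype.card β : ℝ) ≤ Real.exp q) (hA : ∀ i j, |(A i j : ℝ)| ≤ Real.exp Z)
    (hP : (q + Z) * Fintype.card α ≤ P * (Fintype.card β - Fintype.card α)) :
    ∃ t : β → ℤ, t ≠ 0 ∧ (∀ i, ∑ j, A i j * t j = 0) ∧ ∀ j, |(t j : ℝ)| ≤ Real.exp P := by
  obtain ⟨t, ht, ht0, htn⟩ := Int.Matrix.exists_ne_zero_int_vec_norm_le (Matrix.of A) hn hm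
  refine ⟨t, ht, fun i => congrFun ht0 i, fun j => ?_⟩
  rw [← Int.norm_eq_abs]
  have hAn : max 1 ‖Matrix.of A‖ ≤ Real.exp Z := by
    refine max_le (Real.one_le_exp hZ) ((Matrix.norm_le_iff (Real.exp_pos _).le).2 fun i j => ?_)
    simpa [Int.norm_eq_abs] using hA i j
  have hlt : (0 : ℝ) < Fintype.card β - Fintype.card α := sub_pos.2 (by exact_mod_cast hn)
  calc ‖t j‖ ≤ ‖t‖ := norm_le_pi_norm t j
    _ ≤ _ := htn
    _ ≤ (Real.exp q * Real.exp Z) ^ ((Fintype.card α : ℝ) / (Fintype.card β - Fintype.card α)) := by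
      gcongr
    _ = Real.exp ((q + Z) * (Fintype.card α / (Fintype.card β - Fintype.card α))) := by
      rw [← Real.exp_add, ← Real.exp_mul]
    _ ≤ _ := by
      rw [← mul_div_assoc]
      exact Real.exp_le_exp.2 ((div_le_iff₀ hlt).2 hP)

theorem exists_int_almost_solution (a : α → β → ℂ) (hm : 0 < Fintype.card α)
    (hn : 2 * Fintype.card α < Fintype.card β) {q E K P : ℝ} (hE : 0 ≤ E) (hK : 0 ≤ K)
    (hq : (Fintype.card β : ℝ) ≤ Real.exp q) (ha : ∀ i j, ‖a i j‖ ≤ Real.exp E)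
    (hP : (q + (K + E + 1)) * (2 * Fintype.card α) ≤
      P * (Fintype.card β - 2 * Fintype.card α)) :
    ∃ t : β → ℤ, t ≠ 0 ∧ (∀ i, ‖∑ j, (t j : ℂ) * a i j‖ ≤ Real.exp (q + P + 1 - K)) ∧
      ∀ j, |(t j : ℝ)| ≤ Real.exp P := by
  have hcard : Fintype.card (α ⊕ α) = 2 * Fintype.card α := by
    rw [Fintype.card_sum, two_mul]
  have hfl : ∀ x : ℝ, |x| ≤ Real.exp E → |((⌊Real.exp K * x⌋ : ℤ) : ℝ)| ≤ Real.exp (K + E + 1) := by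
    intro x hx
    have h2 : |Real.exp K * x| ≤ Real.exp (K + E) := by
      rw [abs_mul, abs_of_pos (Real.exp_pos K), Real.exp_add]
      gcongr
    have h3 : (1 : ℝ) ≤ Real.exp (K + E) := Real.one_le_exp (by positivity)
    have h4 : |((⌊Real.exp K * x⌋ : ℤ) : ℝ)| ≤ Real.exp (K + E) + 1 := by
      have := abs_le.1 h2
      have := Int.floor_le (Real.exp K * x)
      have := Int.lt_floor_add_one (Real.exp K * x)
      exact abs_le.2 ⟨by linarith, by linarith⟩
    rw [Real.exp_add (K + E)]
    have := Real.add_one_le_exp (1 : ℝ)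
    nlinarith
  obtain ⟨t, ht, ht0, htP⟩ := exists_int_solution_le_exp
    (Sum.elim (fun i j => ⌊Real.exp K * (a i j).re⌋) (fun i j => ⌊Real.exp K * (a i j).im⌋))
    (by omega) (by omega) (q := q) (Z := K + E + 1) (P := P) (by positivity) hq
    (by
      rintro (i | i) j
      · exact hfl _ ((Complex.abs_re_le_norm _).trans (ha i j))
      · exact hfl _ ((Complex.abs_im_le_norm _).trans (ha i j)))
    (by rw [hcard]; push_cast; exact hP)
  have key : ∀ x : β → ℝ, ∑ j, ⌊Real.exp K * x j⌋ * t j = 0 →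
      |∑ j, (t j : ℝ) * x j| ≤ Real.exp (q + P - K) := by
    intro x hx
    have h1 : Real.exp K * ∑ j, (t j : ℝ) * x j =
        ∑ j, (t j : ℝ) * (Real.exp K * x j - ⌊Real.exp K * x j⌋) := by
      have : ∑ j, ((⌊Real.exp K * x j⌋ : ℤ) : ℝ) * t j = 0 := by exact_mod_cast hx
      rw [mul_sum, ← sub_zero (∑ j, Real.exp K * _), ← this, ← sum_sub_distrib]
      exact sum_congr rfl fun j _ => by ring
    have h2 : Real.exp K * |∑ j, (t j : ℝ) * x j| ≤ Real.exp q * Real.exp P := by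
      rw [show Real.exp K * |∑ j, (t j : ℝ) * x j| = |Real.exp K * ∑ j, (t j : ℝ) * x j| by
        rw [abs_mul, abs_of_pos (Real.exp_pos K)], h1]
      calc _ ≤ ∑ j, |(t j : ℝ) * (Real.exp K * x j - ⌊Real.exp K * x j⌋)| := abs_sum_le_sum_abs _ _
        _ ≤ ∑ _j : β, Real.exp P := by
          refine sum_le_sum fun j _ => ?_
          rw [abs_mul]
          have h3 : |Real.exp K * x j - ⌊Real.exp K * x j⌋| ≤ 1 := by
            rw [abs_of_nonneg (sub_nonneg.2 (Int.floor_le _))]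
            linarith [Int.lt_floor_add_one (Real.exp K * x j)]
          calc _ ≤ Real.exp P * 1 := mul_le_mul (htP j) h3 (abs_nonneg _) (Real.exp_pos _).le
            _ = _ := mul_one _
        _ ≤ _ := by
          rw [sum_const, nsmul_eq_mul, card_univ]
          gcongr
    rw [Real.exp_sub, Real.exp_add, le_div_iff₀ (Real.exp_pos K), mul_comm]
    exact h2
  refine ⟨t, ht, fun i => ?_, htP⟩
  have hre := key (fun j => (a i j).re) (ht0 (Sum.inl i))
  have him := key (fun j => (a i j).im) (ht0 (Sum.inr i))
  have ere : (∑ j, (t j : ℂ) * a i j).re = ∑ j, (t j : ℝ) * (a i j).re := by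
    simp [Complex.re_sum]
  have eim : (∑ j, (t j : ℂ) * a i j).im = ∑ j, (t j : ℝ) * (a i j).im := by
    simp [Complex.im_sum]
  refine (Complex.norm_le_abs_re_add_abs_im _).trans ?_
  rw [ere, eim, show q + P + 1 - K = (q + P - K) + 1 by ring, Real.exp_add _ 1]
  have := Real.add_one_le_exp (1 : ℝ)
  nlinarith [Real.exp_pos (q + P - K)]

end Siegel

theorem card_expBox (L : ℕ) : (expBox L).card = L ^ 3 := by
  simp only [expBox, card_product, card_range]
  ring

section AuxiliaryFunction

variable {ℓ₀ ℓ₁ ℓ₂ : ℂ} {b₁ b₂ : ℤ} {L : ℕ}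

theorem abs_projMonomial_le {X : ℝ} (hX : 1 ≤ X) (hL : (L : ℝ) ≤ Real.exp X)
    (hb₁ : |(b₁ : ℝ)| ≤ Real.exp X) (hb₂ : |(b₂ : ℝ)| ≤ Real.exp X) (m n : ℕ) {v : ℕ × ℕ × ℕ}
    (hv : v ∈ expBox L) : |(projMonomial b₁ b₂ m n v : ℝ)| ≤ Real.exp (3 * X * (m + n : ℕ)) := by
  have key : ∀ (b : ℤ) (i j : ℕ), i < L → j < L → |(b : ℝ)| ≤ Real.exp X →
      |(i : ℝ) + j * b| ≤ Real.exp (3 * X) := by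
    intro b i j hi hj hb
    have h2 : 2 ≤ Real.exp X := by linarith [Real.add_one_le_exp X]
    have hi' : (i : ℝ) ≤ L := by exact_mod_cast hi.le
    have hj' : (j : ℝ) ≤ L := by exact_mod_cast hj.le
    have e3 : Real.exp (3 * X) = Real.exp X * (Real.exp X * Real.exp X) := by
      rw [← Real.exp_add, ← Real.exp_add]; ring_nf
    have h4 : |(j : ℝ) * b| ≤ Real.exp X * Real.exp X := by
      rw [abs_mul, Nat.abs_cast]
      exact mul_le_mul (hj'.trans hL) hb (abs_nonneg _) (Real.exp_pos _).le
    have h5 : |(i : ℝ)| ≤ Real.exp X * Real.exp X := by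
      rw [Nat.abs_cast]
      nlinarith
    refine (abs_add_le _ _).trans ?_
    rw [e3]
    nlinarith
  obtain ⟨e₀, e₁, e₂⟩ := mem_expBox.1 hv
  have k₁ := key b₁ _ _ e₁ e₀ hb₁
  have k₂ := key b₂ _ _ e₂ e₀ hb₂
  simp only [projMonomial, projFst, projSnd]
  push_cast
  rw [abs_mul, abs_pow, abs_pow, mul_add, Real.exp_add, mul_comm (3 * X) (m : ℝ),
    mul_comm (3 * X) (n : ℝ), Real.exp_nat_mul, Real.exp_nat_mul]
  gcongr

theorem sum_abs_mul_projMonomial_le {X P : ℝ} (hX : 1 ≤ X) (hL : (L : ℝ) ≤ Real.exp X)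
    (hb₁ : |(b₁ : ℝ)| ≤ Real.exp X) (hb₂ : |(b₂ : ℝ)| ≤ Real.exp X) {p : ℕ × ℕ × ℕ → ℤ}
    (hp : ∀ v ∈ expBox L, |(p v : ℝ)| ≤ Real.exp P) {T m n : ℕ} (h : m + n ≤ T) :
    ∑ v ∈ expBox L, |((p v * projMonomial b₁ b₂ m n v : ℤ) : ℝ)| ≤
      Real.exp (3 * X + P + 3 * X * T) := by
  have hL3 : (L : ℝ) ^ 3 ≤ Real.exp (3 * X) := by
    rw [show 3 * X = (3 : ℕ) * X by norm_num, Real.exp_nat_mul]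
    gcongr
  calc _ ≤ ∑ _v ∈ expBox L, Real.exp P * Real.exp (3 * X * T) := by
        refine sum_le_sum fun v hv => ?_
        push_cast
        rw [abs_mul]
        refine mul_le_mul (hp v hv) ((abs_projMonomial_le hX hL hb₁ hb₂ m n hv).trans ?_)
          (abs_nonneg _) (Real.exp_pos _).le
        gcongr
    _ ≤ _ := by
        rw [sum_const, card_expBox, nsmul_eq_mul, add_assoc, Real.exp_add, Real.exp_add]
        push_cast
        gcongr

theorem exists_algSum_eq_zero {X : ℕ} (hX : 1 ≤ X) (h₀ : ‖ℓ₀‖ ≤ X) (h₁ : ‖ℓ₁‖ ≤ X)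
    (h₂ : ‖ℓ₂‖ ≤ X)
    (hα : LiouvilleBound (Complex.exp ℓ₀) (Complex.exp ℓ₁) (Complex.exp ℓ₂) X)
    (hL : (L : ℝ) ≤ Real.exp X) (hb₁ : |(b₁ : ℝ)| ≤ Real.exp X) (hb₂ : |(b₂ : ℝ)| ≤ Real.exp X)
    {S T : ℕ} (hS : 0 < S) (hT : 0 < T) (hcard : 2 * (S * (T * T)) < L ^ 3) {K P : ℝ} (hK : 0 ≤ K)
    (hP : (3 * X + (K + (6 * (X * T) + 3 * (L * X * S)) + 1)) * (2 * (S * (T * T))) ≤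
      P * (L ^ 3 - 2 * (S * (T * T))))
    (hK' : X * ((3 * X + P + 6 * (X * T)) + X * (L * S)) + 3 * X + P + 1 < K) :
    ∃ p : ℕ × ℕ × ℕ → ℤ, (∃ v ∈ expBox L, p v ≠ 0) ∧ (∀ v ∈ expBox L, |(p v : ℝ)| ≤ Real.exp P) ∧
      ∀ m n, m + n < T → ∀ l < S, algSum ℓ₀ ℓ₁ ℓ₂ b₁ b₂ L p m n l = 0 := by
  have hX' : (1 : ℝ) ≤ X := by exact_mod_cast hX
  have hL3 : (L : ℝ) ^ 3 ≤ Real.exp (3 * X) := by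
    rw [show (3 : ℝ) * X = (3 : ℕ) * X by norm_num, Real.exp_nat_mul]
    gcongr
  have hα' : Fintype.card (Fin S × Fin T × Fin T) = S * (T * T) := by simp
  have hβ' : Fintype.card (expBox L) = L ^ 3 := by rw [Fintype.card_coe, card_expBox]
  obtain ⟨t, ht, hts, htP⟩ := exists_int_almost_solution
    (fun (i : Fin S × Fin T × Fin T) (v : expBox L) =>
      (projMonomial b₁ b₂ i.2.1 i.2.2 v : ℂ) * Complex.exp (logForm ℓ₀ ℓ₁ ℓ₂ v * (i.1 : ℕ)))
    (by rw [hα']; positivity) (by rw [hα', hβ']; exact hcard)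
    (q := 3 * X) (E := 6 * (X * T) + 3 * (L * X * S)) (K := K) (P := P) (by positivity) hK
    (by rw [hβ']; push_cast; exact hL3)
    (by
      rintro ⟨l, m, n⟩ ⟨v, hv⟩
      dsimp only
      rw [norm_mul, Complex.norm_intCast, Real.exp_add]
      refine mul_le_mul ((abs_projMonomial_le hX' hL hb₁ hb₂ _ _ hv).trans ?_)
        ((Complex.norm_exp_le_exp_norm _).trans ?_) (norm_nonneg _) (Real.exp_pos _).le
      · rw [show 6 * (X * T : ℝ) = 3 * X * (T + T : ℕ) by push_cast; ring]
        have : (m : ℕ) + (n : ℕ) ≤ T + T := by omega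
        gcongr
      · rw [norm_mul, Complex.norm_natCast, Real.exp_le_exp, ← mul_assoc, ← mul_assoc]
        have := norm_logForm_le h₀ h₁ h₂ hv
        have hl : ((l : ℕ) : ℝ) ≤ S := by exact_mod_cast l.2.le
        gcongr)
    (by rw [hα', hβ']; push_cast; exact hP)
  refine ⟨fun v => if hv : v ∈ expBox L then t ⟨v, hv⟩ else 0, ?_, ?_, ?_⟩
  · obtain ⟨⟨v, hv⟩, hne⟩ := Function.ne_iff.1 ht
    exact ⟨v, hv, by simpa [hv] using hne⟩
  · intro v hv
    simpa [hv] using htP ⟨v, hv⟩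
  · intro m n hmn l hl
    have hsum : algSum ℓ₀ ℓ₁ ℓ₂ b₁ b₂ L (fun v => if hv : v ∈ expBox L then t ⟨v, hv⟩ else 0) m n l =
        ∑ j : expBox L, (t j : ℂ) * ((projMonomial b₁ b₂ m n j : ℂ) *
          Complex.exp (logForm ℓ₀ ℓ₁ ℓ₂ j * l)) := by
      rw [algSum, ← sum_coe_sort (expBox L)]
      refine sum_congr rfl fun v _ => ?_
      simp [mul_assoc]
    have hup := hts (⟨l, hl⟩, ⟨m, by omega⟩, ⟨n, by omega⟩)
    dsimp only at hup
    rw [← hsum] at hup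
    refine (algSum_eq_zero_or_le hα (w := 3 * X + P + 6 * (X * T)) ?_ hl.le).resolve_right
        fun hlow => ?_
    · refine (sum_abs_mul_projMonomial_le hX' hL hb₁ hb₂ (P := P) ?_ hmn.le).trans ?_
      · intro v hv
        simpa [hv] using htP ⟨v, hv⟩
      · rw [Real.exp_le_exp]
        have : (0 : ℝ) ≤ X * T := by positivity
        nlinarith
    · have := Real.exp_le_exp.1 (hlow.trans hup)
      linarith

end AuxiliaryFunction

theorem mul_pow_le_pow_of_lt {c x : ℝ} (hc : 1 ≤ c) (hx : c ≤ x) {i j : ℕ} (h : i < j) :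
    c * x ^ i ≤ x ^ j := by
  obtain ⟨d, rfl⟩ := Nat.exists_eq_add_of_lt h
  have h1 : 1 ≤ x := hc.trans hx
  rw [show i + d + 1 = i + (d + 1) by ring, pow_add, mul_comm]
  gcongr
  exact hx.trans (le_self_pow₀ h1 (by omega))

theorem pow_twentyEight_le_exp {x : ℝ} (hx : 10 ^ 32 ≤ x) : x ^ 28 ≤ Real.exp x := by
  have h1 := Real.pow_div_factorial_le_exp (x := x) (by linarith) 29
  refine le_trans ?_ h1
  rw [le_div_iff₀ (by positivity), pow_succ]
  refine mul_le_mul_of_nonneg_left (le_trans ?_ hx) (by positivity)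
  norm_num [Nat.factorial]

section AuxiliaryFunction

variable {ℓ₀ ℓ₁ ℓ₂ : ℂ} {b₁ b₂ : ℤ}

theorem exists_algSum_eq_zero_of_lt {X : ℕ} (hX : 10 ^ 32 ≤ X) (h₀ : ‖ℓ₀‖ ≤ X) (h₁ : ‖ℓ₁‖ ≤ X)
    (h₂ : ‖ℓ₂‖ ≤ X)
    (hα : LiouvilleBound (Complex.exp ℓ₀) (Complex.exp ℓ₁) (Complex.exp ℓ₂) X)
    (hb₁ : |(b₁ : ℝ)| ≤ Real.exp X) (hb₂ : |(b₂ : ℝ)| ≤ Real.exp X)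
    (hΛ : ‖ℓ₀ - b₁ * ℓ₁ - b₂ * ℓ₂‖ ≤ Real.exp (-(X : ℝ) ^ 211)) :
    ∃ p : ℕ × ℕ × ℕ → ℤ, (∃ v ∈ expBox (X ^ 28), p v ≠ 0) ∧
      ∀ m n, m + n < X ^ 38 → ∀ l < X ^ 88, algSum ℓ₀ ℓ₁ ℓ₂ b₁ b₂ (X ^ 28) p m n l = 0 := by
  have hx : (10 : ℝ) ^ 32 ≤ X := by exact_mod_cast hX
  have hX1 : 1 ≤ X := le_trans (by norm_num) hX
  have hx1 : (1 : ℝ) ≤ X := by exact_mod_cast hX1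
  have hL : ((X ^ 28 : ℕ) : ℝ) ≤ Real.exp X := by
    push_cast
    exact pow_twentyEight_le_exp hx
  have hmono : ∀ {i j : ℕ}, i < j → 10 ^ 32 * (X : ℝ) ^ i ≤ (X : ℝ) ^ j := fun h =>
    mul_pow_le_pow_of_lt (by norm_num) hx h
  have hle : ∀ {i j : ℕ}, i ≤ j → (X : ℝ) ^ i ≤ (X : ℝ) ^ j := fun h => pow_le_pow_right₀ hx1 h
  have hone : ∀ i : ℕ, (1 : ℝ) ≤ (X : ℝ) ^ i := fun i => one_le_pow₀ hx1
  obtain ⟨p, hp, hpP, hp0⟩ := exists_algSum_eq_zero (L := X ^ 28) (S := X ^ 4)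
      (T := 2 ^ 12 * X ^ 38)
    (K := (X : ℝ) ^ 42) (P := (X : ℝ) ^ 40) hX1 h₀ h₁ h₂ hα hL hb₁ hb₂ (by positivity)
    (by positivity)
    (by
      have h : (2 ^ 25 : ℕ) * X ^ 80 < X ^ 84 := by
        rw [show X ^ 84 = X ^ 4 * X ^ 80 by ring]
        gcongr
        calc 2 ^ 25 < 10 ^ 32 := by norm_num
          _ ≤ X := hX
          _ ≤ X ^ 4 := Nat.le_self_pow (by norm_num) X
      calc _ = (2 ^ 25 : ℕ) * X ^ 80 := by ring
        _ < X ^ 84 := h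
        _ = _ := by ring)
    (by positivity)
    (by
      simp only [Nat.cast_mul, Nat.cast_pow, Nat.cast_ofNat]
      have e1 : (3 * X + ((X : ℝ) ^ 42 + (6 * (X * (2 ^ 12 * X ^ 38)) + 3 * (X ^ 28 * X * X ^ 4)) +
          1)) ≤
          2 * X ^ 42 := by
        have := hmono (show 1 < 42 by norm_num)
        have := hmono (show 39 < 42 by norm_num)
        have := hmono (show 33 < 42 by norm_num)
        have := hone 39
        linarith
      have e2 : 2 * ((X : ℝ) ^ 4 * (2 ^ 12 * X ^ 38 * (2 ^ 12 * X ^ 38))) = 2 ^ 25 * X ^ 80 := by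
          ring
      have e3 : ((X : ℝ) ^ 28) ^ 3 = X ^ 84 := by ring
      rw [e2, e3]
      calc _ ≤ 2 * (X : ℝ) ^ 42 * (2 ^ 25 * X ^ 80) := by gcongr
        _ ≤ X ^ 40 * (X ^ 84 / 2) := by
          have := hmono (show 122 < 124 by norm_num)
          have := hone 122
          linarith
        _ ≤ _ := by
          gcongr
          have := hmono (show 80 < 84 by norm_num)
          have := hone 80
          linarith)
    (by
      push_cast
      have := hmono (show 2 < 42 by norm_num)
      have := hmono (show 1 < 42 by norm_num)
      have := hmono (show 41 < 42 by norm_num)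
      have := hmono (show 40 < 42 by norm_num)
      have := hmono (show 34 < 42 by norm_num)
      have := hone 41
      linarith)
  refine ⟨p, hp, ?_⟩
  have hind : ∀ j ≤ 12, ∀ m n, m + n < 2 ^ (12 - j) * X ^ 38 → ∀ l < X ^ (4 + 7 * j),
      algSum ℓ₀ ℓ₁ ℓ₂ b₁ b₂ (X ^ 28) p m n l = 0 := by
    intro j
    induction j with
    | zero => intro _; exact hp0
    | succ j ih =>
      intro hj
      have hj2 : 2 ^ (12 - j) = 2 * 2 ^ (12 - (j + 1)) := by
        rw [← pow_succ']
        congr 1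
        omega
      have ih' := ih (by omega)
      rw [hj2, mul_assoc] at ih'
      have ht1 : (2 : ℝ) ^ (12 - (j + 1)) ≤ 2 ^ 12 := pow_le_pow_right₀ (by norm_num) (by omega)
      have ht0 : (1 : ℝ) ≤ (2 : ℝ) ^ (12 - (j + 1)) := one_le_pow₀ (by norm_num)
      have hTup : (2 : ℝ) ^ (12 - (j + 1)) * X ^ 38 ≤ X ^ 39 := by
        have := hmono (show 38 < 39 by norm_num)
        have := hone 38
        nlinarith
      have hTlow : (X : ℝ) ^ 38 ≤ (2 : ℝ) ^ (12 - (j + 1)) * X ^ 38 := by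
        have := hone 38
        nlinarith
      have hw2 : 3 * X + X ^ 40 + 3 * X * ((2 ^ 12 * X ^ 38 : ℕ) : ℝ) ≤ 2 * (X : ℝ) ^ 40 := by
        push_cast
        have := hmono (show 1 < 40 by norm_num)
        have := hmono (show 39 < 40 by norm_num)
        have := hone 39
        linarith
      have hS'1 : (X : ℝ) ^ (4 + 7 * (j + 1)) = X ^ (4 + 7 * j) * X ^ 7 := by ring
      have hS'2 : (X : ℝ) ^ (4 + 7 * (j + 1)) ≤ X ^ 88 := hle (by omega)
      have hS1 : (1 : ℝ) ≤ (X : ℝ) ^ (4 + 7 * j) := hone _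
      have hS2 : (X : ℝ) ^ (4 + 7 * j) ≤ X ^ 81 := hle (by omega)
      refine algSum_eq_zero_of_extrapolation (S := X ^ (4 + 7 * j))
        (w := 2 * (X : ℝ) ^ 40) (V := (X : ℝ) ^ 211) hX1 h₀ h₁ h₂ hα
        (Nat.pow_le_pow_right hX1 (by omega)) (Nat.one_le_pow _ _ hX1) (by positivity) ?_ ih' hΛ ?_
        ?_
      · intro m n hmn
        refine (sum_abs_mul_projMonomial_le hx1 hL hb₁ hb₂ hpP (T := 2 ^ 12 * X ^ 38) ?_).trans
          (Real.exp_le_exp.2 hw2)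
        rw [← mul_assoc, ← hj2] at hmn
        refine hmn.le.trans (Nat.mul_le_mul_right _ (Nat.pow_le_pow_right (by norm_num) (by omega)))
      · simp only [Nat.cast_mul, Nat.cast_pow, Nat.cast_ofNat]
        rw [hS'1]
        set s := (X : ℝ) ^ (4 + 7 * j) with hs
        have hs4 : (X : ℝ) ^ 4 ≤ s := hle (by omega)
        calc _ = 2 * X ^ 41 + s * X ^ 37 + 2 + 2 * X ^ 40 + 56 * (s * X ^ 36) := by ring
          _ ≤ s * X ^ 38 := by
            have f1 := hmono (show 37 < 38 by norm_num)
            have f2 := hmono (show 36 < 38 by norm_num)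
            have f3 := hmono (show 41 < 42 by norm_num)
            have f4 := hmono (show 40 < 42 by norm_num)
            have f5 := hone 41
            have f6 : X ^ 4 * X ^ 38 ≤ s * X ^ 38 := by gcongr
            have f7 : s * (10 ^ 32 * X ^ 37) ≤ s * X ^ 38 := by gcongr
            have f8 : s * (10 ^ 32 * X ^ 36) ≤ s * X ^ 38 := by gcongr
            have f9 : 0 ≤ s * X ^ 38 := by positivity
            linarith
          _ ≤ _ := by gcongr
      · simp only [Nat.cast_mul, Nat.cast_pow, Nat.cast_ofNat]
        calc _ ≤ 2 * (X : ℝ) ^ 40 + 3 * (X ^ 28 * X * X ^ 88) + 2 * (X ^ 28 * X ^ 88) + 2 *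
            (X * X ^ 39) +
              X ^ 81 * X ^ 39 * (2 * X ^ 88 + (X ^ 39 + X ^ 39) ^ 2) +
              X * (2 * X ^ 40 + X * (X ^ 28 * X ^ 88)) + 2 := by
              gcongr
              · exact hone _
          _ ≤ _ := by
            have := hmono (show 40 < 211 by norm_num)
            have := hmono (show 117 < 211 by norm_num)
            have := hmono (show 116 < 211 by norm_num)
            have := hmono (show 208 < 211 by norm_num)
            have := hmono (show 198 < 211 by norm_num)
            have := hmono (show 41 < 211 by norm_num)
            have := hmono (show 118 < 211 by norm_num)
            have := hone 40
            linarith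
  simpa using hind 12 le_rfl

end AuxiliaryFunction

section Nonvanishing

variable {ℓ₀ ℓ₁ ℓ₂ : ℂ} {b₁ b₂ : ℤ} {L : ℕ} {p : ℕ × ℕ × ℕ → ℤ}

open Classical in
theorem sum_fiber_eq_zero {S m n : ℕ} (hS : L ^ 3 ≤ S)
    (h : ∀ l < S, algSum ℓ₀ ℓ₁ ℓ₂ b₁ b₂ L p m n l = 0) {v₀ : ℕ × ℕ × ℕ} (hv₀ : v₀ ∈ expBox L) :
    ∑ v ∈ expBox L with Complex.exp (logForm ℓ₀ ℓ₁ ℓ₂ v) = Complex.exp (logForm ℓ₀ ℓ₁ ℓ₂ v₀),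
      (p v : ℝ) * projMonomial b₁ b₂ m n v = 0 := by
  set E : ℕ × ℕ × ℕ → ℂ := fun v => Complex.exp (logForm ℓ₀ ℓ₁ ℓ₂ v) with hE
  have hpoly : ∀ Q : Polynomial ℂ, Q.natDegree < S →
      ∑ v ∈ expBox L, ((p v * projMonomial b₁ b₂ m n v : ℤ) : ℂ) * Q.eval (E v) = 0 := by
    intro Q hQ
    simp_rw [Polynomial.eval_eq_sum_range' hQ, mul_sum]
    rw [sum_comm]
    refine sum_eq_zero fun l hl => ?_
    have := h l (mem_range.1 hl)
    rw [algSum] at this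
    calc _ = Q.coeff l * ∑ v ∈ expBox L, ((p v * projMonomial b₁ b₂ m n v : ℤ) : ℂ) *
          Complex.exp (logForm ℓ₀ ℓ₁ ℓ₂ v * l) := by
          rw [mul_sum]
          refine sum_congr rfl fun v _ => ?_
          rw [mul_comm (logForm ℓ₀ ℓ₁ ℓ₂ v), Complex.exp_nat_mul]
          ring
      _ = 0 := by rw [this, mul_zero]
  set s := ((expBox L).image E).erase (E v₀) with hs
  have hcard : s.card < S := by
    have h1 : s.card < ((expBox L).image E).card := card_erase_lt_of_mem (mem_image_of_mem _ hv₀)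
    have h2 := card_image_le (s := expBox L) (f := E)
    rw [card_expBox] at h2
    omega
  have hQ := hpoly (∏ ζ ∈ s, (Polynomial.X - Polynomial.C ζ))
    (by rwa [Polynomial.natDegree_finsetProd_X_sub_C_eq_card])
  set q := (∏ ζ ∈ s, (Polynomial.X - Polynomial.C ζ)).eval (E v₀) with hq
  have hq0 : q ≠ 0 := by
    rw [hq, Polynomial.eval_prod]
    refine prod_ne_zero_iff.2 fun ζ hζ => ?_
    simpa [sub_eq_zero] using (ne_of_mem_erase hζ).symm
  have hsum : (∑ v ∈ expBox L with E v = E v₀, ((p v * projMonomial b₁ b₂ m n v : ℤ) : ℂ)) * q = 0 := by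
    rw [← hQ, sum_mul, sum_filter]
    refine sum_congr rfl fun v hv => ?_
    split_ifs with hvv
    · rw [hq, hvv]
    · rw [Polynomial.eval_prod, prod_eq_zero (i := E v) (mem_erase.2 ⟨hvv, mem_image_of_mem _ hv⟩)
        (by simp), mul_zero]
  have hint : ∑ v ∈ expBox L with E v = E v₀, p v * projMonomial b₁ b₂ m n v = 0 := by
    exact_mod_cast (mul_eq_zero.1 hsum).resolve_right hq0
  exact_mod_cast hint

theorem sum_mul_prod_affine_eq_zero {ι : Type*} {C : Finset (ℕ × ℕ × ℕ)} {T : ℕ}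
    (h : ∀ m n, m + n < T → ∑ v ∈ C, (p v : ℝ) * projMonomial b₁ b₂ m n v = 0) (a b c : ι → ℝ)
    (s : Finset ι) : ∀ m n, m + n + s.card < T →
    ∑ v ∈ C, (p v : ℝ) * projMonomial b₁ b₂ m n v *
      ∏ i ∈ s, (a i + b i * projFst b₁ v + c i * projSnd b₂ v) = 0 := by
  classical
  induction s using Finset.induction_on with
  | empty => intro m n hmn; simpa using h m n (by simpa using hmn)
  | insert i s hi ih =>
    intro m n hmn
    rw [card_insert_of_notMem hi] at hmn
    have h0 := ih m n (by omega)
    have h1 := ih (m + 1) n (by omega)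
    have h2 := ih m (n + 1) (by omega)
    simp_rw [prod_insert hi]
    calc _ = a i * ∑ v ∈ C, (p v : ℝ) * projMonomial b₁ b₂ m n v *
            ∏ i ∈ s, (a i + b i * projFst b₁ v + c i * projSnd b₂ v) +
          b i * ∑ v ∈ C, (p v : ℝ) * projMonomial b₁ b₂ (m + 1) n v *
            ∏ i ∈ s, (a i + b i * projFst b₁ v + c i * projSnd b₂ v) +
          c i * ∑ v ∈ C, (p v : ℝ) * projMonomial b₁ b₂ m (n + 1) v *
            ∏ i ∈ s, (a i + b i * projFst b₁ v + c i * projSnd b₂ v) := by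
          rw [mul_sum, mul_sum, mul_sum, ← sum_add_distrib, ← sum_add_distrib]
          refine sum_congr rfl fun v _ => ?_
          simp only [projMonomial]
          push_cast
          ring
      _ = 0 := by rw [h0, h1, h2]; ring

theorem exists_algSum_ne_zero {S T : ℕ} (hS : L ^ 3 ≤ S) (hT : 3 * L < T)
    (hp : ∃ v ∈ expBox L, p v ≠ 0) {c₀ c₁ c₂ : ℝ}
    (hc : ∀ v w : ℕ × ℕ × ℕ, Complex.exp (logForm ℓ₀ ℓ₁ ℓ₂ v) = Complex.exp (logForm ℓ₀ ℓ₁ ℓ₂ w) →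
      c₀ * v.1 + c₁ * v.2.1 + c₂ * v.2.2 = c₀ * w.1 + c₁ * w.2.1 + c₂ * w.2.2)
    (hd : c₀ - c₁ * b₁ - c₂ * b₂ ≠ 0) :
    ∃ m n, m + n < T ∧ ∃ l < S, algSum ℓ₀ ℓ₁ ℓ₂ b₁ b₂ L p m n l ≠ 0 := by
  classical
  by_contra! hcon
  obtain ⟨v₀, hv₀, hpv₀⟩ := hp
  set d := c₀ - c₁ * b₁ - c₂ * b₂ with hd_def
  set κ := c₀ * v₀.1 + c₁ * v₀.2.1 + c₂ * v₀.2.2 with hκ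
  let coord : Fin 3 → ℕ × ℕ × ℕ → ℕ := fun i v => ![v.1, v.2.1, v.2.2] i
  set C := (expBox L).filter fun v =>
    Complex.exp (logForm ℓ₀ ℓ₁ ℓ₂ v) = Complex.exp (logForm ℓ₀ ℓ₁ ℓ₂ v₀) with hC
  set s : Finset (Fin 3 × ℕ) := (univ ×ˢ range L).filter fun i => i.2 ≠ coord i.1 v₀ with hs
  have hscard : s.card ≤ 3 * L := by
    refine (card_filter_le _ _).trans ?_
    simp
  have key := sum_mul_prod_affine_eq_zero (p := p) (b₁ := b₁) (b₂ := b₂) (C := C) (T := T)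
    (fun m n hmn => sum_fiber_eq_zero hS (hcon m n hmn) hv₀)
    (fun i => ![κ / d, -b₁ * (κ / d), -b₂ * (κ / d)] i.1 - i.2)
    (fun i => ![-c₁ / d, 1 + b₁ * (c₁ / d), b₂ * (c₁ / d)] i.1)
    (fun i => ![-c₂ / d, b₁ * (c₂ / d), 1 + b₂ * (c₂ / d)] i.1) s 0 0 (by omega)
  have haff : ∀ v ∈ C, ∀ i : Fin 3 × ℕ,
      (![κ / d, -b₁ * (κ / d), -b₂ * (κ / d)] i.1 - i.2) +
        ![-c₁ / d, 1 + b₁ * (c₁ / d), b₂ * (c₁ / d)] i.1 * projFst b₁ v +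
        ![-c₂ / d, b₁ * (c₂ / d), 1 + b₂ * (c₂ / d)] i.1 * projSnd b₂ v =
      (coord i.1 v : ℝ) - i.2 := by
    rintro v hv ⟨i, u⟩
    have e : κ = c₀ * v.1 + c₁ * v.2.1 + c₂ * v.2.2 := (hc _ _ (mem_filter.1 hv).2).symm
    have e0 : (κ - c₁ * projFst b₁ v - c₂ * projSnd b₂ v) / d = v.1 := by
      rw [div_eq_iff hd, e, hd_def]
      simp only [projFst, projSnd]
      push_cast
      ring
    fin_cases i
    · simp only [coord, Fin.zero_eta, Matrix.cons_val_zero]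
      rw [← e0]
      ring
    · simp only [coord, Fin.mk_one, Matrix.cons_val_one, Matrix.cons_val_zero]
      have : (v.2.1 : ℝ) = projFst b₁ v - b₁ * v.1 := by simp only [projFst]; push_cast; ring
      rw [this, ← e0]
      ring
    · simp only [coord, Fin.reduceFinMk, Matrix.cons_val]
      have : (v.2.2 : ℝ) = projSnd b₂ v - b₂ * v.1 := by simp only [projSnd]; push_cast; ring
      rw [this, ← e0]
      ring
  have hv₀C : v₀ ∈ C := mem_filter.2 ⟨hv₀, rfl⟩
  rw [sum_eq_single_of_mem v₀ hv₀C] at key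
  · rw [prod_congr rfl fun i _ => haff v₀ hv₀C i] at key
    have hne : ∏ i ∈ s, ((coord i.1 v₀ : ℝ) - i.2) ≠ 0 :=
      prod_ne_zero_iff.2 fun i hi => sub_ne_zero.2 (by exact_mod_cast (mem_filter.1 hi).2.symm)
    simp [projMonomial, hpv₀, hne] at key
  · intro v hv hne
    rw [prod_congr rfl fun i _ => haff v hv i]
    obtain ⟨i, hi⟩ : ∃ i, coord i v ≠ coord i v₀ := by
      by_contra! hall
      exact hne (Prod.ext (hall 0) (Prod.ext (hall 1) (hall 2)))
    have hbox := mem_expBox.1 (mem_filter.1 hv).1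
    have hlt : coord i v < L := by
      fin_cases i
      exacts [hbox.1, hbox.2.1, hbox.2.2]
    rw [prod_eq_zero (i := (i, coord i v)) (mem_filter.2 ⟨by simpa using hlt, hi⟩) (by simp),
        mul_zero]

end Nonvanishing

/-- An effective lower bound for a nondegenerate linear form in three logarithms. -/
theorem exp_neg_le_norm_logForm {ℓ₀ ℓ₁ ℓ₂ : ℂ} {b₁ b₂ : ℤ} {X : ℕ} (hX : 10 ^ 32 ≤ X)
    (h₀ : ‖ℓ₀‖ ≤ X) (h₁ : ‖ℓ₁‖ ≤ X) (h₂ : ‖ℓ₂‖ ≤ X)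
    (hα : LiouvilleBound (Complex.exp ℓ₀) (Complex.exp ℓ₁) (Complex.exp ℓ₂) X)
    (hb₁ : |(b₁ : ℝ)| ≤ Real.exp X) (hb₂ : |(b₂ : ℝ)| ≤ Real.exp X) {c₀ c₁ c₂ : ℝ}
    (hc : ∀ v w : ℕ × ℕ × ℕ, Complex.exp (logForm ℓ₀ ℓ₁ ℓ₂ v) = Complex.exp (logForm ℓ₀ ℓ₁ ℓ₂ w) →
      c₀ * v.1 + c₁ * v.2.1 + c₂ * v.2.2 = c₀ * w.1 + c₁ * w.2.1 + c₂ * w.2.2)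
    (hd : c₀ - c₁ * b₁ - c₂ * b₂ ≠ 0) :
    Real.exp (-(X : ℝ) ^ 211) ≤ ‖ℓ₀ - b₁ * ℓ₁ - b₂ * ℓ₂‖ := by
  by_contra! hlt
  obtain ⟨p, hp, hp0⟩ := exists_algSum_eq_zero_of_lt hX h₀ h₁ h₂ hα hb₁ hb₂ hlt.le
  obtain ⟨m, n, hmn, l, hl, hne⟩ := exists_algSum_ne_zero (S := X ^ 88) (T := X ^ 38)
    (by rw [← pow_mul]; exact Nat.pow_le_pow_right (by omega) (by norm_num))
    (by
      have : 3 < X ^ 10 := lt_of_lt_of_le (by omega : 3 < X) (Nat.le_self_pow (by norm_num) X)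
      calc 3 * X ^ 28 < X ^ 10 * X ^ 28 := by gcongr
        _ = X ^ 38 := by ring) hp hc hd
  exact hne (hp0 m n hmn l hl)

section Liouville

variable {F : Type*} [Field F] [NumberField F]

theorem one_le_norm_norm_of_isIntegral {x : F} (hx : IsIntegral ℤ x) (h0 : x ≠ 0) :
    1 ≤ ‖Algebra.norm ℚ x‖ := by
  obtain ⟨n, hn⟩ := IsIntegrallyClosed.isIntegral_iff.1 (Algebra.isIntegral_norm ℚ hx)
  have hn0 : n ≠ 0 := by
    rintro rfl
    rw [map_zero] at hn
    exact h0 (Algebra.norm_eq_zero_iff.1 hn.symm)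
  rw [← hn]
  simp only [eq_intCast]
  rw [show ‖(n : ℚ)‖ = ‖(n : ℤ)‖ from by simp, Int.norm_eq_abs]
  exact_mod_cast Int.one_le_abs hn0

theorem house_le_of_forall {x : F} {B : ℝ} (hB : 0 ≤ B) (h : ∀ ψ : F →+* ℂ, ‖ψ x‖ ≤ B) :
    NumberField.house x ≤ B :=
  (pi_norm_le_iff_of_nonneg hB).2 h

theorem liouvilleBound_of_numberField (ι : F →+* ℂ) {a₀ a₁ a₂ c₀ c₁ c₂ : F}
    (ha₀ : IsIntegral ℤ a₀) (ha₁ : IsIntegral ℤ a₁) (ha₂ : IsIntegral ℤ a₂)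
    (hc₀ : IsIntegral ℤ c₀) (hc₁ : IsIntegral ℤ c₁) (hc₂ : IsIntegral ℤ c₂)
    (hn₀ : c₀ ≠ 0) (hn₁ : c₁ ≠ 0) (hn₂ : c₂ ≠ 0) {B : ℝ} (hB : 0 ≤ B)
    (hψ : ∀ ψ : F →+* ℂ, (‖ψ a₀‖ ≤ Real.exp B ∧ ‖ψ a₁‖ ≤ Real.exp B ∧ ‖ψ a₂‖ ≤ Real.exp B) ∧
      ‖ψ c₀‖ ≤ Real.exp B ∧ ‖ψ c₁‖ ≤ Real.exp B ∧ ‖ψ c₂‖ ≤ Real.exp B) {X : ℕ}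
    (hX : Module.finrank ℚ F ≤ X) (hXB : 3 * B ≤ X) :
    LiouvilleBound (ι (a₀ / c₀)) (ι (a₁ / c₁)) (ι (a₂ / c₂)) X := by
  intro s c e N w he hw
  by_cases hsum : ∑ v ∈ s, (c v : ℂ) * (ι (a₀ / c₀) ^ (e v).1 * ι (a₁ / c₁) ^ (e v).2.1 *
    ι (a₂ / c₂) ^ (e v).2.2) = 0
  · exact Or.inl hsum
  refine Or.inr ?_
  set σ := ∑ v ∈ s, (c v : ℂ) * (ι (a₀ / c₀) ^ (e v).1 * ι (a₁ / c₁) ^ (e v).2.1 *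
    ι (a₂ / c₂) ^ (e v).2.2) with hσ
  have hw0 : 0 ≤ w := by
    by_contra! hneg
    refine hsum (sum_eq_zero fun v hv => ?_)
    have h1 : |(c v : ℝ)| < 1 := (single_le_sum (f := fun v => |(c v : ℝ)|)
      (fun _ _ => abs_nonneg _) hv).trans_lt (hw.trans_lt (Real.exp_lt_one_iff.2 hneg))
    have h2 : c v = 0 := Int.abs_lt_one_iff.1 (by exact_mod_cast h1)
    rw [h2, Int.cast_zero, zero_mul]
  set m : ℕ × ℕ × ℕ → F := fun v => (a₀ ^ (e v).1 * c₀ ^ (N - (e v).1)) *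
    (a₁ ^ (e v).2.1 * c₁ ^ (N - (e v).2.1)) * (a₂ ^ (e v).2.2 * c₂ ^ (N - (e v).2.2)) with hm
  set β : F := ∑ v ∈ s, (c v : F) * m v with hβ
  have hβint : IsIntegral ℤ β := IsIntegral.sum _ fun v _ => by
    have : IsIntegral ℤ (c v : F) := isIntegral_algebraMap (x := c v)
    exact this.mul ((((ha₀.pow _).mul (hc₀.pow _)).mul ((ha₁.pow _).mul (hc₁.pow _))).mul
      ((ha₂.pow _).mul (hc₂.pow _)))
  have hfac : ∀ {a c : F} {i : ℕ}, c ≠ 0 → i ≤ N → a ^ i * c ^ (N - i) = (a / c) ^ i * c ^ N := by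
    intro a c i h hi
    rw [div_pow, div_mul_eq_mul_div, mul_div_assoc]
    congr 1
    rw [eq_div_iff (pow_ne_zero _ h), ← pow_add, Nat.sub_add_cancel hi]
  have hβι : ι β = σ * ι (c₀ * c₁ * c₂) ^ N := by
    rw [hβ, map_sum, hσ, sum_mul]
    refine sum_congr rfl fun v hv => ?_
    obtain ⟨i₀, i₁, i₂⟩ := he v hv
    rw [hm]
    dsimp only
    rw [hfac hn₀ i₀, hfac hn₁ i₁, hfac hn₂ i₂]
    simp only [map_mul, map_pow, map_intCast]
    ring
  have hβ0 : β ≠ 0 := by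
    intro h0
    rw [h0, map_zero] at hβι
    refine hsum ((mul_eq_zero.1 hβι.symm).resolve_right ?_)
    exact pow_ne_zero _ ((map_ne_zero ι).2 (mul_ne_zero (mul_ne_zero hn₀ hn₁) hn₂))
  have hpow : ∀ (ψ : F →+* ℂ) {a c : F} {i : ℕ}, ‖ψ a‖ ≤ Real.exp B → ‖ψ c‖ ≤ Real.exp B → i ≤ N →
      ‖ψ (a ^ i * c ^ (N - i))‖ ≤ Real.exp (N * B) := by
    intro ψ a c i ha hc hi
    rw [map_mul, map_pow, map_pow, norm_mul, norm_pow, norm_pow, Real.exp_nat_mul]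
    calc _ ≤ Real.exp B ^ i * Real.exp B ^ (N - i) := by gcongr
      _ = _ := by rw [← pow_add, Nat.add_sub_cancel' hi]
  have hhouse : NumberField.house β ≤ Real.exp (w + 3 * (N * B)) := by
    refine house_le_of_forall (Real.exp_pos _).le fun ψ => ?_
    obtain ⟨⟨p₀, p₁, p₂⟩, q₀, q₁, q₂⟩ := hψ ψ
    rw [hβ, map_sum]
    calc _ ≤ ∑ v ∈ s, |(c v : ℝ)| * Real.exp (3 * (N * B)) := by
          refine norm_sum_le_of_le _ fun v hv => ?_
          obtain ⟨i₀, i₁, i₂⟩ := he v hv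
          rw [map_mul, map_intCast, norm_mul, Complex.norm_intCast]
          gcongr
          rw [hm]
          dsimp only
          rw [map_mul, map_mul, norm_mul, norm_mul,
            show 3 * (N * B) = N * B + N * B + N * B by ring, Real.exp_add, Real.exp_add]
          exact mul_le_mul (mul_le_mul (hpow ψ p₀ q₀ i₀) (hpow ψ p₁ q₁ i₁) (norm_nonneg _)
            (Real.exp_pos _).le) (hpow ψ p₂ q₂ i₂) (norm_nonneg _) (by positivity)
      _ ≤ _ := by
          rw [← sum_mul, Real.exp_add]
          gcongr
  have hcN : ‖ι (c₀ * c₁ * c₂) ^ N‖ ≤ Real.exp (3 * (N * B)) := by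
    obtain ⟨-, q₀, q₁, q₂⟩ := hψ ι
    rw [norm_pow, map_mul, map_mul, norm_mul, norm_mul, show 3 * (N * B) = N * (B + B + B) by ring,
      Real.exp_nat_mul, Real.exp_add, Real.exp_add]
    gcongr
  have hfr : 0 < Module.finrank ℚ F := Module.finrank_pos
  have hexp : Real.exp (w + 3 * (N * B)) ^ (Module.finrank ℚ F - 1) * Real.exp (3 * (N * B)) ≤
      Real.exp (X * (w + X * N)) := by
    rw [← Real.exp_nat_mul, ← Real.exp_add, Real.exp_le_exp]
    have hd : ((Module.finrank ℚ F - 1 : ℕ) : ℝ) + 1 ≤ X := by exact_mod_cast (by omega)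
    have hN : 3 * (N * B) ≤ X * N := by nlinarith [(Nat.cast_nonneg N : (0 : ℝ) ≤ N)]
    have hNB : 0 ≤ 3 * (N * B) := by positivity
    calc _ ≤ (((Module.finrank ℚ F - 1 : ℕ) : ℝ) + 1) * (w + 3 * (N * B)) := by linarith
      _ ≤ X * (w + X * N) := by gcongr
  have hmain := (one_le_norm_norm_of_isIntegral hβint hβ0).trans
    (NumberField.norm_norm_le_norm_mul_house_pow β ι)
  rw [hβι, norm_mul] at hmain
  have h1 : 1 ≤ ‖σ‖ * Real.exp (X * (w + X * N)) := by
    refine hmain.trans ?_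
    rw [mul_assoc]
    gcongr
    refine le_trans ?_ hexp
    rw [mul_comm]
    have := NumberField.house_nonneg β
    gcongr
  rw [Real.exp_neg, inv_le_iff_one_le_mul₀ (Real.exp_pos _)]
  exact h1

end Liouville

end LinearForms

section Units

open NumberField NumberField.InfinitePlace NumberField.mixedEmbedding
open scoped NNReal nonZeroDivisors

theorem minkowskiBound_one_lt (K : Type*) [Field K] [NumberField K] {B : ℝ≥0}
    (hB : Real.sqrt |(discr K : ℝ)| < B) : minkowskiBound K 1 < convexBodyLTFactor K * B := by
  have h2 : ((2:ENNReal)) ^ nrComplexPlaces K ≠ 0 := by simp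
  have h2' : ((2:ENNReal)) ^ nrComplexPlaces K ≠ ⊤ := by simp
  rw [minkowskiBound, volume_fundamentalDomain_fractionalIdealLatticeBasis,
    volume_fundamentalDomain_latticeBasis, mixedEmbedding.finrank, ← card_add_two_mul_card_eq_rank,
    Units.val_one, FractionalIdeal.absNorm_one, Rat.cast_one, ENNReal.ofReal_one, one_mul]
  have hB' : NNReal.sqrt ‖discr K‖₊ < B := by
    rw [← NNReal.coe_lt_coe]
    simpa [Int.norm_eq_abs] using hB
  calc _ = (2:ENNReal) ^ nrRealPlaces K * 2 ^ nrComplexPlaces K *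
      (NNReal.sqrt ‖discr K‖₊ : ENNReal) := by
        rw [pow_add, pow_mul', sq]
        rw [show ((2:ENNReal)⁻¹ ^ nrComplexPlaces K) = (2 ^ nrComplexPlaces K)⁻¹ from by
            rw [ENNReal.inv_pow]]
        calc _ = (2:ENNReal) ^ nrRealPlaces K * 2 ^ nrComplexPlaces K *
            (NNReal.sqrt ‖discr K‖₊ : ENNReal)
              * ((2 ^ nrComplexPlaces K)⁻¹ * 2 ^ nrComplexPlaces K) := by ring
          _ = _ := by rw [ENNReal.inv_mul_cancel h2 h2', mul_one]
    _ < (2:ENNReal) ^ nrRealPlaces K * 2 ^ nrComplexPlaces K * B := by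
        rw [ENNReal.mul_lt_mul_iff_right (by simp) (by finiteness)]
        exact_mod_cast hB'
    _ ≤ _ := by
        rw [convexBodyLTFactor]
        push_cast
        gcongr
        exact_mod_cast Real.two_le_pi

variable {K : Type*} [Field K] [NumberField K]

theorem exists_integer_lt_away_from_place (w₁ : InfinitePlace K) {B : ℕ}
    (hB : Real.sqrt |(discr K : ℝ)| < B) {ε : ℝ} (hε : 0 < ε) :
    ∃ ξ : 𝓞 K, ξ ≠ 0 ∧ (∀ w : InfinitePlace K, w ≠ w₁ → w ξ < ε ∧ ε ≤ B * w ξ) ∧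
      (Algebra.norm ℤ ξ).natAbs ≤ B := by
  classical
  have hB0 : (0 : ℝ) < B := (Real.sqrt_nonneg _).trans_lt hB
  lift ε to ℝ≥0 using hε.le
  rw [NNReal.coe_pos] at hε
  obtain ⟨g, hg, hgB⟩ := adjust_f K (w₁ := w₁) (f := fun _ => ε) (B : ℝ≥0) (fun w _ => hε.ne')
  have hgB' : ∏ w, (g w : ℝ) ^ mult w = B := by exact_mod_cast congrArg NNReal.toReal hgB
  obtain ⟨ξ, hξ, hlt⟩ := exists_ne_zero_mem_ringOfIntegers_lt (K := K) (f := g) (by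
    rw [convexBodyLT_volume]
    convert! minkowskiBound_one_lt K (B := B) (by simpa using hB))
  have hξ' : (ξ : K) ≠ 0 := by simpa using hξ
  have hprod := prod_eq_abs_norm (ξ : K)
  have hnorm : ((|Algebra.norm ℚ (ξ : K)| : ℚ) : ℝ) = ((Algebra.norm ℤ ξ).natAbs : ℝ) := by
    rw [← Algebra.coe_norm_int, Nat.cast_natAbs]
    push_cast
    rfl
  have hN1 : (1 : ℝ) ≤ ((Algebra.norm ℤ ξ).natAbs : ℝ) := by
    have : (Algebra.norm ℤ ξ).natAbs ≠ 0 := by simpa using hξ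
    exact_mod_cast Nat.one_le_iff_ne_zero.2 this
  rw [hnorm] at hprod
  refine ⟨ξ, hξ, fun w hw => ?_, ?_⟩
  · have hgw : g w = ε := hg w hw
    have hlt' : w ξ < ε := hgw ▸ hlt w
    refine ⟨hlt', ?_⟩
    rw [← Finset.mul_prod_erase _ _ (Finset.mem_univ w)] at hprod hgB'
    have hle : ∏ v ∈ Finset.univ.erase w, v (ξ : K) ^ mult v
        ≤ ∏ v ∈ Finset.univ.erase w, (g v : ℝ) ^ mult v := by
      gcongr with v hv
      exact (hlt v).le
    have hE : (0 : ℝ) < ε := hε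
    have hpos : 0 < w (ξ : K) := pos_iff.2 hξ'
    set P := ∏ v ∈ Finset.univ.erase w, (g v : ℝ) ^ mult v
    have h1 : 1 ≤ w (ξ : K) ^ mult w * P := by
      rw [← hprod] at hN1
      exact hN1.trans (by gcongr)
    have h2 : (ε : ℝ) ^ mult w ≤ B * w (ξ : K) ^ mult w := by
      rw [hgw] at hgB'
      rw [← hgB']
      have : (0 : ℝ) ≤ (ε : ℝ) ^ mult w := by positivity
      nlinarith
    have h3 : w (ξ : K) ^ mult w * ε ≤ ε ^ mult w * w (ξ : K) := by
      obtain ⟨m, hm⟩ : ∃ m, mult w = m + 1 := ⟨mult w - 1, by have := mult_pos (w := w); omega⟩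
      rw [hm, pow_succ, pow_succ]
      have : w (ξ : K) ^ m ≤ (ε : ℝ) ^ m := by gcongr
      have h0 : 0 ≤ w (ξ : K) * ε := by positivity
      nlinarith
    have h4 : (ε : ℝ) ^ mult w * ε ≤ ε ^ mult w * (B * w (ξ : K)) := by
      nlinarith
    exact le_of_mul_le_mul_left h4 (by positivity)
  · have : ((Algebra.norm ℤ ξ).natAbs : ℝ) ≤ B := by
      rw [← hprod, ← hgB']
      gcongr with v hv
      exact (hlt v).le
    exact_mod_cast this

theorem exists_unit_lt_away_from_place (w₁ : InfinitePlace K) {B : ℕ}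
    (hB : Real.sqrt |(discr K : ℝ)| < B) :
    ∃ η : (𝓞 K)ˣ, (∀ w : InfinitePlace K, w ≠ w₁ → w (η : K) ≤ 1 / 2) ∧
      ∀ w : InfinitePlace K, |Real.log (w (η : K))| ≤
        Module.finrank ℚ K * ((((B : ℝ) + 1) ^ (Module.finrank ℚ K + 1) + 1) * Real.log (2 * B)) :=
        by
  classical
  have hB0 : (0 : ℝ) < B := (Real.sqrt_nonneg _).trans_lt hB
  have hB1 : (1 : ℝ) ≤ B := by
    have : 0 < B := by exact_mod_cast hB0
    exact_mod_cast this
  set n := Module.finrank ℚ K with hn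
  set Q : ℕ := (B + 1) ^ (n + 1) with hQ
  have h2B : (0 : ℝ) < 2 * B := by positivity
  choose ξ hξ0 hξ hξN using fun t : ℕ =>
    exists_integer_lt_away_from_place w₁ hB (ε := ((2 * B : ℝ) ^ t)⁻¹) (by positivity)
  let b := RingOfIntegers.basis K
  let N : ℕ → ℕ := fun t => (Algebra.norm ℤ (ξ t)).natAbs
  have hN0 : ∀ t, N t ≠ 0 := fun t => by simpa [N] using hξ0 t
  let S := Finset.range (B + 1) ×ˢ
    Fintype.piFinset (fun _ : Module.Free.ChooseBasisIndex ℤ (𝓞 K) => Finset.Ico (0 : ℤ) B)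
  have hS : S.card < (Finset.range (Q + 1)).card := by
    rw [Finset.card_product, Finset.card_range, Finset.card_range, Fintype.card_piFinset]
    simp only [Int.card_Ico, Finset.prod_const, Finset.card_univ]
    rw [← Module.finrank_eq_card_chooseBasisIndex, RingOfIntegers.rank, ← hn, hQ, pow_succ',
      Nat.lt_succ_iff]
    gcongr
    simp
  obtain ⟨s, hs, t, ht, hst, heq⟩ := Finset.exists_ne_map_eq_of_card_lt_of_maps_to hS
    (f := fun t => (N t, fun i => b.repr (ξ t) i % (N t : ℤ))) (fun t _ => by
      have := hN0 t
      have hNB : N t ≤ B := hξN t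
      simp only [S, Finset.coe_product, Set.mem_prod, Finset.mem_coe, Finset.mem_range,
        Fintype.mem_piFinset, Finset.mem_Ico]
      refine ⟨by omega, fun i => ⟨Int.emod_nonneg _ (by exact_mod_cast this), ?_⟩⟩
      refine (Int.emod_lt_of_pos _ (by positivity)).trans_le (by exact_mod_cast hNB))
  have hdvd : ∀ s t, N s = N t → (∀ i, b.repr (ξ s) i % (N s : ℤ) = b.repr (ξ t) i % (N t : ℤ)) →
      ξ s ∣ ξ t := by
    intro s t h1 h2
    have h3 : ξ s ∣ (N s : 𝓞 K) := by
      have := Ideal.absNorm_mem (Ideal.span {ξ s})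
      rwa [Ideal.absNorm_span_singleton, Ideal.mem_span_singleton] at this
    have h4 : (N s : 𝓞 K) ∣ ξ s - ξ t := by
      rw [← b.sum_repr (ξ s - ξ t)]
      refine Finset.dvd_sum fun i _ => ?_
      have : (N s : ℤ) ∣ b.repr (ξ s - ξ t) i := by
        rw [map_sub, Finsupp.sub_apply]
        refine (Int.ModEq.symm ?_).dvd
        rw [Int.ModEq, h2 i, h1]
      obtain ⟨c, hc⟩ := this
      exact ⟨c • b i, by rw [hc, mul_smul, zsmul_eq_mul]; push_cast; rfl⟩
    have := (dvd_sub_right (dvd_refl (ξ s))).1 (h3.trans h4)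
    exact this
  obtain ⟨s, t, hts, hsQ, heq⟩ : ∃ s t, t < s ∧ s ≤ Q ∧
      (N s, fun i => b.repr (ξ s) i % (N s : ℤ)) = (N t, fun i => b.repr (ξ t) i % (N t : ℤ)) := by
    simp only [Finset.mem_range] at hs ht
    rcases hst.lt_or_gt with h | h
    · exact ⟨t, s, h, by omega, heq.symm⟩
    · exact ⟨s, t, h, by omega, heq⟩
  rw [Prod.mk.injEq, funext_iff] at heq
  obtain ⟨η, hη⟩ := associated_of_dvd_dvd (hdvd t s heq.1.symm fun i => (heq.2 i).symm)
    (hdvd s t heq.1 heq.2)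
  have hw : ∀ w : InfinitePlace K, w (ξ t : K) * w (η : K) = w (ξ s : K) := fun w => by
    rw [← map_mul, ← hη]; rfl
  have hpos : ∀ (w : InfinitePlace K) t, 0 < w (ξ t : K) := fun w t =>
    pos_iff.2 (by simpa using hξ0 t)
  have hηpos : ∀ w : InfinitePlace K, 0 < w (η : K) := fun w => pos_iff.2 (by simp)
  obtain ⟨r, rfl⟩ : ∃ r, s = t + r + 1 := ⟨s - t - 1, by omega⟩
  set E := ((2 * B : ℝ) ^ t)⁻¹ with hE
  have hEpos : 0 < E := by positivity
  have hEs : ((2 * B : ℝ) ^ (t + r + 1))⁻¹ = E * ((2 * B : ℝ) ^ (r + 1))⁻¹ := by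
    rw [hE, ← mul_inv, ← pow_add, add_assoc]
  have hupper : ∀ w : InfinitePlace K, w ≠ w₁ → w (η : K) ≤ 1 / 2 := by
    intro w hw₁
    obtain ⟨ht1, ht2⟩ := hξ t w hw₁
    obtain ⟨hs1, hs2⟩ := hξ (t + r + 1) w hw₁
    rw [← hw w, hEs] at hs1
    have h5 : ((2 * B : ℝ) ^ (r + 1))⁻¹ ≤ (2 * B : ℝ)⁻¹ := by
      gcongr
      exact le_self_pow₀ (by linarith) (by omega)
    have h6 : E * w (η : K) ≤ E * (1 / 2) := calc
      E * w (η : K) ≤ (B * w (ξ t : K)) * w (η : K) := by gcongr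
      _ = B * (w (ξ t : K) * w (η : K)) := by ring
      _ ≤ B * (E * (2 * B : ℝ)⁻¹) :=
        mul_le_mul_of_nonneg_left (hs1.le.trans (by gcongr)) hB0.le
      _ = E * (1 / 2) := by field_simp
    exact le_of_mul_le_mul_left h6 hEpos
  have hlower : ∀ w : InfinitePlace K, w ≠ w₁ →
      -Real.log (w (η : K)) ≤ ((B : ℝ) + 1) ^ (n + 1) * Real.log (2 * B) + Real.log (2 * B) := by
    intro w hw₁
    obtain ⟨ht1, ht2⟩ := hξ t w hw₁
    obtain ⟨hs1, hs2⟩ := hξ (t + r + 1) w hw₁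
    rw [← hw w, hEs] at hs2
    have h6 : E * ((2 * B : ℝ) ^ (r + 1))⁻¹ ≤ E * (B * w (η : K)) := calc
      _ ≤ _ := hs2
      _ ≤ B * (E * w (η : K)) := by gcongr
      _ = _ := by ring
    have h7 := le_of_mul_le_mul_left h6 hEpos
    have h8 : 1 ≤ (2 * B : ℝ) ^ (Q + 1) * w (η : K) := by
      rw [inv_le_iff_one_le_mul₀ (by positivity)] at h7
      calc (1 : ℝ) ≤ B * w (η : K) * (2 * B) ^ (r + 1) := h7
        _ ≤ (2 * B) * w (η : K) * (2 * B) ^ Q := by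
          have := (hηpos w).le
          gcongr
          · linarith
          · linarith
          · omega
        _ = _ := by ring
    have h9 := Real.log_nonneg h8
    rw [Real.log_mul (by positivity) (hηpos w).ne', Real.log_pow, hQ] at h9
    push_cast at h9
    linarith
  have hlog : 0 ≤ Real.log (2 * B) := Real.log_nonneg (by linarith)
  have hn1 : (1 : ℝ) ≤ n := by exact_mod_cast Module.finrank_pos
  refine ⟨η, hupper, fun w => ?_⟩
  set U := (((B : ℝ) + 1) ^ (n + 1) + 1) * Real.log (2 * B) with hU
  have hU0 : 0 ≤ U := by positivity
  have hneg : ∀ w : InfinitePlace K, w ≠ w₁ → Real.log (w (η : K)) ≤ 0 := fun w hw₁ =>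
    Real.log_nonpos (hηpos w).le ((hupper w hw₁).trans (by norm_num))
  have hle : ∀ w : InfinitePlace K, w ≠ w₁ → |Real.log (w (η : K))| ≤ U := fun w hw₁ => by
    rw [abs_of_nonpos (hneg w hw₁)]
    linarith [hlower w hw₁]
  by_cases hw₁ : w = w₁
  · subst hw₁
    have hsum := Units.sum_mult_mul_log η
    rw [← Finset.add_sum_erase _ _ (Finset.mem_univ w)] at hsum
    have hmult : (1 : ℝ) ≤ mult w := by exact_mod_cast mult_pos
    have habs : |Real.log (w (η : K))| ≤ mult w * |Real.log (w (η : K))| :=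
      le_mul_of_one_le_left (abs_nonneg _) hmult
    refine habs.trans ?_
    rw [← abs_of_nonneg (zero_le_one.trans hmult), ← abs_mul, eq_neg_of_add_eq_zero_left hsum,
      abs_neg]
    refine (Finset.abs_sum_le_sum_abs _ _).trans ?_
    calc _ ≤ ∑ v ∈ Finset.univ.erase w, (mult v : ℝ) * U := by
          refine Finset.sum_le_sum fun v hv => ?_
          rw [abs_mul, Nat.abs_cast]
          gcongr
          exact hle v (Finset.ne_of_mem_erase hv)
      _ ≤ ∑ v : InfinitePlace K, (mult v : ℝ) * U :=
          Finset.sum_le_sum_of_subset_of_nonneg (Finset.erase_subset _ _)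
            fun _ _ _ => by positivity
      _ = n * U := by
          rw [← Finset.sum_mul, hn, ← sum_mult_eq]
          push_cast
          rfl
  · exact (hle w hw₁).trans (le_mul_of_one_le_left hU0 hn1)

end Units

section Core

open NumberField

variable {K : Type*} [Field K] [NumberField K]

/-- Three embeddings of a number field factor through a number field of bounded degree. -/
theorem exists_numberField_factorization (σ₁ σ₂ σ₃ : K →+* ℂ) :
    ∃ (L : Type) (_ : Field L) (_ : NumberField L) (ι : L →+* ℂ) (τ₁ τ₂ τ₃ : K →+* L),
      Module.finrank ℚ L ≤ Module.finrank ℚ K ^ 3 ∧ ι.comp τ₁ = σ₁ ∧ ι.comp τ₂ = σ₂ ∧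
        ι.comp τ₃ = σ₃ := by
  let A (σ : K →+* ℂ) : IntermediateField ℚ ℂ := σ.toRatAlgHom.fieldRange
  have hfd (σ : K →+* ℂ) : FiniteDimensional ℚ (A σ) :=
    LinearMap.finiteDimensional_range σ.toRatAlgHom.toLinearMap
  have hfr (σ : K →+* ℂ) : Module.finrank ℚ (A σ) = Module.finrank ℚ K :=
    LinearMap.finrank_range_of_inj (f := σ.toRatAlgHom.toLinearMap) σ.injective
  let E : IntermediateField ℚ ℂ := A σ₁ ⊔ A σ₂ ⊔ A σ₃
  have : FiniteDimensional ℚ E := inferInstance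
  have : NumberField E := ⟨⟩
  have hmem (σ : K →+* ℂ) (h : A σ ≤ E) : ∀ x, σ x ∈ E := fun x => h ⟨x, rfl⟩
  refine ⟨E, inferInstance, inferInstance, E.val.toRingHom,
    σ₁.codRestrict E.toSubring (hmem _ (le_sup_left.trans le_sup_left)),
    σ₂.codRestrict E.toSubring (hmem _ (le_sup_right.trans le_sup_left)),
    σ₃.codRestrict E.toSubring (hmem _ le_sup_right), ?_, rfl, rfl, rfl⟩
  calc Module.finrank ℚ E ≤ Module.finrank ℚ ↥(A σ₁ ⊔ A σ₂) * Module.finrank ℚ (A σ₃) :=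
        IntermediateField.finrank_sup_le _ _
    _ ≤ (Module.finrank ℚ (A σ₁) * Module.finrank ℚ (A σ₂)) * Module.finrank ℚ (A σ₃) := by
        gcongr
        exact IntermediateField.finrank_sup_le _ _
    _ = _ := by rw [hfr, hfr, hfr]; ring

theorem exists_embedding_comp_eq {L : Type*} [Field L] [NumberField L] (τ : K →+* L)
    (σ : K →+* ℂ) : ∃ ψ : L →+* ℂ, ψ.comp τ = σ := by
  let := τ.toAlgebra
  let := σ.toAlgebra
  have : IsScalarTower ℚ K L := IsScalarTower.of_algebraMap_eq' (Subsingleton.elim _ _)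
  have : Algebra.IsAlgebraic K L := Algebra.IsAlgebraic.tower_top (K := ℚ) K
  refine ⟨(IsAlgClosed.lift (R := K) (S := L) (M := ℂ)).toRingHom, ?_⟩
  ext x
  exact (IsAlgClosed.lift (R := K) (S := L) (M := ℂ)).commutes x

theorem exp_neg_le_norm_log_of_cubic (hK : Module.finrank ℚ K = 3) {σ₁ σ₂ σ₃ : K →+* ℂ}
    (h₂₃ : σ₂ ≠ σ₃) (hσ : ∀ φ : K →+* ℂ, φ = σ₁ ∨ φ = σ₂ ∨ φ = σ₃)
    {γ η₁ η₂ β : K} (hγ : IsIntegral ℤ γ) (hη₁ : IsIntegral ℤ η₁) (hη₂ : IsIntegral ℤ η₂)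
    (hγ0 : γ ≠ 0) (hη₁0 : η₁ ≠ 0) (hη₂0 : η₂ ≠ 0) {b₁ b₂ : ℤ}
    (hβ : β = γ * η₁ ^ (-b₁) * η₂ ^ (-b₂)) {G : ℝ} (hG : 0 ≤ G)
    (hbd : ∀ φ : K →+* ℂ, ‖φ γ‖ ≤ Real.exp G ∧ ‖φ η₁‖ ≤ Real.exp G ∧ ‖φ η₂‖ ≤ Real.exp G)
    {X : ℕ} (hX : 10 ^ 32 ≤ X) (hGX : 6 * G ≤ X) {ℓ₀ ℓ₁ ℓ₂ : ℂ}
    (h₀ : ‖ℓ₀‖ ≤ X) (h₁ : ‖ℓ₁‖ ≤ X) (h₂ : ‖ℓ₂‖ ≤ X)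
    (he₀ : Complex.exp ℓ₀ = (σ₂ γ / σ₃ γ) ^ 2) (he₁ : Complex.exp ℓ₁ = (σ₂ η₁ / σ₃ η₁) ^ 2)
    (he₂ : Complex.exp ℓ₂ = (σ₂ η₂ / σ₃ η₂) ^ 2)
    (hb₁ : |(b₁ : ℝ)| ≤ Real.exp X) (hb₂ : |(b₂ : ℝ)| ≤ Real.exp X)
    (hlt₂ : ‖σ₁ β‖ < ‖σ₂ β‖) (hlt₃ : ‖σ₁ β‖ < ‖σ₃ β‖) :
    Real.exp (-(X : ℝ) ^ 211) ≤ ‖ℓ₀ - b₁ * ℓ₁ - b₂ * ℓ₂‖ := by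
  obtain ⟨L, _, _, ι, τ₁, τ₂, τ₃, hfin, hτ₁, hτ₂, hτ₃⟩ := exists_numberField_factorization σ₁ σ₂ σ₃
  have hτ₂' : ∀ x, ι (τ₂ x) = σ₂ x := fun x => by rw [← hτ₂]; rfl
  have hτ₃' : ∀ x, ι (τ₃ x) = σ₃ x := fun x => by rw [← hτ₃]; rfl
  have hne : ∀ {x : K} (τ : K →+* L), x ≠ 0 → τ x ^ 2 ≠ 0 := fun τ hx =>
    pow_ne_zero _ ((map_ne_zero τ).2 hx)
  have hint : ∀ {x : K} (τ : K →+* L), IsIntegral ℤ x → IsIntegral ℤ (τ x ^ 2) := fun τ hx =>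
    (hx.map τ.toIntAlgHom).pow 2
  have hsq : ∀ {z : ℂ}, ‖z‖ ≤ Real.exp G → ‖z ^ 2‖ ≤ Real.exp (2 * G) := fun hz => by
    rw [norm_pow, two_mul, Real.exp_add, ← sq]
    gcongr
  have hα : ∀ {x : K} {ℓ : ℂ}, Complex.exp ℓ = (σ₂ x / σ₃ x) ^ 2 →
      Complex.exp ℓ = ι (τ₂ x ^ 2 / τ₃ x ^ 2) := fun h => by
    rw [h, map_div₀, map_pow, map_pow, hτ₂', hτ₃', div_pow]
  have hL : LiouvilleBound (Complex.exp ℓ₀) (Complex.exp ℓ₁) (Complex.exp ℓ₂) X := by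
    rw [hα he₀, hα he₁, hα he₂]
    refine liouvilleBound_of_numberField ι (hint _ hγ) (hint _ hη₁) (hint _ hη₂) (hint _ hγ)
      (hint _ hη₁) (hint _ hη₂) (hne _ hγ0) (hne _ hη₁0) (hne _ hη₂0) (B := 2 * G)
      (by positivity) (fun ψ => ?_) (hfin.trans ?_) (by linarith)
    · have hb : ∀ (τ : K →+* L) {x : K}, (∀ φ : K →+* ℂ, ‖φ x‖ ≤ Real.exp G) →
          ‖ψ (τ x ^ 2)‖ ≤ Real.exp (2 * G) := fun τ x hx => by
        rw [map_pow]
        exact hsq (hx (ψ.comp τ))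
      exact ⟨⟨hb _ fun φ => (hbd φ).1, hb _ fun φ => (hbd φ).2.1, hb _ fun φ => (hbd φ).2.2⟩,
        hb _ fun φ => (hbd φ).1, hb _ fun φ => (hbd φ).2.1, hb _ fun φ => (hbd φ).2.2⟩
    · rw [hK]
      exact le_trans (by norm_num) hX
  obtain ⟨ψ, hψ⟩ := exists_embedding_comp_eq τ₃ σ₁
  have hψ₂ : ψ.comp τ₂ ≠ σ₁ := by
    intro h
    apply h₂₃
    rw [← hψ] at h
    have : τ₂ = τ₃ := RingHom.ext fun x => ψ.injective (RingHom.congr_fun h x)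
    rw [← hτ₂, ← hτ₃, this]
  obtain ⟨σ, hσψ, hσlt⟩ : ∃ σ : K →+* ℂ, ψ.comp τ₂ = σ ∧ ‖σ₁ β‖ < ‖σ β‖ := by
    rcases hσ (ψ.comp τ₂) with h | h | h
    · exact absurd h hψ₂
    · exact ⟨_, h, hlt₂⟩
    · exact ⟨_, h, hlt₃⟩
  have hψ' : ∀ x, ψ (τ₃ x) = σ₁ x := fun x => by rw [← hψ]; rfl
  have hσ' : ∀ x, ψ (τ₂ x) = σ x := fun x => by rw [← hσψ]; rfl
  let c : K → ℝ := fun x => Real.log ‖ψ (τ₂ x ^ 2 / τ₃ x ^ 2)‖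
  have hcx : ∀ x, x ≠ 0 → c x = 2 * (Real.log ‖σ x‖ - Real.log ‖σ₁ x‖) := fun x hx => by
    simp only [c]
    rw [map_div₀, map_pow, map_pow, hψ', hσ', norm_div, norm_pow, norm_pow, Real.log_div,
      Real.log_pow, Real.log_pow]
    · push_cast; ring
    · simpa using hx
    · simpa using hx
  have hlog : ∀ φ : K →+* ℂ, Real.log ‖φ β‖ =
      Real.log ‖φ γ‖ - b₁ * Real.log ‖φ η₁‖ - b₂ * Real.log ‖φ η₂‖ := fun φ => by
    have h0 : ∀ {x : K}, x ≠ 0 → ‖φ x‖ ≠ 0 := fun hx => by simpa using hx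
    rw [hβ, map_mul, map_mul, map_zpow₀, map_zpow₀, norm_mul, norm_mul, norm_zpow, norm_zpow,
      Real.log_mul (mul_ne_zero (h0 hγ0) (zpow_ne_zero _ (h0 hη₁0))) (zpow_ne_zero _ (h0 hη₂0)),
      Real.log_mul (h0 hγ0) (zpow_ne_zero _ (h0 hη₁0)), Real.log_zpow, Real.log_zpow]
    push_cast
    ring
  have hβ0 : β ≠ 0 := by
    rw [hβ]
    exact mul_ne_zero (mul_ne_zero hγ0 (zpow_ne_zero _ hη₁0)) (zpow_ne_zero _ hη₂0)
  refine exp_neg_le_norm_logForm hX h₀ h₁ h₂ hL hb₁ hb₂ (c₀ := c γ) (c₁ := c η₁) (c₂ := c η₂)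
    (fun v w hvw => ?_) ?_
  · have hform : ∀ u : ℕ × ℕ × ℕ, Complex.exp (logForm ℓ₀ ℓ₁ ℓ₂ u) =
        ι ((τ₂ γ ^ 2 / τ₃ γ ^ 2) ^ u.1 * (τ₂ η₁ ^ 2 / τ₃ η₁ ^ 2) ^ u.2.1 *
          (τ₂ η₂ ^ 2 / τ₃ η₂ ^ 2) ^ u.2.2) := fun u => by
      rw [logForm, Complex.exp_add, Complex.exp_add, Complex.exp_nat_mul, Complex.exp_nat_mul,
        Complex.exp_nat_mul, hα he₀, hα he₁, hα he₂, map_mul, map_mul, map_pow, map_pow, map_pow]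
    have hcu : ∀ u : ℕ × ℕ × ℕ, c γ * u.1 + c η₁ * u.2.1 + c η₂ * u.2.2 =
        Real.log ‖ψ ((τ₂ γ ^ 2 / τ₃ γ ^ 2) ^ u.1 * (τ₂ η₁ ^ 2 / τ₃ η₁ ^ 2) ^ u.2.1 *
          (τ₂ η₂ ^ 2 / τ₃ η₂ ^ 2) ^ u.2.2)‖ := fun u => by
      have h0 : ∀ {x : K} (n : ℕ), x ≠ 0 → ‖ψ (τ₂ x ^ 2 / τ₃ x ^ 2)‖ ^ n ≠ 0 := fun n hx =>
        pow_ne_zero _ (norm_ne_zero_iff.2 ((map_ne_zero ψ).2 (div_ne_zero (hne _ hx) (hne _ hx))))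
      rw [map_mul, map_mul, map_pow, map_pow, map_pow, norm_mul, norm_mul, norm_pow, norm_pow,
        norm_pow, Real.log_mul (mul_ne_zero (h0 _ hγ0) (h0 _ hη₁0)) (h0 _ hη₂0),
        Real.log_mul (h0 _ hγ0) (h0 _ hη₁0), Real.log_pow, Real.log_pow, Real.log_pow]
      ring
    rw [hform, hform] at hvw
    rw [hcu, hcu, ι.injective hvw]
  · rw [hcx _ hγ0, hcx _ hη₁0, hcx _ hη₂0]
    have h1 := hlog σ
    have h2 := hlog σ₁
    have h3 : Real.log ‖σ₁ β‖ < Real.log ‖σ β‖ :=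
      Real.log_lt_log (by simpa using hβ0) hσlt
    intro h
    linarith

end Core

section Decomposition

open NumberField

theorem exists_int_approx {p₂ p₃ q₂ q₃ r₂ r₃ U R : ℝ} (hp₂ : p₂ ≤ -(2 / 3)) (hp₃ : p₃ ≤ -(2 / 3))
    (hq₂ : 4 / 3 ≤ q₂) (hq₃ : q₃ ≤ -(2 / 3)) (hp₂U : |p₂| ≤ U) (hp₃U : |p₃| ≤ U) (hq₂U : |q₂| ≤ U)
    (hq₃U : |q₃| ≤ U) (hr₂ : |r₂| ≤ R) (hr₃ : |r₃| ≤ R) :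
    ∃ a b : ℤ, |r₂ + a * p₂ + b * q₂| ≤ 2 * U ∧ |r₃ + a * p₃ + b * q₃| ≤ 2 * U ∧
      |(a : ℝ)| ≤ 2 * R * U + 1 ∧ |(b : ℝ)| ≤ 2 * R * U + 1 := by
  have hdet : 1 ≤ p₂ * q₃ - p₃ * q₂ := by nlinarith
  set d := p₂ * q₃ - p₃ * q₂ with hd
  have hd0 : d ≠ 0 := by positivity
  have hU : 0 ≤ U := (abs_nonneg _).trans hp₂U
  have hR : 0 ≤ R := (abs_nonneg _).trans hr₂
  have hcoef : ∀ {p q : ℝ}, |p| ≤ U → |q| ≤ U → |(r₂ * q - r₃ * p) / d| ≤ 2 * R * U := by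
    intro p q hp hq
    rw [abs_div, abs_of_pos (by linarith : 0 < d)]
    refine (div_le_self (abs_nonneg _) hdet).trans ((abs_sub _ _).trans ?_)
    rw [abs_mul, abs_mul]
    have h1 : |r₂| * |q| ≤ R * U := by gcongr
    have h2 : |r₃| * |p| ≤ R * U := by gcongr
    linarith
  have hfloor : ∀ t : ℝ, |(⌊t⌋ : ℝ) - t| ≤ 1 := fun t => by
    rw [abs_le]
    constructor <;> linarith [Int.floor_le t, Int.lt_floor_add_one t]
  have hfl : ∀ {t : ℝ}, |t| ≤ 2 * R * U → |(⌊t⌋ : ℝ)| ≤ 2 * R * U + 1 := fun {t} ht => by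
    have := abs_add_le ((⌊t⌋ : ℝ) - t) t
    rw [sub_add_cancel] at this
    linarith [hfloor t]
  set s := -((r₂ * q₃ - r₃ * q₂) / d) with hs
  set t := (r₂ * p₃ - r₃ * p₂) / d with ht
  have hclose : ∀ {r p q : ℝ}, |p| ≤ U → |q| ≤ U → r + s * p + t * q = 0 →
      |r + ⌊s⌋ * p + ⌊t⌋ * q| ≤ 2 * U := by
    intro r p q hp hq h0
    have : r + ⌊s⌋ * p + ⌊t⌋ * q = (⌊s⌋ - s) * p + (⌊t⌋ - t) * q := by linear_combination h0
    rw [this]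
    refine (abs_add_le _ _).trans ?_
    rw [abs_mul, abs_mul]
    have h1 : |(⌊s⌋ : ℝ) - s| * |p| ≤ 1 * U := by gcongr; exact hfloor s
    have h2 : |(⌊t⌋ : ℝ) - t| * |q| ≤ 1 * U := by gcongr; exact hfloor t
    linarith
  refine ⟨⌊s⌋, ⌊t⌋, hclose hp₂U hq₂U ?_, hclose hp₃U hq₃U ?_, hfl ?_, hfl (hcoef hp₂U hp₃U)⟩
  · rw [hs, ht]
    field_simp
    rw [hd]
    ring
  · rw [hs, ht]
    field_simp
    rw [hd]
    ring
  · rw [hs, abs_neg]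
    exact hcoef hq₂U hq₃U

theorem abs_log_le_two_mul {t r : ℝ} (h : |t - 1| ≤ r) (hr : r ≤ 1 / 2) : |Real.log t| ≤ 2 * r := by
  obtain ⟨h1, h2⟩ := abs_le.1 h
  have ht : 0 < t := by linarith
  have h3 := Real.log_le_sub_one_of_pos ht
  have h4 := Real.one_sub_inv_le_log_of_pos ht
  have h5 : t⁻¹ ≤ 2 := by
    rw [inv_le_comm₀ ht (by norm_num)]
    linarith
  have h6 : 1 - t⁻¹ = (t - 1) * t⁻¹ := by field_simp
  have h7 : 0 < t⁻¹ := by positivity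
  rw [abs_le]
  constructor
  · nlinarith
  · nlinarith

variable {K : Type*} [Field K] [NumberField K]

theorem norm_mul_norm_mul_norm {σ₁ σ₂ σ₃ : K →+* ℂ} (h₁₂ : σ₁ ≠ σ₂) (h₁₃ : σ₁ ≠ σ₃) (h₂₃ : σ₂ ≠ σ₃)
    (hσ : ∀ φ : K →+* ℂ, φ = σ₁ ∨ φ = σ₂ ∨ φ = σ₃) (x : K) :
    ‖σ₁ x‖ * ‖σ₂ x‖ * ‖σ₃ x‖ = ((|Algebra.norm ℚ x| : ℚ) : ℝ) := by
  classical
  have h := congrArg (‖·‖) (Algebra.norm_eq_prod_embeddings ℚ ℂ x)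
  rw [norm_prod, ← Fintype.prod_equiv (RingHom.equivRatAlgHom K ℂ) (fun f => ‖f x‖)
      (fun φ => ‖φ x‖) fun _ => by simp [RingHom.equivRatAlgHom_apply],
    show (Finset.univ : Finset (K →+* ℂ)) = {σ₁, σ₂, σ₃} from by ext φ; simpa using hσ φ,
    Finset.prod_insert (by simp [h₁₂, h₁₃]), Finset.prod_pair h₂₃] at h
  rw [mul_assoc, ← h, eq_ratCast, Rat.cast_abs, ← Real.norm_eq_abs, ← Complex.norm_real,
    Complex.ofReal_ratCast]

theorem log_norm_add_log_norm_add_log_norm {σ₁ σ₂ σ₃ : K →+* ℂ} (h₁₂ : σ₁ ≠ σ₂) (h₁₃ : σ₁ ≠ σ₃)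
    (h₂₃ : σ₂ ≠ σ₃) (hσ : ∀ φ : K →+* ℂ, φ = σ₁ ∨ φ = σ₂ ∨ φ = σ₃) {x : K} (hx : x ≠ 0) :
    Real.log ‖σ₁ x‖ + Real.log ‖σ₂ x‖ + Real.log ‖σ₃ x‖ =
      Real.log ((|Algebra.norm ℚ x| : ℚ) : ℝ) := by
  have h0 : ∀ φ : K →+* ℂ, ‖φ x‖ ≠ 0 := fun φ => by simpa using hx
  rw [← norm_mul_norm_mul_norm h₁₂ h₁₃ h₂₃ hσ, Real.log_mul (mul_ne_zero (h0 _) (h0 _)) (h0 _),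
    Real.log_mul (h0 _) (h0 _)]

theorem exp_neg_le_norm_log_of_units (hK : Module.finrank ℚ K = 3) {σ₁ σ₂ σ₃ : K →+* ℂ}
    (h₂₃ : σ₂ ≠ σ₃) (hσ : ∀ φ : K →+* ℂ, φ = σ₁ ∨ φ = σ₂ ∨ φ = σ₃)
    {β γ : K} (hβ : IsIntegral ℤ β) (hβ0 : β ≠ 0) {η₁ η₂ : (𝓞 K)ˣ} {b₁ b₂ : ℤ}
    (hγ : γ = β * (η₁ : K) ^ b₁ * (η₂ : K) ^ b₂) {G : ℝ} (hG : 0 ≤ G)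
    (hγG : ∀ φ : K →+* ℂ, Real.log ‖φ γ‖ ≤ G)
    (hη₁G : ∀ φ : K →+* ℂ, |Real.log ‖φ η₁‖| ≤ G) (hη₂G : ∀ φ : K →+* ℂ, |Real.log ‖φ η₂‖| ≤ G)
    {X : ℕ} (hX : 10 ^ 32 ≤ X) (hGX : 6 * G ≤ X) {ℓ₀ ℓ₁ ℓ₂ : ℂ}
    (h₀ : ‖ℓ₀‖ ≤ X) (h₁ : ‖ℓ₁‖ ≤ X) (h₂ : ‖ℓ₂‖ ≤ X)
    (he₀ : Complex.exp ℓ₀ = (σ₂ γ / σ₃ γ) ^ 2) (he₁ : Complex.exp ℓ₁ = (σ₂ η₁ / σ₃ η₁) ^ 2)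
    (he₂ : Complex.exp ℓ₂ = (σ₂ η₂ / σ₃ η₂) ^ 2)
    (hb₁ : |(b₁ : ℝ)| ≤ Real.exp X) (hb₂ : |(b₂ : ℝ)| ≤ Real.exp X)
    (hlt₂ : ‖σ₁ β‖ < ‖σ₂ β‖) (hlt₃ : ‖σ₁ β‖ < ‖σ₃ β‖) :
    Real.exp (-(X : ℝ) ^ 211) ≤ ‖ℓ₀ - b₁ * ℓ₁ - b₂ * ℓ₂‖ := by
  have hη0 : ∀ η : (𝓞 K)ˣ, (η : K) ≠ 0 := fun η => by simp
  have hγ0 : γ ≠ 0 := by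
    rw [hγ]
    exact mul_ne_zero (mul_ne_zero hβ0 (zpow_ne_zero _ (hη0 _))) (zpow_ne_zero _ (hη0 _))
  have hexp : ∀ {x : K}, x ≠ 0 → ∀ φ : K →+* ℂ, Real.log ‖φ x‖ ≤ G → ‖φ x‖ ≤ Real.exp G :=
    fun hx φ h => (Real.log_le_iff_le_exp (norm_pos_iff.2 ((map_ne_zero φ).2 hx))).1 h
  have hint : IsIntegral ℤ γ := by
    rw [hγ, mul_assoc, ← Units.coe_zpow, ← Units.coe_zpow]
    exact hβ.mul (IsIntegral.mul (RingOfIntegers.isIntegral_coe _)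
        (RingOfIntegers.isIntegral_coe _))
  refine exp_neg_le_norm_log_of_cubic hK h₂₃ hσ hint (RingOfIntegers.isIntegral_coe _)
    (RingOfIntegers.isIntegral_coe _) hγ0 (hη0 η₁) (hη0 η₂) (β := β) ?_ hG
    (fun φ => ⟨hexp hγ0 φ (hγG φ), hexp (hη0 _) φ ((le_abs_self _).trans (hη₁G φ)),
      hexp (hη0 _) φ ((le_abs_self _).trans (hη₂G φ))⟩)
    hX hGX h₀ h₁ h₂ he₀ he₁ he₂ hb₁ hb₂ hlt₂ hlt₃
  rw [hγ, zpow_neg, zpow_neg]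
  have h1 := zpow_ne_zero b₁ (hη0 η₁)
  have h2 := zpow_ne_zero b₂ (hη0 η₂)
  field_simp

end Decomposition

section Cases

open NumberField

variable {K : Type*} [Field K] [NumberField K]

theorem abs_norm_div_norm_sub_one_le {δ₁ δ₂ δ₃ : ℂ} (hδ : δ₁ + δ₂ + δ₃ = 0) (h₃ : δ₃ ≠ 0) :
    |‖δ₂‖ / ‖δ₃‖ - 1| ≤ ‖δ₁‖ / ‖δ₃‖ := by
  have h : 0 < ‖δ₃‖ := norm_pos_iff.2 h₃
  rw [div_sub_one h.ne', abs_div, abs_of_pos h]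
  gcongr
  calc |‖δ₂‖ - ‖δ₃‖| = |‖δ₂‖ - ‖-δ₃‖| := by rw [norm_neg]
    _ ≤ ‖δ₂ - -δ₃‖ := abs_norm_sub_norm_le _ _
    _ = ‖δ₁‖ := by rw [sub_neg_eq_add, show δ₂ + δ₃ = -δ₁ by linear_combination hδ, norm_neg]

theorem norm_log_pow_four_le {u : ℂ} {r : ℝ} (hu : ‖u - 1‖ ≤ r) (hr : r ≤ 1 / 30) :
    ‖Complex.log (u ^ 4)‖ ≤ 30 * r := by
  have h0 : 0 ≤ r := (norm_nonneg _).trans hu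
  have hu1 : ‖u‖ ≤ 1 + r := by
    calc ‖u‖ = ‖1 + (u - 1)‖ := by ring_nf
      _ ≤ ‖(1 : ℂ)‖ + ‖u - 1‖ := norm_add_le _ _
      _ ≤ 1 + r := by rw [norm_one]; gcongr
  have hz : ‖u ^ 4 - 1‖ ≤ 15 * r := by
    have h1 : ‖u ^ 3 + u ^ 2 + u + 1‖ ≤ 15 := by
      refine (norm_add_le _ _).trans ?_
      have h3 : ‖u‖ ≤ 2 := by linarith
      have h4 : ‖u ^ 3 + u ^ 2 + u‖ ≤ 2 ^ 3 + 2 ^ 2 + 2 := by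
        refine (norm_add₃_le).trans ?_
        rw [norm_pow, norm_pow]
        gcongr
      rw [norm_one]
      linarith
    calc ‖u ^ 4 - 1‖ = ‖u ^ 3 + u ^ 2 + u + 1‖ * ‖u - 1‖ := by rw [← norm_mul]; ring_nf
      _ ≤ 15 * r := by gcongr
  have h2 := Complex.norm_log_one_add_half_le_self (z := u ^ 4 - 1) (by linarith)
  rw [add_sub_cancel] at h2
  linarith

theorem exp_neg_le_of_forall_isReal (hK : Module.finrank ℚ K = 3) {σ₁ σ₂ σ₃ : K →+* ℂ}
    (h₁₂ : σ₁ ≠ σ₂) (h₁₃ : σ₁ ≠ σ₃) (h₂₃ : σ₂ ≠ σ₃)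
    (hσ : ∀ φ : K →+* ℂ, φ = σ₁ ∨ φ = σ₂ ∨ φ = σ₃)
    (hreal : ∀ φ : K →+* ℂ, ComplexEmbedding.IsReal φ) {U : ℝ}
    (hunit : ∀ w₁ : InfinitePlace K, ∃ η : (𝓞 K)ˣ,
    (∀ w : InfinitePlace K, w ≠ w₁ → w (η : K) ≤ 1 / 2) ∧
      ∀ w : InfinitePlace K, |Real.log (w (η : K))| ≤ U)
    {β : K} (hβ : IsIntegral ℤ β) (hβ0 : β ≠ 0) {δ₁ δ₂ δ₃ : ℂ} (hδ : δ₁ + δ₂ + δ₃ = 0)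
    (hδ₁ : δ₁ ^ 2 = σ₁ β) (hδ₂ : δ₂ ^ 2 = σ₂ β) (hδ₃ : δ₃ ^ 2 = σ₃ β)
    (hlt₂ : ‖δ₁‖ < ‖δ₂‖) (hlt₃ : ‖δ₁‖ < ‖δ₃‖) (hsmall : ‖δ₁‖ / ‖δ₃‖ ≤ 1 / 30)
    {H R : ℝ} (hH0 : 0 ≤ H) (hH : Real.log ((|Algebra.norm ℚ β| : ℚ) : ℝ) ≤ H)
    (hR : ∀ φ : K →+* ℂ, |Real.log ‖φ β‖| ≤ R)
    {X : ℕ} (hX : 10 ^ 32 ≤ X) (hGX : 6 * (H + 4 * U) ≤ X)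
    (hRX : 2 * R * U + 3 * R + 3 ≤ Real.exp X) :
    Real.exp (-(X : ℝ) ^ 211) ≤ 30 * (‖δ₁‖ / ‖δ₃‖) := by
  obtain ⟨η₁, hη₁, hη₁U⟩ := hunit (InfinitePlace.mk σ₁)
  obtain ⟨η₂, hη₂, hη₂U⟩ := hunit (InfinitePlace.mk σ₂)
  have hmk : ∀ {φ ψ : K →+* ℂ}, φ ≠ ψ → InfinitePlace.mk φ ≠ InfinitePlace.mk ψ := by
    intro φ ψ h
    rw [Ne, InfinitePlace.mk_eq_iff, ComplexEmbedding.isReal_iff.1 (hreal φ), or_self]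
    exact h
  have hη0 : ∀ η : (𝓞 K)ˣ, (η : K) ≠ 0 := fun η => by simp
  have hpos : ∀ {x : K}, x ≠ 0 → ∀ φ : K →+* ℂ, 0 < ‖φ x‖ := fun hx φ =>
    norm_pos_iff.2 ((map_ne_zero φ).2 hx)
  have hhalf : ∀ {η : (𝓞 K)ˣ} {φ : K →+* ℂ}, ‖φ η‖ ≤ 1 / 2 → Real.log ‖φ η‖ ≤ -(2 / 3) := by
    intro η φ h
    have h1 := Real.log_le_log (hpos (hη0 η) φ) h
    rw [one_div, Real.log_inv] at h1
    linarith [Real.log_two_gt_d9]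
  have hη₁' : ∀ φ : K →+* ℂ, |Real.log ‖φ η₁‖| ≤ U := fun φ => hη₁U (InfinitePlace.mk φ)
  have hη₂' : ∀ φ : K →+* ℂ, |Real.log ‖φ η₂‖| ≤ U := fun φ => hη₂U (InfinitePlace.mk φ)
  have hsum : ∀ η : (𝓞 K)ˣ, Real.log ‖σ₁ η‖ + Real.log ‖σ₂ η‖ + Real.log ‖σ₃ η‖ = 0 := fun η => by
    rw [log_norm_add_log_norm_add_log_norm h₁₂ h₁₃ h₂₃ hσ (hη0 η), Units.norm]
    simp
  have hsumβ := log_norm_add_log_norm_add_log_norm h₁₂ h₁₃ h₂₃ hσ hβ0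
  have hp₂ : Real.log ‖σ₂ η₁‖ ≤ -(2 / 3) := hhalf (hη₁ (InfinitePlace.mk σ₂) (hmk h₁₂.symm))
  have hp₃ : Real.log ‖σ₃ η₁‖ ≤ -(2 / 3) := hhalf (hη₁ (InfinitePlace.mk σ₃) (hmk h₁₃.symm))
  have hq₁ : Real.log ‖σ₁ η₂‖ ≤ -(2 / 3) := hhalf (hη₂ (InfinitePlace.mk σ₁) (hmk h₁₂))
  have hq₃ : Real.log ‖σ₃ η₂‖ ≤ -(2 / 3) := hhalf (hη₂ (InfinitePlace.mk σ₃) (hmk h₂₃.symm))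
  have hU0 : 0 ≤ U := (abs_nonneg _).trans (hη₁' σ₁)
  have hR0 : 0 ≤ R := (abs_nonneg _).trans (hR σ₁)
  have hq₂ : 4 / 3 ≤ Real.log ‖σ₂ η₂‖ := by linarith [hsum η₂]
  obtain ⟨a, b, h2, h3, ha, hb⟩ := exists_int_approx hp₂ hp₃ hq₂ hq₃ (hη₁' _)
    (hη₁' _) (hη₂' _) (hη₂' _) (hR σ₂) (hR σ₃)
  have hG : 0 ≤ H + 4 * U := by positivity
  set γ : K := β * (η₁ : K) ^ a * (η₂ : K) ^ b with hγ
  have hγ0 : γ ≠ 0 :=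
    mul_ne_zero (mul_ne_zero hβ0 (zpow_ne_zero _ (hη0 _))) (zpow_ne_zero _ (hη0 _))
  have hlogγ : ∀ φ : K →+* ℂ, Real.log ‖φ γ‖ =
      Real.log ‖φ β‖ + a * Real.log ‖φ η₁‖ + b * Real.log ‖φ η₂‖ := fun φ => by
    have h0 : ∀ {x : K}, x ≠ 0 → ‖φ x‖ ≠ 0 := fun hx => (hpos hx φ).ne'
    rw [hγ, map_mul, map_mul, map_zpow₀, map_zpow₀, norm_mul, norm_mul, norm_zpow, norm_zpow,
      Real.log_mul (mul_ne_zero (h0 hβ0) (zpow_ne_zero _ (h0 (hη0 _))))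
      (zpow_ne_zero _ (h0 (hη0 _))),
      Real.log_mul (h0 hβ0) (zpow_ne_zero _ (h0 (hη0 _))), Real.log_zpow, Real.log_zpow]
  rw [← hlogγ] at h2 h3
  have h1 : Real.log ‖σ₁ γ‖ ≤ H + 4 * U := by
    have e1 := hlogγ σ₁
    have e2 := hlogγ σ₂
    have e3 := hlogγ σ₃
    have : Real.log ‖σ₁ γ‖ + Real.log ‖σ₂ γ‖ + Real.log ‖σ₃ γ‖ =
        Real.log ((|Algebra.norm ℚ β| : ℚ) : ℝ) := by
      linear_combination e1 + e2 + e3 + hsumβ + a * hsum η₁ + b * hsum η₂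
    linarith [(abs_le.1 h2).1, (abs_le.1 h3).1]
  have hγG : ∀ φ : K →+* ℂ, Real.log ‖φ γ‖ ≤ H + 4 * U := fun φ => by
    rcases hσ φ with rfl | rfl | rfl
    · exact h1
    · linarith [(abs_le.1 h2).2]
    · linarith [(abs_le.1 h3).2]
  have hrealsq : ∀ {x : K}, x ≠ 0 →
      Complex.exp ((2 * (Real.log ‖σ₂ x‖ - Real.log ‖σ₃ x‖) : ℝ) : ℂ) = (σ₂ x / σ₃ x) ^ 2 := by
    intro x hx
    have hsq : ∀ φ : K →+* ℂ, φ x ^ 2 = ((‖φ x‖ ^ 2 : ℝ) : ℂ) := fun φ => by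
      obtain ⟨r, hr⟩ : ∃ r : ℝ, φ x = r :=
        ⟨(hreal φ).embedding x, ((hreal φ).coe_embedding_apply x).symm⟩
      rw [hr, Complex.norm_real, Real.norm_eq_abs, sq_abs, Complex.ofReal_pow]
    rw [div_pow, hsq, hsq, ← Complex.ofReal_div, ← Complex.ofReal_exp]
    congr 1
    rw [show 2 * (Real.log ‖σ₂ x‖ - Real.log ‖σ₃ x‖) =
      (Real.log ‖σ₂ x‖ + Real.log ‖σ₂ x‖) - (Real.log ‖σ₃ x‖ + Real.log ‖σ₃ x‖) by ring,
      Real.exp_sub, Real.exp_add, Real.exp_add, Real.exp_log (hpos hx _), Real.exp_log (hpos hx _)]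
    ring
  have hnorm : ∀ {s t : ℝ}, |s| ≤ 2 * U → |t| ≤ 2 * U → ‖((2 * (s - t) : ℝ) : ℂ)‖ ≤ X := by
    intro s t hs ht
    rw [Complex.norm_real, Real.norm_eq_abs, abs_mul, abs_two]
    have := abs_sub s t
    linarith
  have hbX : ∀ {c : ℤ}, |(c : ℝ)| ≤ 2 * R * U + 1 → |(c : ℝ)| ≤ Real.exp X := fun h => by linarith
  have hδlog : ∀ {δ : ℂ} {φ : K →+* ℂ}, δ ^ 2 = φ β → ‖φ β‖ = ‖δ‖ ^ 2 := fun h => by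
    rw [← h, norm_pow]
  have hmain := exp_neg_le_norm_log_of_units hK h₂₃ hσ hβ hβ0 hγ hG hγG
    (fun φ => (hη₁' φ).trans (by linarith)) (fun φ => (hη₂' φ).trans (by linarith)) hX hGX
    (hnorm h2 h3) (hnorm ((hη₁' σ₂).trans (by linarith)) ((hη₁' σ₃).trans (by linarith)))
    (hnorm ((hη₂' σ₂).trans (by linarith)) ((hη₂' σ₃).trans (by linarith)))
    (hrealsq hγ0) (hrealsq (hη0 η₁)) (hrealsq (hη0 η₂)) (hbX ha) (hbX hb)
    (by rw [hδlog hδ₁, hδlog hδ₂]; gcongr) (by rw [hδlog hδ₁, hδlog hδ₃]; gcongr)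
  refine hmain.trans ?_
  have hδ₃0 : δ₃ ≠ 0 := norm_pos_iff.1 ((norm_nonneg _).trans_lt hlt₃)
  have hδ₂0 : δ₂ ≠ 0 := norm_pos_iff.1 ((norm_nonneg _).trans_lt hlt₂)
  have hΛ : ((2 * (Real.log ‖σ₂ γ‖ - Real.log ‖σ₃ γ‖) : ℝ) : ℂ) -
      a * ((2 * (Real.log ‖σ₂ η₁‖ - Real.log ‖σ₃ η₁‖) : ℝ) : ℂ) -
      b * ((2 * (Real.log ‖σ₂ η₂‖ - Real.log ‖σ₃ η₂‖) : ℝ) : ℂ) =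
      ((4 * Real.log (‖δ₂‖ / ‖δ₃‖) : ℝ) : ℂ) := by
    have e1 : Real.log ‖σ₂ β‖ = 2 * Real.log ‖δ₂‖ := by rw [hδlog hδ₂, Real.log_pow]; norm_num
    have e2 : Real.log ‖σ₃ β‖ = 2 * Real.log ‖δ₃‖ := by rw [hδlog hδ₃, Real.log_pow]; norm_num
    rw [hlogγ, hlogγ, e1, e2, Real.log_div (norm_ne_zero_iff.2 hδ₂0) (norm_ne_zero_iff.2 hδ₃0)]
    push_cast
    ring
  rw [hΛ, Complex.norm_real, Real.norm_eq_abs, abs_mul]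
  have := abs_log_le_two_mul (abs_norm_div_norm_sub_one_le hδ hδ₃0) (by linarith)
  rw [abs_of_pos (by norm_num : (0 : ℝ) < 4)]
  have h0 : 0 ≤ ‖δ₁‖ / ‖δ₃‖ := by positivity
  linarith

theorem exp_neg_le_of_conjugate (hK : Module.finrank ℚ K = 3) {σ₁ σ₂ σ₃ : K →+* ℂ}
    (h₁₂ : σ₁ ≠ σ₂) (h₁₃ : σ₁ ≠ σ₃) (h₂₃ : σ₂ ≠ σ₃)
    (hσ : ∀ φ : K →+* ℂ, φ = σ₁ ∨ φ = σ₂ ∨ φ = σ₃)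
    (hconj : ∀ x, σ₃ x = starRingEnd ℂ (σ₂ x)) {U : ℝ}
    (hunit : ∀ w₁ : InfinitePlace K, ∃ η : (𝓞 K)ˣ,
    (∀ w : InfinitePlace K, w ≠ w₁ → w (η : K) ≤ 1 / 2) ∧
      ∀ w : InfinitePlace K, |Real.log (w (η : K))| ≤ U)
    {β : K} (hβ : IsIntegral ℤ β) (hβ0 : β ≠ 0) {δ₁ δ₂ δ₃ : ℂ} (hδ : δ₁ + δ₂ + δ₃ = 0)
    (hδ₁ : δ₁ ^ 2 = σ₁ β) (hδ₂ : δ₂ ^ 2 = σ₂ β) (hδ₃ : δ₃ ^ 2 = σ₃ β)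
    (hlt₂ : ‖δ₁‖ < ‖δ₂‖) (hlt₃ : ‖δ₁‖ < ‖δ₃‖) (hsmall : ‖δ₁‖ / ‖δ₃‖ ≤ 1 / 30)
    {H R : ℝ} (hH0 : 0 ≤ H) (hH : Real.log ((|Algebra.norm ℚ β| : ℚ) : ℝ) ≤ H)
    (hR : ∀ φ : K →+* ℂ, |Real.log ‖φ β‖| ≤ R)
    {X : ℕ} (hX : 10 ^ 32 ≤ X) (hGX : 6 * (H + 4 * U) ≤ X)
    (hRX : 2 * R * U + 3 * R + 3 ≤ Real.exp X) :
    Real.exp (-(X : ℝ) ^ 211) ≤ 30 * (‖δ₁‖ / ‖δ₃‖) := by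
  obtain ⟨η, hη, hηU⟩ := hunit (InfinitePlace.mk σ₁)
  have hη0 : (η : K) ≠ 0 := by simp
  have hpos : ∀ {x : K}, x ≠ 0 → ∀ φ : K →+* ℂ, 0 < ‖φ x‖ := fun hx φ =>
    norm_pos_iff.2 ((map_ne_zero φ).2 hx)
  have hnorm : ∀ x, ‖σ₃ x‖ = ‖σ₂ x‖ := fun x => by rw [hconj, Complex.norm_conj]
  have hη' : ∀ φ : K →+* ℂ, |Real.log ‖φ η‖| ≤ U := fun φ => hηU (InfinitePlace.mk φ)
  have hsum : Real.log ‖σ₁ η‖ + Real.log ‖σ₂ η‖ + Real.log ‖σ₃ η‖ = 0 := by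
    rw [log_norm_add_log_norm_add_log_norm h₁₂ h₁₃ h₂₃ hσ hη0, Units.norm]
    simp
  have hsumβ := log_norm_add_log_norm_add_log_norm h₁₂ h₁₃ h₂₃ hσ hβ0
  have hp : Real.log ‖σ₂ η‖ ≤ -(2 / 3) := by
    have hmk : InfinitePlace.mk σ₂ ≠ InfinitePlace.mk σ₁ := by
      rw [Ne, InfinitePlace.mk_eq_iff]
      rintro (h | h)
      · exact h₁₂ h.symm
      · exact h₁₃ (h.symm.trans (RingHom.ext fun x => (hconj x).symm))
    have h1 := Real.log_le_log (hpos hη0 σ₂) (hη _ hmk)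
    rw [one_div, Real.log_inv] at h1
    linarith [Real.log_two_gt_d9]
  have hU0 : 0 ≤ U := (abs_nonneg _).trans (hη' σ₁)
  have hR0 : 0 ≤ R := (abs_nonneg _).trans (hR σ₁)
  have hG : 0 ≤ H + 4 * U := by positivity
  obtain ⟨a, h2, ha⟩ : ∃ a : ℤ, |Real.log ‖σ₂ β‖ + a * Real.log ‖σ₂ η‖| ≤ U ∧
      |(a : ℝ)| ≤ 2 * R + 1 := by
    set p := Real.log ‖σ₂ η‖
    set r := Real.log ‖σ₂ β‖
    have hp0 : p ≠ 0 := by linarith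
    have h1 : |(⌊-r / p⌋ : ℝ) - -r / p| ≤ 1 := by
      rw [abs_le]
      constructor <;> linarith [Int.floor_le (-r / p), Int.lt_floor_add_one (-r / p)]
    have h3 : |-r / p| ≤ 2 * R := by
      have hp1 : 2 / 3 ≤ |p| := by rw [abs_of_neg (by linarith)]; linarith
      rw [abs_div, abs_neg, div_le_iff₀ (by linarith)]
      have := hR σ₂
      nlinarith
    refine ⟨⌊-r / p⌋, ?_, ?_⟩
    · rw [show r + ⌊-r / p⌋ * p = (⌊-r / p⌋ - -r / p) * p by field_simp; ring, abs_mul]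
      exact (mul_le_mul h1 (hη' σ₂) (abs_nonneg _) zero_le_one).trans (one_mul U).le
    · have := abs_add_le ((⌊-r / p⌋ : ℝ) - -r / p) (-r / p)
      rw [sub_add_cancel] at this
      linarith
  set γ : K := β * (η : K) ^ a with hγ
  have hγ0 : γ ≠ 0 := mul_ne_zero hβ0 (zpow_ne_zero _ hη0)
  have hlogγ : ∀ φ : K →+* ℂ, Real.log ‖φ γ‖ = Real.log ‖φ β‖ + a * Real.log ‖φ η‖ := fun φ => by
    have h0 : ∀ {x : K}, x ≠ 0 → ‖φ x‖ ≠ 0 := fun hx => (hpos hx φ).ne'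
    rw [hγ, map_mul, map_zpow₀, norm_mul, norm_zpow, Real.log_mul (h0 hβ0)
      (zpow_ne_zero _ (h0 hη0)), Real.log_zpow]
  rw [← hlogγ] at h2
  have h3 : |Real.log ‖σ₃ γ‖| ≤ U := by rwa [hnorm]
  have h1 : Real.log ‖σ₁ γ‖ ≤ H + 4 * U := by
    have e1 := hlogγ σ₁
    have e2 := hlogγ σ₂
    have e3 := hlogγ σ₃
    have : Real.log ‖σ₁ γ‖ + Real.log ‖σ₂ γ‖ + Real.log ‖σ₃ γ‖ =
        Real.log ((|Algebra.norm ℚ β| : ℚ) : ℝ) := by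
      linear_combination e1 + e2 + e3 + hsumβ + a * hsum
    linarith [(abs_le.1 h2).1, (abs_le.1 h3).1]
  have hγG : ∀ φ : K →+* ℂ, Real.log ‖φ γ‖ ≤ H + 4 * U := fun φ => by
    rcases hσ φ with rfl | rfl | rfl
    · exact h1
    · linarith [(abs_le.1 h2).2]
    · linarith [(abs_le.1 h3).2]
  have hX7 : (7 : ℝ) ≤ X := by
    have : (10 ^ 32 : ℝ) ≤ X := by exact_mod_cast hX
    exact le_trans (by norm_num) this
  have hq0 : ∀ {x : K}, x ≠ 0 → (σ₂ x / σ₃ x) ^ 2 ≠ 0 := fun hx =>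
    pow_ne_zero _ (div_ne_zero ((map_ne_zero _).2 hx) ((map_ne_zero _).2 hx))
  have hlogpi : ∀ {x : K}, x ≠ 0 → ‖Complex.log ((σ₂ x / σ₃ x) ^ 2)‖ ≤ Real.pi := by
    intro x hx
    refine (Complex.norm_le_abs_re_add_abs_im _).trans ?_
    rw [Complex.log_re, Complex.log_im, norm_pow, norm_div, hnorm, div_self (hpos hx _).ne',
      one_pow, Real.log_one, abs_zero, zero_add]
    exact Complex.abs_arg_le_pi _
  have hpi := Real.pi_lt_four
  have hpi3 := Real.pi_gt_three
  have hδ₃0 : δ₃ ≠ 0 := norm_pos_iff.1 ((norm_nonneg _).trans_lt hlt₃)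
  have hu : (-δ₂ / δ₃) ^ 4 = (σ₂ β / σ₃ β) ^ 2 := by
    rw [← hδ₂, ← hδ₃]
    ring
  have hΛ : ‖Complex.log ((σ₂ β / σ₃ β) ^ 2)‖ ≤ 30 * (‖δ₁‖ / ‖δ₃‖) := by
    rw [← hu]
    refine norm_log_pow_four_le (le_of_eq ?_) hsmall
    rw [← norm_div]
    congr 1
    field_simp
    linear_combination -hδ
  have hexp : Complex.exp (Complex.log ((σ₂ β / σ₃ β) ^ 2)) =
      Complex.exp (Complex.log ((σ₂ γ / σ₃ γ) ^ 2) - a * Complex.log ((σ₂ η / σ₃ η) ^ 2)) := by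
    rw [Complex.exp_sub, Complex.exp_int_mul, Complex.exp_log (hq0 hβ0), Complex.exp_log (hq0 hγ0),
      Complex.exp_log (hq0 hη0), hγ, map_mul, map_mul, map_zpow₀, map_zpow₀,
      eq_div_iff (zpow_ne_zero _ (hq0 hη0)), mul_div_mul_comm, mul_pow, ← div_zpow, ← zpow_natCast,
      ← zpow_natCast, ← zpow_natCast, ← zpow_mul, ← zpow_mul, mul_comm a]
  obtain ⟨n, hn⟩ := Complex.exp_eq_exp_iff_exists_int.1 hexp
  have h2pi : ‖(2 * Real.pi * Complex.I : ℂ)‖ = 2 * Real.pi := by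
    simp [abs_of_pos Real.pi_pos]
  have hnb : |((-n : ℤ) : ℝ)| ≤ 3 * R + 3 := by
    have e1 : (n : ℂ) * (2 * Real.pi * Complex.I) = Complex.log ((σ₂ β / σ₃ β) ^ 2) -
        Complex.log ((σ₂ γ / σ₃ γ) ^ 2) + a * Complex.log ((σ₂ η / σ₃ η) ^ 2) := by
      rw [hn]
      ring
    have e2 := congrArg norm e1
    rw [norm_mul, h2pi, Complex.norm_intCast] at e2
    have e3 : ‖(a : ℂ) * Complex.log ((σ₂ η / σ₃ η) ^ 2)‖ ≤ (2 * R + 1) * Real.pi := by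
      rw [norm_mul, Complex.norm_intCast]
      exact mul_le_mul ha (hlogpi hη0) (norm_nonneg _) (by positivity)
    have e4 : |(n : ℝ)| * (2 * Real.pi) ≤ 1 + Real.pi + (2 * R + 1) * Real.pi := by
      rw [e2]
      refine (norm_add_le _ _).trans (add_le_add ((norm_sub_le _ _).trans
        (add_le_add ?_ (hlogpi hγ0))) e3)
      linarith
    rw [Int.cast_neg, abs_neg]
    have e5 : |(n : ℝ)| * (2 * Real.pi) ≤ (3 * R + 3) * (2 * Real.pi) := by nlinarith
    exact le_of_mul_le_mul_right e5 (by positivity)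
  have hRU : 0 ≤ 2 * R * U := by positivity
  have hδlog : ∀ {δ : ℂ} {φ : K →+* ℂ}, δ ^ 2 = φ β → ‖φ β‖ = ‖δ‖ ^ 2 := fun h => by
    rw [← h, norm_pow]
  have hmain := exp_neg_le_norm_log_of_units hK h₂₃ hσ hβ hβ0 (γ := γ) (η₁ := η) (η₂ := 1)
    (b₁ := a) (b₂ := -n) (by simp [hγ]) hG hγG
    (fun φ => (hη' φ).trans (by linarith)) (fun φ => by simpa using hG) hX hGX
    (ℓ₂ := 2 * Real.pi * Complex.I)
    ((hlogpi hγ0).trans (by linarith)) ((hlogpi hη0).trans (by linarith))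
    (by rw [h2pi]; linarith [Real.pi_lt_d2])
    (Complex.exp_log (hq0 hγ0)) (Complex.exp_log (hq0 hη0))
    (by rw [Complex.exp_two_pi_mul_I]; simp) (by linarith) (by linarith)
    (by rw [hδlog hδ₁, hδlog hδ₂]; gcongr) (by rw [hδlog hδ₁, hδlog hδ₃]; gcongr)
  refine hmain.trans (le_trans (le_of_eq ?_) hΛ)
  rw [hn]
  congr 1
  push_cast
  ring

end Cases

section Bound

open NumberField

theorem pow_le_exp_of_large {X : ℝ} (hX : 10 ^ 32 ≤ X) : X ^ 215 ≤ Real.exp X := by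
  have h0 : 0 ≤ X := le_trans (by norm_num) hX
  have h1 : X ≤ (X / 430) ^ 2 := by nlinarith
  calc X ^ 215 ≤ ((X / 430) ^ 2) ^ 215 := by gcongr
    _ = (X / 430) ^ 430 := by rw [← pow_mul]
    _ ≤ Real.exp (X / 430) ^ 430 := by
        gcongr
        linarith [Real.add_one_le_exp (X / 430)]
    _ = Real.exp X := by
        rw [← Real.exp_nat_mul]
        congr 1
        push_cast
        ring

theorem unit_log_bound_le {κ : ℝ} (hκ : 1 ≤ κ) :
    3 * (((109 * κ + 1) ^ (3 + 1) + 1) * Real.log (2 * (109 * κ))) ≤ 10 ^ 11 * κ ^ 5 := by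
  have h1 : Real.log (2 * (109 * κ)) ≤ 218 * κ := by
    linarith [Real.log_le_sub_one_of_pos (show 0 < 2 * (109 * κ) by linarith)]
  have h2 : (109 * κ + 1) ^ (3 + 1) + 1 ≤ 147000000 * κ ^ 4 := by
    have h3 : (109 * κ + 1) ^ (3 + 1) ≤ (110 * κ) ^ (3 + 1) := by gcongr; linarith
    have h4 : 1 ≤ κ ^ 4 := one_le_pow₀ hκ
    rw [mul_pow] at h3
    norm_num at h3 ⊢
    linarith
  have h3 : 0 ≤ Real.log (2 * (109 * κ)) := Real.log_nonneg (by linarith)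
  have h4 : ((109 * κ + 1) ^ (3 + 1) + 1) * Real.log (2 * (109 * κ)) ≤
      (147000000 * κ ^ 4) * (218 * κ) := mul_le_mul h2 h1 h3 (by positivity)
  have h5 : 0 ≤ κ ^ 5 := by positivity
  nlinarith

theorem exists_nat_pow_le_lt {Y : ℝ} {X₀ n : ℕ} (hn : n ≠ 0) (h : (X₀ : ℝ) ^ n ≤ Y) :
    ∃ X : ℕ, X₀ ≤ X ∧ (X : ℝ) ^ n ≤ Y ∧ Y < (X + 1 : ℝ) ^ n := by
  classical
  have hex : ∃ X : ℕ, Y < (X + 1 : ℝ) ^ n := by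
    obtain ⟨X, hX⟩ := exists_nat_gt Y
    refine ⟨X, hX.trans_le ?_⟩
    exact (by linarith : (X : ℝ) ≤ X + 1).trans
        (le_self_pow₀ (by linarith [X.cast_nonneg (α := ℝ)]) hn)
  have hY0 : X₀ ≤ Nat.find hex := by
    by_contra! hlt
    have h1 := Nat.find_spec hex
    have h2 : ((Nat.find hex : ℝ) + 1) ^ n ≤ (X₀ : ℝ) ^ n := by
      gcongr
      exact_mod_cast hlt
    linarith
  refine ⟨Nat.find hex, hY0, ?_, Nat.find_spec hex⟩
  rcases Nat.eq_zero_or_pos (Nat.find hex) with h0 | h0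
  · rw [h0] at hY0 ⊢
    rwa [Nat.le_zero.1 hY0] at h
  · have := Nat.find_min hex (m := Nat.find hex - 1) (by omega)
    rw [Nat.cast_sub h0, Nat.cast_one, sub_add_cancel] at this
    linarith

theorem exists_nat_height {Y : ℝ} {T : ℕ} (hT : 10 ^ 32 ≤ (T : ℝ)) (hTY : (T : ℝ) ^ 211 ≤ Y) :
    ∃ X : ℕ, (T : ℝ) ≤ X ∧ Real.exp (-Y) ≤ Real.exp (-(X : ℝ) ^ 211) ∧
      28 * (Y * X) ≤ Real.exp X := by
  obtain ⟨X, hTX, hXY, hYX⟩ := exists_nat_pow_le_lt (by decide) hTY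
  have hTX' : (T : ℝ) ≤ X := by exact_mod_cast hTX
  have hX32 : (10 : ℝ) ^ 32 ≤ X := hT.trans hTX'
  have hX1 : (X : ℝ) + 1 ≤ 2 * X := by
    clear hTY hXY hYX
    linarith
  refine ⟨X, hTX', Real.exp_le_exp.2 (neg_le_neg hXY), ?_⟩
  have h1 : Y ≤ (2 * X : ℝ) ^ 211 := hYX.le.trans (pow_le_pow_left₀ (by positivity) hX1 _)
  have h4 : (28 : ℝ) * 2 ^ 211 ≤ X ^ 3 := by
    refine le_trans ?_ (pow_le_pow_left₀ (by norm_num) hX32 3)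
    norm_num
  calc 28 * (Y * X) ≤ 28 * ((2 * X : ℝ) ^ 211 * X) := by gcongr
    _ = (28 * 2 ^ 211) * X ^ 212 := by rw [mul_pow, pow_succ (X : ℝ) 211]; simp only [mul_assoc]
    _ ≤ X ^ 3 * X ^ 212 := by gcongr
    _ = X ^ 215 := by rw [← pow_add]
    _ ≤ Real.exp X := pow_le_exp_of_large hX32

variable {K : Type*} [Field K] [NumberField K]

set_option maxHeartbeats 1000000 in
theorem false_of_cubic_of_large (hK : Module.finrank ℚ K = 3) {σ₁ σ₂ σ₃ : K →+* ℂ}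
    (h₁₂ : σ₁ ≠ σ₂) (h₁₃ : σ₁ ≠ σ₃) (h₂₃ : σ₂ ≠ σ₃)
    (hσ : ∀ φ : K →+* ℂ, φ = σ₁ ∨ φ = σ₂ ∨ φ = σ₃) {δ₁ δ₂ δ₃ : ℂ}
    (hcase : ((∀ φ : K →+* ℂ, ComplexEmbedding.IsReal φ) ∧ ‖δ₁‖ ≤ ‖δ₂‖ ∧ ‖δ₁‖ ≤ ‖δ₃‖) ∨
      ∀ x, σ₃ x = starRingEnd ℂ (σ₂ x))
    {β : K} (hβ : IsIntegral ℤ β) (hδ : δ₁ + δ₂ + δ₃ = 0)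
    (hδ₁ : δ₁ ^ 2 = σ₁ β) (hδ₂ : δ₂ ^ 2 = σ₂ β) (hδ₃ : δ₃ ^ 2 = σ₃ β) {κ : ℕ} (hκ : 1 ≤ κ)

    (hN : ((|Algebra.norm ℚ β| : ℚ) : ℝ) = 108 * κ) (hd : |(discr K : ℝ)| ≤ 108 * κ)
    {m Y : ℝ} (hm₂ : m ≤ ‖δ₂‖) (hm₃ : m ≤ ‖δ₃‖) (hδ₁m : ‖δ₁‖ ≤ 2 * m) (hδ₂m : ‖δ₂‖ ≤ 3 * m)
    (hδ₃m : ‖δ₃‖ ≤ 3 * m) (hYexp : Real.exp Y = m) {X : ℕ} (hκX : (10 ^ 33 * κ ^ 5 : ℝ) ≤ X)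
    (hXY : (X : ℝ) ≤ Y) (hX : Real.exp (-Y) ≤ Real.exp (-(X : ℝ) ^ 211))
    (hXexp : 28 * (Y * X) ≤ Real.exp X) : False := by
  have hκ' : (1 : ℝ) ≤ κ := by exact_mod_cast hκ
  have hκ5 : (κ : ℝ) ≤ κ ^ 5 := le_self_pow₀ hκ' (by norm_num)
  have hm0 : 0 < m := hYexp ▸ Real.exp_pos Y
  have hβ0 : β ≠ 0 := by
    rintro rfl
    rw [Algebra.norm_zero, abs_zero, Rat.cast_zero] at hN
    linarith
  have hδ₁0 : 0 < ‖δ₁‖ := by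
    rw [norm_pos_iff]
    rintro rfl
    rw [zero_pow two_ne_zero] at hδ₁
    exact hβ0 ((map_eq_zero σ₁).1 hδ₁.symm)
  have hδ₂0 : 0 < ‖δ₂‖ := hm0.trans_le hm₂
  have hδ₃0 : 0 < ‖δ₃‖ := hm0.trans_le hm₃
  set Δ := ‖δ₁‖ * ‖δ₂‖ * ‖δ₃‖ with hΔ
  have hΔ0 : 0 ≤ Δ := by positivity
  have hΔsq : Δ ^ 2 = 108 * κ := by
    rw [← hN, ← norm_mul_norm_mul_norm h₁₂ h₁₃ h₂₃ hσ, ← hδ₁, ← hδ₂, ← hδ₃, norm_pow, norm_pow,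
      norm_pow, hΔ]
    ring
  have hΔ1 : 1 ≤ Δ := by nlinarith
  have hΔκ : Δ ≤ 108 * κ := by nlinarith
  have hYm : Y = Real.log m := by rw [← hYexp, Real.log_exp]
  have hX33 : (10 : ℝ) ^ 33 * κ ≤ X := le_trans (by gcongr) hκX
  have hX33' : (10 : ℝ) ^ 33 ≤ X := le_trans (by linarith) hX33
  have hX32 : (10 : ℝ) ^ 32 ≤ X := le_trans (by norm_num) hX33'
  have hY33 : (10 : ℝ) ^ 33 ≤ Y := hX33'.trans hXY
  have hmY : Y ≤ m := by linarith [Real.add_one_le_exp Y]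
  have hsmall : ‖δ₁‖ / ‖δ₃‖ ≤ Δ / m ^ 3 := by
    rw [div_le_div_iff₀ hδ₃0 (by positivity), hΔ]
    have : m ^ 3 ≤ ‖δ₂‖ * ‖δ₃‖ * ‖δ₃‖ := by
      rw [pow_three, ← mul_assoc]
      gcongr
    nlinarith
  have hmbig : 10 ^ 33 * Δ ≤ 108 * m := by linarith
  have hm1 : 10 ^ 33 ≤ m := by linarith
  have hm3 : 30 * Δ ≤ m ^ 3 := by
    have : m ≤ m ^ 3 := le_self_pow₀ (by linarith) (by norm_num)
    linarith
  have hδ₁lt : ‖δ₁‖ < m := by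
    have h1 : ‖δ₁‖ * (m * m) ≤ Δ := by
      rw [hΔ, mul_assoc]
      gcongr
    have h2 : ‖δ₁‖ * 10 ^ 33 ≤ ‖δ₁‖ * m := by gcongr
    nlinarith
  set U := 3 * (((109 * κ + 1 : ℝ) ^ (3 + 1) + 1) * Real.log (2 * (109 * κ))) with hU
  have hUle : U ≤ 10 ^ 11 * κ ^ 5 := unit_log_bound_le hκ'
  have hU0 : 0 ≤ U := by
    have : 0 ≤ Real.log (2 * (109 * κ)) := Real.log_nonneg (by linarith)
    positivity
  have hunit : ∀ w₁ : InfinitePlace K, ∃ η : (𝓞 K)ˣ,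
      (∀ w : InfinitePlace K, w ≠ w₁ → w (η : K) ≤ 1 / 2) ∧
        ∀ w : InfinitePlace K, |Real.log (w (η : K))| ≤ U := by
    intro w₁
    have hsq : Real.sqrt |(discr K : ℝ)| < (109 * κ : ℕ) := by
      rw [Real.sqrt_lt' (by positivity)]
      push_cast
      nlinarith
    obtain ⟨η, h1, h2⟩ := exists_unit_lt_away_from_place w₁ hsq
    refine ⟨η, h1, fun w => (h2 w).trans (le_of_eq ?_)⟩
    rw [hK, hU]
    push_cast
    rfl
  have hlog3 : Real.log 3 ≤ 2 := by
    linarith [Real.log_le_sub_one_of_pos (show (0 : ℝ) < 3 by norm_num)]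
  have hup : ∀ {t : ℝ}, 0 < t → t ≤ 3 * m → Real.log t ≤ Y + 2 := fun ht h => by
    rw [hYm]
    have := Real.log_le_log ht h
    rw [Real.log_mul (by norm_num) hm0.ne'] at this
    linarith
  have hlo : ∀ {t : ℝ}, m ≤ t → Y ≤ Real.log t := fun h => hYm ▸ Real.log_le_log hm0 h
  have hlogΔ : 0 ≤ Real.log ‖δ₁‖ + Real.log ‖δ₂‖ + Real.log ‖δ₃‖ := by
    rw [← Real.log_mul hδ₁0.ne' hδ₂0.ne', ← Real.log_mul (mul_pos hδ₁0 hδ₂0).ne' hδ₃0.ne']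
    exact Real.log_nonneg hΔ1
  have hR : ∀ φ : K →+* ℂ, |Real.log ‖φ β‖| ≤ 5 * Y := by
    have hdelta : ∀ {δ : ℂ} {φ : K →+* ℂ}, δ ^ 2 = φ β → |Real.log ‖δ‖| ≤ 2 * Y + 4 →
        |Real.log ‖φ β‖| ≤ 5 * Y := fun h h' => by
      rw [← h, norm_pow, Real.log_pow, abs_mul]
      norm_num
      linarith
    intro φ
    have u1 := hup hδ₁0 (by linarith)
    have u2 := hup hδ₂0 hδ₂m
    have u3 := hup hδ₃0 hδ₃m
    have l2 := hlo hm₂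
    have l3 := hlo hm₃
    rcases hσ φ with rfl | rfl | rfl
    · exact hdelta hδ₁ (abs_le.2 ⟨by linarith, by linarith⟩)
    · exact hdelta hδ₂ (abs_le.2 ⟨by linarith, by linarith⟩)
    · exact hdelta hδ₃ (abs_le.2 ⟨by linarith, by linarith⟩)
  have hH : Real.log (108 * κ) ≤ 108 * κ := by
    linarith [Real.log_le_sub_one_of_pos (show (0 : ℝ) < 108 * κ by linarith)]
  have hGX : 6 * (108 * (κ : ℝ) + 4 * U) ≤ X := by linarith
  have hUX : U ≤ X := by linarith
  have hRX : 2 * (5 * Y) * U + 3 * (5 * Y) + 3 ≤ Real.exp X := by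
    have h2 : Y * U ≤ Y * X := by gcongr
    have h3 : Y * 1 ≤ Y * X := by gcongr; linarith
    linarith
  have hsmall' : ‖δ₁‖ / ‖δ₃‖ ≤ 1 / 30 := by
    refine hsmall.trans ?_
    rw [div_le_div_iff₀ (by positivity) (by norm_num)]
    linarith
  have hkey : Real.exp (-(X : ℝ) ^ 211) ≤ 30 * (‖δ₁‖ / ‖δ₃‖) := by
    rcases hcase with ⟨hreal, -⟩ | hconj
    · exact exp_neg_le_of_forall_isReal hK h₁₂ h₁₃ h₂₃ hσ hreal hunit hβ hβ0 hδ hδ₁ hδ₂ hδ₃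
        (hδ₁lt.trans_le hm₂) (hδ₁lt.trans_le hm₃) hsmall' (by positivity) (by rw [hN]; exact hH)
        hR (by exact_mod_cast hX32) hGX hRX
    · exact exp_neg_le_of_conjugate hK h₁₂ h₁₃ h₂₃ hσ hconj hunit hβ hβ0 hδ hδ₁ hδ₂ hδ₃
        (hδ₁lt.trans_le hm₂) (hδ₁lt.trans_le hm₃) hsmall' (by positivity) (by rw [hN]; exact hH)
        hR (by exact_mod_cast hX32) hGX hRX
  have hfin : m⁻¹ ≤ 30 * (Δ / m ^ 3) := calc
    m⁻¹ = Real.exp (-Y) := by rw [Real.exp_neg, hYexp]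
    _ ≤ Real.exp (-(X : ℝ) ^ 211) := hX
    _ ≤ _ := hkey
    _ ≤ _ := by gcongr
  rw [inv_le_iff_one_le_mul₀ hm0] at hfin
  have hfin' : m ^ 2 ≤ 30 * Δ := by
    have : 30 * (Δ / m ^ 3) * m = 30 * Δ / m ^ 2 := by field_simp
    rwa [this, one_le_div (by positivity)] at hfin
  nlinarith

theorem norm_le_exp_of_cubic_ordered (hK : Module.finrank ℚ K = 3) {σ₁ σ₂ σ₃ : K →+* ℂ}
    (h₁₂ : σ₁ ≠ σ₂) (h₁₃ : σ₁ ≠ σ₃) (h₂₃ : σ₂ ≠ σ₃)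
    (hσ : ∀ φ : K →+* ℂ, φ = σ₁ ∨ φ = σ₂ ∨ φ = σ₃) {δ₁ δ₂ δ₃ : ℂ}
    (hcase : ((∀ φ : K →+* ℂ, ComplexEmbedding.IsReal φ) ∧ ‖δ₁‖ ≤ ‖δ₂‖ ∧ ‖δ₁‖ ≤ ‖δ₃‖) ∨
      ∀ x, σ₃ x = starRingEnd ℂ (σ₂ x))
    {β : K} (hβ : IsIntegral ℤ β) (hδ : δ₁ + δ₂ + δ₃ = 0)
    (hδ₁ : δ₁ ^ 2 = σ₁ β) (hδ₂ : δ₂ ^ 2 = σ₂ β) (hδ₃ : δ₃ ^ 2 = σ₃ β) {κ : ℕ} (hκ : 1 ≤ κ)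
    (hN : ((|Algebra.norm ℚ β| : ℚ) : ℝ) = 108 * κ) (hd : |(discr K : ℝ)| ≤ 108 * κ) :
    ‖δ₁‖ ≤ 3 * Real.exp ((10 ^ 33 * κ ^ 5) ^ 211) ∧ ‖δ₂‖ ≤ 3 * Real.exp ((10 ^ 33 * κ ^ 5) ^ 211) ∧
      ‖δ₃‖ ≤ 3 * Real.exp ((10 ^ 33 * κ ^ 5) ^ 211) := by
  have hκ' : (1 : ℝ) ≤ κ := by exact_mod_cast hκ
  have hκ5 : (κ : ℝ) ≤ κ ^ 5 := le_self_pow₀ hκ' (by norm_num)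
  set m := min ‖δ₂‖ ‖δ₃‖ with hm
  have hm₂ : m ≤ ‖δ₂‖ := min_le_left _ _
  have hm₃ : m ≤ ‖δ₃‖ := min_le_right _ _
  have htri₂ : ‖δ₂‖ ≤ ‖δ₁‖ + ‖δ₃‖ := by
    rw [show δ₂ = -(δ₁ + δ₃) by linear_combination hδ, norm_neg]
    exact norm_add_le _ _
  have htri₃ : ‖δ₃‖ ≤ ‖δ₁‖ + ‖δ₂‖ := by
    rw [show δ₃ = -(δ₁ + δ₂) by linear_combination hδ, norm_neg]
    exact norm_add_le _ _
  have htri₁ : ‖δ₁‖ ≤ ‖δ₂‖ + ‖δ₃‖ := by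
    rw [show δ₁ = -(δ₂ + δ₃) by linear_combination hδ, norm_neg]
    exact norm_add_le _ _
  have hδ₁m : ‖δ₁‖ ≤ 2 * m := by
    rcases hcase with ⟨-, h2, h3⟩ | h
    · have := le_min h2 h3
      have h0 := norm_nonneg δ₁
      linarith
    · have h1 : ‖δ₂‖ = ‖δ₃‖ := by
        rw [← sq_eq_sq₀ (norm_nonneg _) (norm_nonneg _), ← norm_pow, ← norm_pow, hδ₂, hδ₃, h,
          Complex.norm_conj]
      rw [hm, ← h1, min_self]
      linarith
  have hδ₂m : ‖δ₂‖ ≤ 3 * m := by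
    rcases min_choice ‖δ₂‖ ‖δ₃‖ with h | h <;> rw [← hm] at h <;> linarith [norm_nonneg δ₁]
  have hδ₃m : ‖δ₃‖ ≤ 3 * m := by
    rcases min_choice ‖δ₂‖ ‖δ₃‖ with h | h <;> rw [← hm] at h <;> linarith [norm_nonneg δ₁]
  suffices hmain : m ≤ Real.exp ((10 ^ 33 * κ ^ 5) ^ 211) by
    refine ⟨?_, ?_, ?_⟩ <;> linarith [norm_nonneg δ₁]
  by_contra! hlt
  have hm0 : 0 < m := (Real.exp_pos _).trans hlt
  have hTY := (Real.lt_log_iff_exp_lt hm0).2 hlt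
  obtain ⟨T, hT⟩ : ∃ T : ℕ, T = 10 ^ 33 * κ ^ 5 := ⟨_, rfl⟩
  have hT' : (10 ^ 33 * κ ^ 5 : ℝ) = T := by
    rw [hT, Nat.cast_mul, Nat.cast_pow, Nat.cast_pow, Nat.cast_ofNat]
  rw [hT'] at hTY
  have hT1 : (10 : ℝ) ^ 33 ≤ T := by
    rw [← hT']
    exact le_mul_of_one_le_right (by positivity) (one_le_pow₀ hκ')
  obtain ⟨X, hTX, hX, hXexp⟩ := exists_nat_height (le_trans (by norm_num) hT1) hTY.le
  refine false_of_cubic_of_large hK h₁₂ h₁₃ h₂₃ hσ hcase hβ hδ hδ₁ hδ₂ hδ₃ hκ hN hd hm₂ hm₃ hδ₁m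
    hδ₂m hδ₃m (Real.exp_log hm0) (hT'.trans_le hTX) ?_ hX hXexp
  exact (le_self_pow₀ (le_trans (by norm_num) (hT1.trans hTX)) (by decide)).trans
    (neg_le_neg_iff.1 (Real.exp_le_exp.1 hX))

end Bound

section Symmetric

open NumberField

variable {K : Type*} [Field K] [NumberField K]

theorem norm_le_exp_of_cubic (hK : Module.finrank ℚ K = 3) {σ₁ σ₂ σ₃ : K →+* ℂ}
    (h₁₂ : σ₁ ≠ σ₂) (h₁₃ : σ₁ ≠ σ₃) (h₂₃ : σ₂ ≠ σ₃)
    (hσ : ∀ φ : K →+* ℂ, φ = σ₁ ∨ φ = σ₂ ∨ φ = σ₃) {δ₁ δ₂ δ₃ : ℂ}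
    {β : K} (hβ : IsIntegral ℤ β) (hδ : δ₁ + δ₂ + δ₃ = 0)
    (hδ₁ : δ₁ ^ 2 = σ₁ β) (hδ₂ : δ₂ ^ 2 = σ₂ β) (hδ₃ : δ₃ ^ 2 = σ₃ β) {κ : ℕ} (hκ : 1 ≤ κ)
    (hN : ((|Algebra.norm ℚ β| : ℚ) : ℝ) = 108 * κ) (hd : |(discr K : ℝ)| ≤ 108 * κ) :
    ‖δ₁‖ ≤ 3 * Real.exp ((10 ^ 33 * κ ^ 5) ^ 211) ∧ ‖δ₂‖ ≤ 3 * Real.exp ((10 ^ 33 * κ ^ 5) ^ 211) ∧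
      ‖δ₃‖ ≤ 3 * Real.exp ((10 ^ 33 * κ ^ 5) ^ 211) := by
  have hσ' : ∀ φ : K →+* ℂ, φ = σ₂ ∨ φ = σ₃ ∨ φ = σ₁ := fun φ => by
    rcases hσ φ with h | h | h <;> simp [h]
  have hσ'' : ∀ φ : K →+* ℂ, φ = σ₃ ∨ φ = σ₁ ∨ φ = σ₂ := fun φ => by
    rcases hσ φ with h | h | h <;> simp [h]
  have hδ' : δ₂ + δ₃ + δ₁ = 0 := by linear_combination hδ
  have hδ'' : δ₃ + δ₁ + δ₂ = 0 := by linear_combination hδ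
  have key₁ := fun h => norm_le_exp_of_cubic_ordered hK h₁₂ h₁₃ h₂₃ hσ h hβ hδ hδ₁ hδ₂ hδ₃ hκ hN hd
  have key₂ := fun h => norm_le_exp_of_cubic_ordered hK h₂₃ h₁₂.symm h₁₃.symm hσ' h hβ hδ'
    hδ₂ hδ₃ hδ₁ hκ hN hd
  have key₃ := fun h => norm_le_exp_of_cubic_ordered hK h₁₃.symm h₂₃.symm h₁₂ hσ'' h hβ hδ''
    hδ₃ hδ₁ hδ₂ hκ hN hd
  by_cases hreal : ∀ φ : K →+* ℂ, ComplexEmbedding.IsReal φ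
  · rcases le_total ‖δ₁‖ ‖δ₂‖ with h | h <;> rcases le_total ‖δ₁‖ ‖δ₃‖ with h' | h' <;>
      rcases le_total ‖δ₂‖ ‖δ₃‖ with h'' | h''
    · exact key₁ (.inl ⟨hreal, h, h'⟩)
    · exact key₁ (.inl ⟨hreal, h, h'⟩)
    · exact key₁ (.inl ⟨hreal, h, h.trans h''⟩)
    · obtain ⟨b₃, b₁, b₂⟩ := key₃ (.inl ⟨hreal, h', h''⟩)
      exact ⟨b₁, b₂, b₃⟩
    · obtain ⟨b₂, b₃, b₁⟩ := key₂ (.inl ⟨hreal, h'', h⟩)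
      exact ⟨b₁, b₂, b₃⟩
    · exact key₁ (.inl ⟨hreal, h'.trans h'', h'⟩)
    · obtain ⟨b₂, b₃, b₁⟩ := key₂ (.inl ⟨hreal, h'', h⟩)
      exact ⟨b₁, b₂, b₃⟩
    · obtain ⟨b₃, b₁, b₂⟩ := key₃ (.inl ⟨hreal, h', h''⟩)
      exact ⟨b₁, b₂, b₃⟩
  · push Not at hreal
    obtain ⟨φ, hφ⟩ := hreal
    rw [ComplexEmbedding.isReal_iff] at hφ
    have hc : ∀ {φ ψ : K →+* ℂ}, ComplexEmbedding.conjugate φ = ψ →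
        (∀ x, ψ x = starRingEnd ℂ (φ x)) ∧ ∀ x, φ x = starRingEnd ℂ (ψ x) := by
      rintro φ ψ rfl
      exact ⟨fun x => rfl, fun x => (Complex.conj_conj _).symm⟩
    rcases hσ φ with rfl | rfl | rfl <;> rcases hσ (ComplexEmbedding.conjugate φ) with h | h | h
    · exact absurd h hφ
    · obtain ⟨b₃, b₁, b₂⟩ := key₃ (.inr (hc h).1)
      exact ⟨b₁, b₂, b₃⟩
    · obtain ⟨b₂, b₃, b₁⟩ := key₂ (.inr (hc h).2)
      exact ⟨b₁, b₂, b₃⟩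
    · obtain ⟨b₃, b₁, b₂⟩ := key₃ (.inr (hc h).2)
      exact ⟨b₁, b₂, b₃⟩
    · exact absurd h hφ
    · exact key₁ (.inr (hc h).1)
    · obtain ⟨b₂, b₃, b₁⟩ := key₂ (.inr (hc h).1)
      exact ⟨b₁, b₂, b₃⟩
    · exact key₁ (.inr (hc h).2)
    · exact absurd h hφ

end Symmetric

section Discriminant

open NumberField

variable {K : Type*} [Field K] [NumberField K]

theorem exists_sq_mul_discr_eq (hK : Module.finrank ℚ K = 3) {σ₁ σ₂ σ₃ : K →+* ℂ}
    (h₁₂ : σ₁ ≠ σ₂) (h₁₃ : σ₁ ≠ σ₃) (h₂₃ : σ₂ ≠ σ₃)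
    (hσ : ∀ φ : K →+* ℂ, φ = σ₁ ∨ φ = σ₂ ∨ φ = σ₃) {θ : K} (hθ : IsIntegral ℤ θ) :
    ∃ n : ℤ, (n : ℂ) ^ 2 * (discr K : ℂ) =
      ((σ₂ θ - σ₃ θ) * (σ₃ θ - σ₁ θ) * (σ₁ θ - σ₂ θ)) ^ 2 := by
  classical
  obtain ⟨t, rfl⟩ : ∃ t : 𝓞 K, (t : K) = θ := ⟨⟨θ, hθ⟩, rfl⟩
  have hcard : Fintype.card (Module.Free.ChooseBasisIndex ℤ (𝓞 K)) = Fintype.card (Fin 3) := by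
    rw [← Module.finrank_eq_card_chooseBasisIndex, RingOfIntegers.rank, hK, Fintype.card_fin]
  let e₀ := Fintype.equivOfCardEq hcard
  let b := (integralBasis K).reindex e₀
  let v : Fin 3 → 𝓞 K := ![1, t, t ^ 2]
  let v' : Fin 3 → K := fun i => (v i : K)
  let P : Matrix (Fin 3) (Fin 3) ℤ := fun i j => (RingOfIntegers.basis K).repr (v j) (e₀.symm i)
  have hP : b.toMatrix v' = P.map (Int.castRingHom ℚ) := by
    ext i j
    rw [Module.Basis.toMatrix_apply, Module.Basis.repr_reindex, Finsupp.mapDomain_equiv_apply]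
    exact integralBasis_repr_apply K (v j) (e₀.symm i)
  let s : Fin 3 → (K →ₐ[ℚ] ℂ) := ![σ₁.toRatAlgHom, σ₂.toRatAlgHom, σ₃.toRatAlgHom]
  have hs : Function.Bijective s := by
    have hinj : ∀ {φ ψ : K →+* ℂ}, φ ≠ ψ → φ.toRatAlgHom ≠ ψ.toRatAlgHom := fun h h' =>
      h (RingHom.ext fun x => DFunLike.congr_fun h' x)
    constructor
    · intro i j hij
      fin_cases i <;> fin_cases j <;>
        simp [s, hinj h₁₂, hinj h₁₃, hinj h₂₃, (hinj h₁₂).symm, (hinj h₁₃).symm,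
          (hinj h₂₃).symm] at hij ⊢
    · intro φ
      rcases hσ φ.toRingHom with h | h | h
      · exact ⟨0, AlgHom.ext fun x => (RingHom.congr_fun h x).symm⟩
      · exact ⟨1, AlgHom.ext fun x => (RingHom.congr_fun h x).symm⟩
      · exact ⟨2, AlgHom.ext fun x => (RingHom.congr_fun h x).symm⟩
  have hdiscr : Algebra.discr ℚ v' = (P.det : ℚ) ^ 2 * (discr K : ℚ) := by
    rw [← b.toMatrix_map_vecMul v', Algebra.discr_of_matrix_vecMul, coe_discr, hP,
      ← RingHom.mapMatrix_apply, ← RingHom.map_det, eq_intCast, Module.Basis.coe_reindex,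
      Algebra.discr_reindex]
  refine ⟨P.det, ?_⟩
  have h := Algebra.discr_eq_det_embeddingsMatrixReindex_pow_two ℚ ℂ v' (Equiv.ofBijective s hs)
  rw [hdiscr, Matrix.det_fin_three (Algebra.embeddingsMatrixReindex _ _ _ _)] at h
  simp only [Algebra.embeddingsMatrixReindex, Algebra.embeddingsMatrix, Matrix.reindex_apply,
    Matrix.submatrix_apply, Matrix.of_apply, Equiv.refl_symm, Equiv.refl_apply, Equiv.symm_symm,
    Equiv.ofBijective_apply] at h
  simp only [s, v', v, Matrix.cons_val, RingHom.toRatAlgHom_apply, map_mul, map_pow, map_one,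
    map_intCast] at h
  rw [h]
  ring

theorem abs_discr_le_of_cubic (hK : Module.finrank ℚ K = 3) {σ₁ σ₂ σ₃ : K →+* ℂ}
    (h₁₂ : σ₁ ≠ σ₂) (h₁₃ : σ₁ ≠ σ₃) (h₂₃ : σ₂ ≠ σ₃)
    (hσ : ∀ φ : K →+* ℂ, φ = σ₁ ∨ φ = σ₂ ∨ φ = σ₃) {θ : K} (hθ : IsIntegral ℤ θ)
    (h₁₂' : σ₁ θ ≠ σ₂ θ) (h₁₃' : σ₁ θ ≠ σ₃ θ) (h₂₃' : σ₂ θ ≠ σ₃ θ) :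
    |(discr K : ℝ)| ≤ ‖(σ₂ θ - σ₃ θ) * (σ₃ θ - σ₁ θ) * (σ₁ θ - σ₂ θ)‖ ^ 2 := by
  obtain ⟨n, hn⟩ := exists_sq_mul_discr_eq hK h₁₂ h₁₃ h₂₃ hσ hθ
  have hn0 : n ≠ 0 := by
    rintro rfl
    rw [Int.cast_zero, zero_pow two_ne_zero, zero_mul] at hn
    exact pow_ne_zero 2 (mul_ne_zero (mul_ne_zero (sub_ne_zero.2 h₂₃') (sub_ne_zero.2 h₁₃'.symm))
      (sub_ne_zero.2 h₁₂')) hn.symm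
  rw [← norm_pow, ← hn, norm_mul, norm_pow, Complex.norm_intCast, Complex.norm_intCast]
  exact le_mul_of_one_le_left (abs_nonneg _)
    (one_le_pow₀ (by exact_mod_cast Int.one_le_abs hn0))

end Discriminant

section Mordell

open NumberField Polynomial

theorem exists_three_embeddings {K : Type*} [Field K] [NumberField K]
    (hK : Module.finrank ℚ K = 3) :
    ∃ σ₁ σ₂ σ₃ : K →+* ℂ, σ₁ ≠ σ₂ ∧ σ₁ ≠ σ₃ ∧ σ₂ ≠ σ₃ ∧
      ∀ φ : K →+* ℂ, φ = σ₁ ∨ φ = σ₂ ∨ φ = σ₃ := by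
  classical
  have hcard : (Finset.univ : Finset (K →+* ℂ)).card = 3 := by
    rw [Finset.card_univ, NumberField.Embeddings.card, hK]
  obtain ⟨σ₁, σ₂, σ₃, h₁₂, h₁₃, h₂₃, h⟩ := Finset.card_eq_three.1 hcard
  refine ⟨σ₁, σ₂, σ₃, h₁₂, h₁₃, h₂₃, fun φ => ?_⟩
  have := Finset.mem_univ φ
  rw [h] at this
  simpa using this

/-- The data attached to three distinct roots of `T ^ 3 - 3 * X * T - 2 * Y`. -/
theorem depressed_cubic_identities {X Y a b c : ℂ} (hab : a ≠ b) (hac : a ≠ c) (hbc : b ≠ c)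
    (ha : a ^ 3 = 3 * X * a + 2 * Y) (hb : b ^ 3 = 3 * X * b + 2 * Y)
    (hc : c ^ 3 = 3 * X * c + 2 * Y) :
    (b - c) ^ 2 = 12 * X - 3 * a ^ 2 ∧ (c - a) ^ 2 = 12 * X - 3 * b ^ 2 ∧
      (a - b) ^ 2 = 12 * X - 3 * c ^ 2 ∧
      ((b - c) * (c - a) * (a - b)) ^ 2 = 108 * (X ^ 3 - Y ^ 2) ∧
      (b - c) ^ 2 + (c - a) ^ 2 + (a - b) ^ 2 = 18 * X := by
  have h1 : a ^ 2 + a * b + b ^ 2 = 3 * X :=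
    mul_left_cancel₀ (sub_ne_zero.2 hab) (by linear_combination ha - hb)
  have h2 : a ^ 2 + a * c + c ^ 2 = 3 * X :=
    mul_left_cancel₀ (sub_ne_zero.2 hac) (by linear_combination ha - hc)
  have h3 : c = -a - b :=
    mul_left_cancel₀ (sub_ne_zero.2 hbc) (by linear_combination h1 - h2)
  obtain rfl : X = (a ^ 2 + a * b + b ^ 2) / 3 := by linear_combination -h1 / 3
  obtain rfl : Y = -(a * b * (a + b)) / 2 := by linear_combination -ha / 2
  subst h3
  refine ⟨?_, ?_, ?_, ?_, ?_⟩ <;> ring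

theorem abs_le_two_mul_exp_of_root {K : Type*} [Field K] [NumberField K]
    (hK : Module.finrank ℚ K = 3) {x y k : ℤ} (hk : k ≠ 0) (h : y ^ 2 = x ^ 3 + k) {θ : K}
    (hroot : θ ^ 3 = 3 * (x : K) * θ + 2 * (y : K))
    (hinj : ∀ φ ψ : K →+* ℂ, φ θ = ψ θ → φ = ψ) :
    |(x : ℝ)| ≤ 2 * Real.exp ((10 ^ 33 * |(k : ℝ)| ^ 5) ^ 211) ^ 2 := by
  obtain ⟨σ₁, σ₂, σ₃, h₁₂, h₁₃, h₂₃, hσ⟩ := exists_three_embeddings hK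
  have hθ : IsIntegral ℤ θ := by
    refine ⟨X ^ 3 - (C (3 * x) * X + C (2 * y)), by monicity!, ?_⟩
    rw [eval₂_sub, eval₂_add, eval₂_mul, eval₂_pow, eval₂_X, eval₂_C, eval₂_C, map_mul, map_mul,
      map_ofNat, map_ofNat, eq_intCast, eq_intCast, hroot, sub_self]
  have hmap : ∀ φ : K →+* ℂ, φ θ ^ 3 = 3 * (x : ℂ) * φ θ + 2 * (y : ℂ) := fun φ => by
    have := congr_arg φ hroot
    simpa only [map_pow, map_add, map_mul, map_ofNat, map_intCast] using this
  have h₁₂' : σ₁ θ ≠ σ₂ θ := fun h => h₁₂ (hinj _ _ h)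
  have h₁₃' : σ₁ θ ≠ σ₃ θ := fun h => h₁₃ (hinj _ _ h)
  have h₂₃' : σ₂ θ ≠ σ₃ θ := fun h => h₂₃ (hinj _ _ h)
  obtain ⟨e₁, e₂, e₃, ed, es⟩ := depressed_cubic_identities h₁₂' h₁₃' h₂₃' (hmap σ₁) (hmap σ₂)
    (hmap σ₃)
  set β : K := 12 * (x : K) - 3 * θ ^ 2 with hβ
  have hβint : IsIntegral ℤ β := by
    have h12 : IsIntegral ℤ (12 * (x : K)) := by
      simpa using isIntegral_algebraMap (R := ℤ) (A := K) (x := 12 * x)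
    have h3 : IsIntegral ℤ (3 : K) := by
      simpa using isIntegral_algebraMap (R := ℤ) (A := K) (x := 3)
    exact h12.sub (h3.mul (hθ.pow 2))
  have hβmap : ∀ φ : K →+* ℂ, φ β = 12 * (x : ℂ) - 3 * φ θ ^ 2 := fun φ => by
    simp only [hβ, map_sub, map_mul, map_pow, map_ofNat, map_intCast]
  rw [← hβmap] at e₁ e₂ e₃
  have hprod : ‖(σ₂ θ - σ₃ θ) * (σ₃ θ - σ₁ θ) * (σ₁ θ - σ₂ θ)‖ ^ 2 = 108 * (k.natAbs : ℝ) := by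
    have hxy : (x : ℂ) ^ 3 - (y : ℂ) ^ 2 = ((-k : ℤ) : ℂ) := by
      have : x ^ 3 - y ^ 2 = -k := by linarith
      exact_mod_cast this
    rw [← norm_pow, ed, hxy, norm_mul, Complex.norm_intCast, Nat.cast_natAbs]
    simp
  have hnorm : ((|Algebra.norm ℚ β| : ℚ) : ℝ) = 108 * (k.natAbs : ℝ) := by
    rw [← norm_mul_norm_mul_norm h₁₂ h₁₃ h₂₃ hσ, ← e₁, ← e₂, ← e₃, ← hprod, ← norm_mul, ← norm_mul,
      ← norm_pow, mul_pow, mul_pow]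
  have hdisc := (abs_discr_le_of_cubic hK h₁₂ h₁₃ h₂₃ hσ hθ h₁₂' h₁₃' h₂₃').trans_eq hprod
  obtain ⟨b₁, b₂, b₃⟩ := norm_le_exp_of_cubic hK h₁₂ h₁₃ h₂₃ hσ hβint (by ring) e₁ e₂ e₃
    (Int.natAbs_pos.2 hk) hnorm hdisc
  have hkabs : (k.natAbs : ℝ) = |(k : ℝ)| := by rw [Nat.cast_natAbs, Int.cast_abs]
  rw [hkabs] at b₁ b₂ b₃
  generalize Real.exp ((10 ^ 33 * |(k : ℝ)| ^ 5) ^ 211) = E at b₁ b₂ b₃ ⊢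
  have hx : 18 * |(x : ℝ)| = ‖(18 : ℂ) * (x : ℂ)‖ := by
    rw [norm_mul, Complex.norm_intCast]
    simp
  have hsum : 18 * |(x : ℝ)| ≤ (3 * E) ^ 2 + (3 * E) ^ 2 + (3 * E) ^ 2 := by
    rw [hx, ← es]
    refine (norm_add₃_le).trans ?_
    rw [norm_pow, norm_pow, norm_pow]
    gcongr
  nlinarith [sq_nonneg E]

theorem abs_le_of_int_root {x y k t : ℤ} (hk : k ≠ 0) (h : y ^ 2 = x ^ 3 + k)
    (ht : t ^ 3 = 3 * x * t + 2 * y) : |x| ≤ 24 * |k| := by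
  have hprod : (12 * x - 3 * t ^ 2) * (3 * t ^ 2 - 3 * x) ^ 2 = -108 * k := by
    have hy : 2 * y = t ^ 3 - 3 * x * t := by linarith
    have h4 : 4 * k = (t ^ 3 - 3 * x * t) ^ 2 - 4 * x ^ 3 := by rw [← hy]; linarith
    linear_combination 27 * h4
  set A := 12 * x - 3 * t ^ 2 with hA
  set B := 3 * t ^ 2 - 3 * x with hB
  have hB0 : B ≠ 0 := by
    rintro h0
    rw [h0] at hprod
    omega
  have hA0 : A ≠ 0 := by
    rintro h0
    rw [h0] at hprod
    omega
  have habs : |A| * |B| ^ 2 = 108 * |k| := by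
    rw [← abs_pow, ← abs_mul, hprod, abs_mul]
    rfl
  have hA1 := Int.one_le_abs hA0
  have hB1 := Int.one_le_abs hB0
  have h9 : 9 * |x| ≤ |A| + |B| := by
    have : A + B = 9 * x := by rw [hA, hB]; ring
    rw [show 9 * |x| = |9 * x| by rw [abs_mul]; rfl, ← this]
    exact abs_add_le A B
  have h1 : |A| ≤ 108 * |k| :=
    (le_mul_of_one_le_right (abs_nonneg A) (one_le_pow₀ hB1)).trans_eq habs
  have h2 : |B| ≤ 108 * |k| := by nlinarith
  linarith

theorem abs_le_two_mul_exp {x y k : ℤ} (hk : k ≠ 0) (h : y ^ 2 = x ^ 3 + k) :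
    |(x : ℝ)| ≤ 2 * Real.exp ((10 ^ 33 * |(k : ℝ)| ^ 5) ^ 211) ^ 2 := by
  set f : ℤ[X] := X ^ 3 - (C (3 * x) * X + C (2 * y)) with hf
  have hmonic : f.Monic := by rw [hf]; monicity!
  have hdeg : f.natDegree = 3 := by rw [hf]; compute_degree!
  set g : ℚ[X] := f.map (Int.castRingHom ℚ) with hg
  have hgmonic : g.Monic := hmonic.map _
  have hgdeg : g.natDegree = 3 := by rw [hg, hmonic.natDegree_map, hdeg]
  by_cases hirr : Irreducible g
  · have := Fact.mk hirr
    have hg0 := hirr.ne_zero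
    have : FiniteDimensional ℚ (AdjoinRoot g) := (AdjoinRoot.powerBasis hg0).finite
    have : NumberField (AdjoinRoot g) := { }
    have hK : Module.finrank ℚ (AdjoinRoot g) = 3 := by
      rw [(AdjoinRoot.powerBasis hg0).finrank, AdjoinRoot.powerBasis_dim hg0, hgdeg]
    refine abs_le_two_mul_exp_of_root hK hk h (θ := AdjoinRoot.root g) ?_ fun φ ψ hφψ => ?_
    · have hroot : eval₂ ((AdjoinRoot.of g).comp (Int.castRingHom ℚ)) (AdjoinRoot.root g)
        f = 0 := by
        rw [← eval₂_map]
        exact AdjoinRoot.eval₂_root g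
      rw [hf, eval₂_sub, eval₂_add, eval₂_mul, eval₂_pow, eval₂_X, eval₂_C, eval₂_C, map_mul,
        map_mul, map_ofNat, map_ofNat, eq_intCast, eq_intCast] at hroot
      exact sub_eq_zero.1 hroot
    · have : φ.toRatAlgHom = ψ.toRatAlgHom := AdjoinRoot.algHom_ext hφψ
      exact RingHom.ext fun z => DFunLike.congr_fun this z
  · rw [hgmonic.irreducible_iff_roots_eq_zero_of_degree_le_three (by omega) (by omega)] at hirr
    obtain ⟨r, hr⟩ := Multiset.exists_mem_of_ne_zero hirr
    have hr' : aeval r f = 0 := by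
      have := (mem_roots'.1 hr).2
      rwa [hg, IsRoot, eval_map, ← algebraMap_int_eq, ← aeval_def] at this
    obtain ⟨t, rfl⟩ := isInteger_of_is_root_of_monic hmonic hr'
    have ht : t ^ 3 = 3 * x * t + 2 * y := by
      rw [aeval_algebraMap_apply, map_eq_zero_iff _ (algebraMap ℤ ℚ).injective_int, hf] at hr'
      simp only [map_sub, map_add, map_mul, map_pow, aeval_X, eq_intCast] at hr'
      exact sub_eq_zero.1 (by simpa using hr')
    have hk1 : (1 : ℝ) ≤ |(k : ℝ)| := by exact_mod_cast Int.one_le_abs hk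
    have hx : |(x : ℝ)| ≤ 24 * |(k : ℝ)| := by exact_mod_cast abs_le_of_int_root hk h ht
    have hS : 10 ^ 33 * |(k : ℝ)| ≤ 10 ^ 33 * |(k : ℝ)| ^ 5 := by
      gcongr
      exact le_self_pow₀ hk1 (by norm_num)
    have hT : 10 ^ 33 * |(k : ℝ)| ^ 5 ≤ (10 ^ 33 * |(k : ℝ)| ^ 5) ^ 211 :=
      le_self_pow₀ (le_trans (by linarith) hS) (by decide)
    generalize (10 ^ 33 * |(k : ℝ)| ^ 5) ^ 211 = T at hT ⊢
    have hE := Real.add_one_le_exp T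
    have hE2 : Real.exp T ≤ Real.exp T ^ 2 := le_self_pow₀ (by linarith) two_ne_zero
    linarith

theorem mul_pow_le_pow {S T : ℝ} (hT : 6 ≤ T) (hS0 : 0 ≤ S) (hST : S ≤ T ^ 5) {m n : ℕ}
    (hmn : 5 * m + 1 ≤ n) : 6 * S ^ m ≤ T ^ n :=
  calc 6 * S ^ m ≤ T * (T ^ 5) ^ m := by gcongr
    _ = T ^ (5 * m + 1) := by rw [← pow_mul, pow_succ, mul_comm]
    _ ≤ T ^ n := pow_le_pow_right₀ (by linarith) hmn

theorem max_abs_le_exp {x y k : ℤ} {T : ℝ} (h : y ^ 2 = x ^ 3 + k) (hT : 10 * |(k : ℝ)| ≤ T)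
    (hT1 : 10 ≤ T)
    (hx : |(x : ℝ)| ≤ 2 * Real.exp T ^ 2) : max |(x : ℝ)| |(y : ℝ)| ≤ Real.exp (6 * T) := by
  have hE := Real.add_one_le_exp T
  have hE6 : Real.exp (6 * T) = (Real.exp T ^ 3) ^ 2 := by
    rw [← pow_mul, ← Real.exp_nat_mul]
    norm_num
  rw [hE6]
  set E := Real.exp T
  have hE0 : 0 < E := Real.exp_pos T
  have hA : |(x : ℝ)| ≤ E ^ 3 := by nlinarith [sq_nonneg E]
  have hEA : E ≤ E ^ 3 := le_self_pow₀ (by linarith) (by norm_num)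
  generalize E ^ 3 = A at hA hEA ⊢
  have hA1 : 1 ≤ A := by linarith
  refine max_le (hA.trans (le_self_pow₀ hA1 two_ne_zero)) ?_
  refine abs_le_of_sq_le_sq ?_ (by positivity)
  have hy : (y : ℝ) ^ 2 = (x : ℝ) ^ 3 + k := by exact_mod_cast h
  have hx3 : (x : ℝ) ^ 3 ≤ A ^ 3 :=
    (le_abs_self _).trans ((abs_pow (x : ℝ) 3).trans_le (by gcongr))
  have hk' : (k : ℝ) ≤ A := by linarith [le_abs_self (k : ℝ)]
  have hA3 : A ≤ A ^ 3 := le_self_pow₀ hA1 (by norm_num)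
  calc (y : ℝ) ^ 2 ≤ 2 * A ^ 3 := by linarith
    _ ≤ A * A ^ 3 := by gcongr; linarith
    _ = (A ^ 2) ^ 2 := by ring

end Mordell

/-- **Baker's effective bound for the Mordell equation (1968).**
For every nonzero integer `k`, all integers `x`, `y` with `y² = x³ + k` satisfy
`max {|x|, |y|} ≤ exp((10¹⁰ |k|)^10000)`. -/
theorem baker_mordell_bound (k : ℤ) (hk : k ≠ 0) (x y : ℤ) (h : y ^ 2 = x ^ 3 + k) :
    ((max |x| |y| : ℤ) : ℝ) ≤ Real.exp (((10 : ℝ) ^ 10 * |(k : ℝ)|) ^ 10000) := by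
  have hx := abs_le_two_mul_exp hk h
  have hκ : (1 : ℝ) ≤ |(k : ℝ)| := by exact_mod_cast Int.one_le_abs hk
  have hS : (10 : ℝ) ^ 33 * |(k : ℝ)| ^ 5 ≤ (10 ^ 10 * |(k : ℝ)|) ^ 5 := by
    rw [mul_pow, ← pow_mul]
    gcongr <;> norm_num
  have hk5 : |(k : ℝ)| ≤ |(k : ℝ)| ^ 5 := le_self_pow₀ hκ (by norm_num)
  have h33 : 10 ^ 33 * |(k : ℝ)| ≤ (10 : ℝ) ^ 33 * |(k : ℝ)| ^ 5 := by gcongr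
  have h6 : 6 * ((10 : ℝ) ^ 33 * |(k : ℝ)| ^ 5) ^ 211 ≤ (10 ^ 10 * |(k : ℝ)|) ^ 10000 :=
    mul_pow_le_pow (le_trans (by norm_num) (le_mul_of_one_le_right (by positivity) hκ))
      (by positivity) hS (by decide)
  have hT : (10 : ℝ) ^ 33 * |(k : ℝ)| ^ 5 ≤ (10 ^ 33 * |(k : ℝ)| ^ 5) ^ 211 :=
    le_self_pow₀ (le_trans (by linarith) h33) (by decide)
  rw [Int.cast_max, Int.cast_abs, Int.cast_abs]
  refine (max_abs_le_exp h ?_ ?_ hx).trans (Real.exp_le_exp.2 h6) <;> refine le_trans ?_ hT <;>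
    linarith
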